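/- arXiv:1704.04778 — 4 statements merged into one kernel-verified Lean document; each statement's English description precedes it below -/
import Mathlib

section
/- Let μ be a positive, translation bounded, strongly almost periodic Radon measure on ℝ^d, and let c : ℝ^d → ℂ be its Fourier–Bohr coefficients, i.e., for every χ ∈ ℝ^d the limit lim_{R→∞} vol(B_R)⁻¹ ∫_{B_R} e^{−2πi⟨χ,t⟩} dμ(t) exists and equals c(χ). Then μ is positive definite — meaning that for every continuous compactly supported f : ℝ^d → ℂ the number ∫_{ℝ^d} (f * f̃)(t) dμ(t) is a nonnegative real — if and only if c(χ) is a nonnegative real number for every χ ∈ ℝ^d and c is translation bounded, i.e., for every compact K ⊆ ℝ^d, sup_{t ∈ ℝ^d} ∑_{χ ∈ t+K} ‖c(χ)‖ < ∞. -/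
open MeasureTheory Metric Filter
open scoped Pointwise FourierTransform RealInnerProductSpace ENNReal Topology

noncomputable section

/-- A bounded continuous function is Bohr (strongly) almost periodic if its set of translates is
totally bounded in the supremum norm (expressed via finite `ε`-nets of translates). -/
def IsBohrAlmostPeriodic {d : ℕ} (F : EuclideanSpace ℝ (Fin d) → ℂ) : Prop :=
  Continuous F ∧ (∃ C : ℝ, ∀ t, ‖F t‖ ≤ C) ∧
    ∀ ε : ℝ, 0 < ε → ∃ S : Finset (EuclideanSpace ℝ (Fin d)),
      ∀ s : EuclideanSpace ℝ (Fin d), ∃ s₀ ∈ S,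
        ∀ t : EuclideanSpace ℝ (Fin d), ‖F (t - s) - F (t - s₀)‖ ≤ ε

/-- `c χ` is the Fourier–Bohr coefficient of `μ` at `χ`. -/
def IsFourierBohrCoeff {d : ℕ} (μ : Measure (EuclideanSpace ℝ (Fin d)))
    (χ : EuclideanSpace ℝ (Fin d)) (a : ℂ) : Prop :=
  Tendsto (fun R : ℝ =>
      ((volume (ball (0 : EuclideanSpace ℝ (Fin d)) R)).toReal)⁻¹ •
        ∫ t in ball (0 : EuclideanSpace ℝ (Fin d)) R,
          Complex.exp (((-(2 * Real.pi * ⟪χ, t⟫)) : ℝ) * Complex.I) ∂μ)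
    atTop (𝓝 a)


theorem gelfand_char {H : Type*} [NormedAddCommGroup H] [InnerProductSpace ℂ H] [CompleteSpace H]
    {X : Type*} [AddCommGroup X] [TopologicalSpace X]
    (T : X → H →L[ℂ] H) (hT0 : T 0 = 1) (hTadd : ∀ s t, T (s + t) = T s * T t)
    (hTstar : ∀ s, star (T s) = T (-s)) (C : H →L[ℂ] H) (hC : star C = C)
    (hTC : ∀ s, T s * C = C * T s) (hcont : Continuous fun s => T s * C)
    (x : X) (hx : T x * C ≠ C) :
    ∃ χ : X → ℂ, Continuous χ ∧ (∀ s t, χ (s + t) = χ s * χ t) ∧ (∀ s, ‖χ s‖ = 1) ∧ χ x ≠ 1 := by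
  classical
  set S : Set (H →L[ℂ] H) := insert C (Set.range T) with hS
  have hTT : ∀ s t, T s * T t = T t * T s := fun s t => by
    rw [← hTadd, ← hTadd, add_comm]
  have hstarS : ∀ a ∈ S, star a ∈ S := by
    rintro a (rfl | ⟨s, rfl⟩)
    · rw [hC]; exact Set.mem_insert _ _
    · rw [hTstar]; exact Set.mem_insert_of_mem _ ⟨_, rfl⟩
  have hcomm : ∀ a ∈ S, ∀ b ∈ S, a * b = b * a := by
    rintro a (rfl | ⟨s, rfl⟩) b (rfl | ⟨t, rfl⟩)
    · rfl
    · exact (hTC t).symm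
    · exact hTC s
    · exact hTT s t
  letI inst1 : CommRing (StarAlgebra.adjoin ℂ S) :=
    StarAlgebra.adjoinCommRingOfComm ℂ hcomm (fun a ha b hb => hcomm a ha _ (hstarS b hb))
  set A := (StarAlgebra.adjoin ℂ S).topologicalClosure with hA
  have hmul : ∀ a b : A, a * b = b * a := by
    letI : CommRing A := StarSubalgebra.commRingTopologicalClosure _ (fun a b => mul_comm a b)
    exact fun a b => mul_comm a b
  haveI : IsClosed (A : Set (H →L[ℂ] H)) := StarSubalgebra.isClosed_topologicalClosure _
  letI : CStarAlgebra A := inferInstance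
  letI : CommCStarAlgebra A := { (inferInstance : CStarAlgebra A) with mul_comm := hmul }
  have hmem : ∀ a ∈ S, a ∈ A := fun a ha =>
    StarSubalgebra.le_topologicalClosure _ (StarAlgebra.subset_adjoin ℂ S ha)
  let t : X → A := fun s => ⟨T s, hmem _ (Set.mem_insert_of_mem _ ⟨s, rfl⟩)⟩
  let c : A := ⟨C, hmem _ (Set.mem_insert _ _)⟩
  have hne : t x * c ≠ c := fun h => hx (congrArg Subtype.val h)
  have hinj := (gelfandTransform_bijective A).1
  obtain ⟨ψ, hψ⟩ : ∃ ψ : WeakDual.characterSpace ℂ A, ψ (t x * c) ≠ ψ c := by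
    by_contra! hcon
    apply hne
    apply hinj
    ext ψ
    exact hcon ψ
  have hadd : ∀ s u, t (s + u) = t s * t u := fun s u => Subtype.ext (hTadd s u)
  have h0 : t 0 = 1 := Subtype.ext hT0
  have hst : ∀ s, star (t s) = t (-s) := fun s => Subtype.ext (hTstar s)
  rw [map_mul] at hψ
  have hψc : ψ c ≠ 0 := by
    intro h; simp [h] at hψ
  refine ⟨fun s => ψ (t s), ?_, fun s u => ?_, fun s => ?_, fun h => ?_⟩
  · have h1 : Continuous fun s => ψ (t s * c) := by
      refine (map_continuous ψ).comp ?_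
      exact Continuous.subtype_mk hcont _
    have h2 : (fun s => ψ (t s)) = fun s => ψ (t s * c) * (ψ c)⁻¹ := by
      ext s; rw [map_mul]; field_simp
    rw [h2]; exact h1.mul continuous_const
  · simp only [hadd, map_mul]
  · have h1 : ψ (t s) * star (ψ (t s)) = 1 := by
      rw [← map_star, hst, ← map_mul, ← hadd, add_neg_cancel, h0, map_one]
    have h2 : ‖ψ (t s)‖ * ‖ψ (t s)‖ = 1 := by
      rw [← congrArg norm h1 |>.trans norm_one, norm_mul, norm_star]
    nlinarith [norm_nonneg (ψ (t s))]
  · simp only at h; apply hψ; rw [h, one_mul]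


section compactsep
variable {X : Type*} [NormedAddCommGroup X] [CompactSpace X] [MeasurableSpace X] [BorelSpace X]

/-- Translation operator on `L²` of a compact group. -/
noncomputable def trL (y : X) : Lp ℂ 2 (Measure.addHaar : Measure X) →L[ℂ] Lp ℂ 2 (Measure.addHaar : Measure X) :=
  (Lp.compMeasurePreservingₗᵢ ℂ (fun z => z + y) (measurePreserving_add_right Measure.addHaar y)).toContinuousLinearMap

theorem trL_norm (y : X) (f) : ‖trL y f‖ = ‖f‖ :=
  (Lp.compMeasurePreservingₗᵢ ℂ (fun z => z + y) (measurePreserving_add_right Measure.addHaar y)).norm_map f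

theorem trL_coe (y : X) (f : Lp ℂ 2 (Measure.addHaar : Measure X)) :
    trL y f =ᵐ[Measure.addHaar] fun z => f (z + y) :=
  Lp.coeFn_compMeasurePreserving f (measurePreserving_add_right Measure.addHaar y)

theorem trL_zero : trL (0 : X) = 1 := by
  ext1 f
  apply Lp.ext
  filter_upwards [trL_coe (0 : X) f] with z hz
  rw [hz]; simp

theorem trL_add (s t : X) : trL (s + t) = trL s * trL t := by
  ext1 f
  apply Lp.ext
  have h1 := (measurePreserving_add_right (Measure.addHaar : Measure X) s).quasiMeasurePreserving.ae (trL_coe t f)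
  filter_upwards [trL_coe (s + t) f, trL_coe s (trL t f), h1] with z h1 h2 h3
  rw [h1, mul_apply_eq_comp, h2, h3, add_assoc]

theorem trL_star (s : X) : star (trL s) = trL (-s) := by
  have h1 : star (trL s) * trL s = 1 := by
    rw [ContinuousLinearMap.star_eq_adjoint]
    exact (ContinuousLinearMap.norm_map_iff_adjoint_comp_self (trL s)).1 (trL_norm s)
  have h2 : trL s * trL (-s) = 1 := by
    rw [← trL_add, add_neg_cancel, trL_zero]
  calc star (trL s) = star (trL s) * (trL s * trL (-s)) := by rw [h2, mul_one]
    _ = trL (-s) := by rw [← mul_assoc, h1, one_mul]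

theorem trL_cont (f : Lp ℂ 2 (Measure.addHaar : Measure X)) : Continuous fun y => trL y f := by
  let g : C(X, C(X, X)) := (ContinuousMap.mk (fun a : X × X => a.2 + a.1) (by fun_prop)).curry
  exact Continuous.compMeasurePreservingLp (g := fun y : X => g y) (f := fun _ => f) continuous_const g.continuous
    (fun y => measurePreserving_add_right (Measure.addHaar : Measure X) y) (by simp)

theorem int_of_cont {F : Type*} [NormedAddCommGroup F] {g : X → F} (hg : Continuous g) :
    Integrable g (Measure.addHaar : Measure X) :=
  hg.integrable_of_hasCompactSupport (HasCompactSupport.of_compactSpace g)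

/-- Convolution operator. -/
noncomputable def cvL (φ : C(X, ℝ)) : Lp ℂ 2 (Measure.addHaar : Measure X) →L[ℂ] Lp ℂ 2 (Measure.addHaar : Measure X) :=
  LinearMap.mkContinuous
    { toFun := fun f => ∫ y, φ y • trL y f ∂(Measure.addHaar : Measure X)
      map_add' := fun f g => by
        simp only [map_add, smul_add]
        exact integral_add (int_of_cont (φ.continuous.smul (trL_cont f))) (int_of_cont (φ.continuous.smul (trL_cont g)))
      map_smul' := fun c f => by
        simp only [map_smul, RingHom.id_apply]
        rw [← integral_smul]
        congr 1; ext1 y; rw [smul_comm] }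
    (∫ y, |φ y| ∂(Measure.addHaar : Measure X))
    (fun f => by
      refine (norm_integral_le_integral_norm _).trans (le_of_eq ?_)
      simp only [norm_smul, trL_norm, Real.norm_eq_abs]
      rw [integral_mul_const])

theorem cvL_apply (φ : C(X, ℝ)) (f) : cvL φ f = ∫ y, φ y • trL y f ∂(Measure.addHaar : Measure X) := rfl

theorem cvL_norm (φ : C(X, ℝ)) : ‖cvL φ‖ ≤ ∫ y, |φ y| ∂(Measure.addHaar : Measure X) :=
  LinearMap.mkContinuous_norm_le _ (integral_nonneg fun _ => abs_nonneg _) _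

theorem trL_cvL (φ : C(X, ℝ)) (s : X) (f) :
    (trL s * cvL φ) f = ∫ y, φ y • trL (s + y) f ∂(Measure.addHaar : Measure X) := by
  rw [mul_apply_eq_comp, cvL_apply, ← ContinuousLinearMap.integral_comp_comm]
  · congr 1; ext1 y
    rw [trL_add, mul_apply_eq_comp]
    exact ((trL s).restrictScalars ℝ).map_smul _ _
  · exact int_of_cont (φ.continuous.smul (trL_cont f))

theorem trL_cvL' (φ : C(X, ℝ)) (s : X) :
    trL s * cvL φ = cvL (φ.comp (ContinuousMap.mk (fun y => y - s) (by fun_prop))) := by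
  ext1 f
  rw [trL_cvL, cvL_apply, ← integral_sub_right_eq_self (μ := (Measure.addHaar : Measure X)) (fun y => φ y • trL (s + y) f) s]
  simp

theorem cvL_comm (φ : C(X, ℝ)) (s : X) : trL s * cvL φ = cvL φ * trL s := by
  ext1 f
  rw [trL_cvL, mul_apply_eq_comp, cvL_apply]
  congr 1; ext1 y
  rw [add_comm, trL_add, mul_apply_eq_comp]

theorem cvL_sub (φ ψ : C(X, ℝ)) : cvL φ - cvL ψ = cvL (φ - ψ) := by
  ext1 f
  rw [sub_apply, cvL_apply, cvL_apply, cvL_apply, ← integral_sub]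
  · congr 1; ext1 y; simp [sub_smul]
  · exact int_of_cont (φ.continuous.smul (trL_cont f))
  · exact int_of_cont (ψ.continuous.smul (trL_cont f))

theorem cvL_dist (φ ψ : C(X, ℝ)) :
    ‖cvL φ - cvL ψ‖ ≤ ‖φ - ψ‖ * (Measure.addHaar : Measure X).real Set.univ := by
  rw [cvL_sub]
  refine (cvL_norm _).trans ?_
  calc _ ≤ ∫ y, ‖φ - ψ‖ ∂(Measure.addHaar : Measure X) := by
        apply integral_mono (int_of_cont (by fun_prop)) (integrable_const _)
        intro y; exact (φ - ψ).norm_coe_le_norm y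
    _ = _ := by simp [mul_comm]

theorem trL_cvL_cont (φ : C(X, ℝ)) : Continuous fun s : X => trL s * cvL φ := by
  have h : Continuous fun s : X => φ.comp (ContinuousMap.mk (fun y => y - s) (by fun_prop)) :=
    ContinuousMap.continuous_of_continuous_uncurry _ (by
      show Continuous fun p : X × X => φ (p.2 - p.1)
      fun_prop)
  have h2 : Continuous (fun φ : C(X, ℝ) => cvL φ) := by
    refine (LipschitzWith.of_dist_le_mul (f := fun φ : C(X, ℝ) => cvL φ) (K := ⟨(Measure.addHaar : Measure X).real Set.univ, measureReal_nonneg⟩) ?_).continuous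
    intro φ ψ
    rw [dist_eq_norm, dist_eq_norm, mul_comm]
    exact cvL_dist φ ψ
  simp only [trL_cvL']
  exact h2.comp h

theorem cvL_star (φ : C(X, ℝ)) (hφ : ∀ x, φ (-x) = φ x) : star (cvL φ) = cvL φ := by
  rw [ContinuousLinearMap.star_eq_adjoint]
  symm
  rw [ContinuousLinearMap.eq_adjoint_iff]
  intro f g
  have hi1 : Integrable (fun y => φ y • trL y g) (Measure.addHaar : Measure X) :=
    int_of_cont (φ.continuous.smul (trL_cont g))
  have hi2 : Integrable (fun y => φ y • trL y f) (Measure.addHaar : Measure X) :=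
    int_of_cont (φ.continuous.smul (trL_cont f))
  rw [cvL_apply, cvL_apply, ← integral_inner hi1]
  rw [← inner_conj_symm, ← integral_inner hi2, ← integral_conj]
  rw [← integral_neg_eq_self (fun y => inner ℂ f (φ y • trL y g))]
  congr 1; ext1 y
  rw [inner_conj_symm, hφ, inner_smul_left_eq_smul, inner_smul_right_eq_smul, ← trL_star,
    ContinuousLinearMap.star_eq_adjoint, ContinuousLinearMap.adjoint_inner_right]

theorem trL_toLp (φ : C(X, ℝ)) (s : X) : inner ℂ (trL s (ContinuousMap.toLp 2 (Measure.addHaar : Measure X) ℂ ((ContinuousMap.mk Complex.ofReal (by fun_prop)).comp φ)))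
   (ContinuousMap.toLp 2 (Measure.addHaar : Measure X) ℂ ((ContinuousMap.mk Complex.ofReal (by fun_prop)).comp φ)) =
   ((∫ z, φ (z + s) * φ z ∂(Measure.addHaar : Measure X) : ℝ) : ℂ) := by
  set F := ContinuousMap.toLp 2 (Measure.addHaar : Measure X) ℂ ((ContinuousMap.mk Complex.ofReal (by fun_prop)).comp φ)
  have hF := ContinuousMap.coeFn_toLp (p := 2) (𝕜 := ℂ) (Measure.addHaar : Measure X) ((ContinuousMap.mk Complex.ofReal (by fun_prop)).comp φ)
  rw [L2.inner_def, ← integral_complex_ofReal]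
  apply integral_congr_ae
  have h1 := (measurePreserving_add_right (Measure.addHaar : Measure X) s).quasiMeasurePreserving.ae hF
  filter_upwards [hF, h1, trL_coe s F] with z h1 h2 h3
  rw [h3, h1, h2]
  simp [mul_comm]

theorem compact_sep (x : X) (hx : x ≠ 0) :
    ∃ χ : X → ℂ, Continuous χ ∧ (∀ s t, χ (s + t) = χ s * χ t) ∧ (∀ s, ‖χ s‖ = 1) ∧ χ x ≠ 1 := by
  have hr : 0 < ‖x‖ / 4 := by positivity
  set r := ‖x‖ / 4 with hrdef
  let φ : C(X, ℝ) := ⟨fun y => max 0 (r - ‖y‖), by fun_prop⟩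
  have hφ : ∀ y, φ y = max 0 (r - ‖y‖) := fun y => rfl
  have hφ0 : ∀ y, 0 ≤ φ y := fun y => le_max_left _ _
  have hφz : ∀ y, r ≤ ‖y‖ → φ y = 0 := fun y hy => by
    rw [hφ]; exact max_eq_left (by linarith)
  have hφs : ∀ y, φ (-y) = φ y := fun y => by rw [hφ, hφ, norm_neg]
  refine gelfand_char (fun s : X => trL s) trL_zero trL_add trL_star (cvL φ) (cvL_star φ hφs) (cvL_comm φ)
    (trL_cvL_cont φ) x ?_
  intro heq
  set F := ContinuousMap.toLp 2 (Measure.addHaar : Measure X) ℂ ((ContinuousMap.mk Complex.ofReal (by fun_prop)).comp φ) with hF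
  let w : X → ℝ := fun s => ∫ z, φ (z + s) * φ z ∂(Measure.addHaar : Measure X)
  have hw : ∀ s, inner ℂ (trL s F) F = (w s : ℂ) := fun s => trL_toLp φ s
  have hwc : Continuous w := by
    have : Continuous fun s => (inner ℂ (trL s F) F).re :=
      Complex.continuous_re.comp ((trL_cont F).inner continuous_const)
    refine this.congr fun s => ?_
    rw [hw]; simp
  have key : ∀ s, inner ℂ ((trL s * cvL φ) F) F = ((∫ y, φ y * w (s + y) ∂(Measure.addHaar : Measure X) : ℝ) : ℂ) := by
    intro s
    have hi : Integrable (fun y => φ y • trL (s + y) F) (Measure.addHaar : Measure X) := int_of_cont (φ.continuous.smul ((trL_cont F).comp (continuous_const.add continuous_id : Continuous fun y => s + y)))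
    rw [trL_cvL, ← inner_conj_symm, ← integral_inner hi, ← integral_conj, ← integral_complex_ofReal]
    congr 1; ext1 y
    rw [inner_conj_symm]
    rw [inner_smul_left_eq_smul, hw]
    simp
  have h1 := key x
  have h2 := key 0
  rw [trL_zero, one_mul] at h2
  rw [heq, h2] at h1
  have h3 := Complex.ofReal_injective h1
  have h4 : ∫ y, φ y * w (x + y) ∂(Measure.addHaar : Measure X) = 0 := by
    apply integral_eq_zero_of_ae
    refine Eventually.of_forall fun y => ?_
    show φ y * w (x + y) = 0
    by_cases hy : r ≤ ‖y‖
    · rw [hφz y hy, zero_mul]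
    · have : w (x + y) = 0 := by
        apply integral_eq_zero_of_ae
        refine Eventually.of_forall fun z => ?_
        show φ (z + (x + y)) * φ z = 0
        by_cases hz : r ≤ ‖z‖
        · rw [hφz z hz, mul_zero]
        · rw [hφz, zero_mul]
          have : ‖x‖ ≤ ‖z + (x + y)‖ + ‖y‖ + ‖z‖ := by
            calc ‖x‖ = ‖(z + (x + y)) - y - z‖ := by congr 1; abel
              _ ≤ _ := by
                refine (norm_sub_le _ _).trans ?_
                gcongr
                exact norm_sub_le _ _
          push Not at hy hz
          linarith
      rw [this, mul_zero]
  have hφpos : 0 < φ 0 := by rw [hφ]; simp [hr]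
  have hw0 : ∀ s, 0 ≤ w s := fun s => integral_nonneg fun z => mul_nonneg (hφ0 _) (hφ0 _)
  have hw00 : 0 < w 0 := by
    refine Continuous.integral_pos_of_hasCompactSupport_nonneg_nonzero (x := 0) (by fun_prop) (HasCompactSupport.of_compactSpace _)
      (fun z => mul_nonneg (hφ0 _) (hφ0 _)) ?_
    simp only [add_zero]
    positivity
  have h5 : 0 < ∫ y, φ y * w (0 + y) ∂(Measure.addHaar : Measure X) := by
    refine Continuous.integral_pos_of_hasCompactSupport_nonneg_nonzero (x := 0) (by fun_prop) (HasCompactSupport.of_compactSpace _)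
      (fun z => mul_nonneg (hφ0 _) (hw0 _)) ?_
    simp only [add_zero]
    positivity
  rw [h3, h4] at h5
  exact lt_irrefl _ h5

end compactsep


theorem hull_chars {G : Type*} [AddCommGroup G] (p : AddGroupSeminorm G)
    (tb : ∀ ε : ℝ, 0 < ε → ∃ S : Finset G, ∀ s, ∃ s₀ ∈ S, p (s - s₀) ≤ ε) (ε : ℝ) (hε : 0 < ε) :
    ∃ (B : Finset (G → ℂ)) (δ : ℝ), 0 < δ ∧
      (∀ χ ∈ B, (∀ s t, χ (s + t) = χ s * χ t) ∧ (∀ s, ‖χ s‖ = 1) ∧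
        ∀ η : ℝ, 0 < η → ∃ ρ : ℝ, 0 < ρ ∧ ∀ s, p s < ρ → ‖χ s - 1‖ < η) ∧
      ∀ τ, (∀ χ ∈ B, ‖χ τ - 1‖ < δ) → p τ < ε := by
  classical
  let : SeminormedAddCommGroup G := p.toSeminormedAddCommGroup
  have hnorm : ∀ s : G, ‖s‖ = p s := fun s => rfl
  have htb : TotallyBounded (Set.univ : Set G) := by
    rw [Metric.totallyBounded_iff]
    intro η hη
    obtain ⟨S, hS⟩ := tb (η / 2) (by positivity)
    refine ⟨S, S.finite_toSet, fun s _ => ?_⟩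
    obtain ⟨s₀, h0, h1⟩ := hS s
    simp only [Set.mem_iUnion]
    refine ⟨s₀, h0, ?_⟩
    rw [mem_ball, dist_eq_norm, hnorm]
    linarith
  have : CompactSpace (UniformSpace.Completion G) := by
    rw [← isCompact_univ_iff]
    have h1 : TotallyBounded (Set.range ((↑) : G → UniformSpace.Completion G)) := by
      rw [← Set.image_univ]
      exact htb.image (UniformSpace.Completion.uniformContinuous_coe G)
    have h2 := h1.closure
    rw [UniformSpace.Completion.denseRange_coe.closure_range] at h2
    exact isCompact_iff_totallyBounded_isComplete.2 ⟨h2, isClosed_univ.isComplete⟩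
  let : MeasurableSpace (UniformSpace.Completion G) := borel _
  have : BorelSpace (UniformSpace.Completion G) := ⟨rfl⟩
  have hK : IsCompact {x : UniformSpace.Completion G | ε ≤ ‖x‖} :=
    (isClosed_le continuous_const continuous_norm).isCompact
  have hsep : ∀ x : UniformSpace.Completion G, ∃ χ : UniformSpace.Completion G → ℂ, Continuous χ ∧
      (∀ s t, χ (s + t) = χ s * χ t) ∧ (∀ s, ‖χ s‖ = 1) ∧ (x ≠ 0 → χ x ≠ 1) := by
    intro x
    by_cases hx : x = 0
    · exact ⟨fun _ => 1, continuous_const, by simp, by simp, fun h => absurd hx h⟩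
    · obtain ⟨χ, h1, h2, h3, h4⟩ := compact_sep x hx
      exact ⟨χ, h1, h2, h3, fun _ => h4⟩
  choose χ hχc hχa hχn hχs using hsep
  obtain ⟨t, htK, ht⟩ := hK.elim_nhds_subcover
    (fun x => {y | ‖χ x x - 1‖ / 2 < ‖χ x y - 1‖}) (fun x hx => by
      have hx0 : x ≠ 0 := by
        rintro rfl
        simp at hx; linarith
      apply IsOpen.mem_nhds
      · exact isOpen_lt continuous_const ((hχc x).sub continuous_const).norm
      · have : 0 < ‖χ x x - 1‖ := norm_pos_iff.2 (sub_ne_zero.2 (hχs x hx0))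
        rw [Set.mem_ofPred_eq]
        linarith)
  obtain ⟨δ, hδ, hδ'⟩ : ∃ δ : ℝ, 0 < δ ∧ ∀ x ∈ t, δ ≤ ‖χ x x - 1‖ / 2 := by
    have : ∀ x ∈ t, 0 < ‖χ x x - 1‖ / 2 := fun x hx => by
      have hx0 : x ≠ 0 := by
        rintro rfl
        have := htK _ hx
        simp at this; linarith
      have : 0 < ‖χ x x - 1‖ := norm_pos_iff.2 (sub_ne_zero.2 (hχs x hx0))
      linarith
    clear ht htK
    induction t using Finset.induction_on with
    | empty => exact ⟨1, one_pos, by simp⟩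
    | insert a s ha ih =>
      obtain ⟨δ, h1, h2⟩ := ih (fun x hx => this x (Finset.mem_insert_of_mem hx))
      refine ⟨min δ (‖χ a a - 1‖ / 2), lt_min h1 (this a (Finset.mem_insert_self _ _)), ?_⟩
      intro x hx
      rcases Finset.mem_insert.1 hx with rfl | hx
      · exact min_le_right _ _
      · exact (min_le_left _ _).trans (h2 x hx)
  refine ⟨t.image (fun x => fun s : G => χ x (s : UniformSpace.Completion G)), δ, hδ, ?_, ?_⟩
  · intro ψ hψ
    obtain ⟨x, hx, rfl⟩ := Finset.mem_image.1 hψ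
    refine ⟨fun s t => ?_, fun s => hχn x _, fun η hη => ?_⟩
    · show χ x ((s + t : G) : UniformSpace.Completion G) = _
      rw [UniformSpace.Completion.coe_add, hχa]
    · have h0 : χ x 0 = 1 := by
        have := hχa x 0 0
        rw [add_zero] at this
        have hne : χ x 0 ≠ 0 := by
          intro h; have := hχn x 0; rw [h] at this; simp at this
        exact (mul_eq_left₀ hne).1 this.symm
      obtain ⟨ρ, hρ, h⟩ := Metric.continuous_iff.1 (hχc x) 0 η hη
      refine ⟨ρ, hρ, fun s hs => ?_⟩
      have := h (s : UniformSpace.Completion G) (by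
        rw [dist_zero_right, UniformSpace.Completion.norm_coe, hnorm]; exact hs)
      rwa [dist_eq_norm, h0] at this
  · intro τ hτ
    by_contra! hcon
    have h1 : (τ : UniformSpace.Completion G) ∈ {x : UniformSpace.Completion G | ε ≤ ‖x‖} := by
      rw [Set.mem_ofPred_eq]
      rw [UniformSpace.Completion.norm_coe, hnorm]; exact hcon
    have h2 := ht h1
    simp only [Set.mem_iUnion] at h2
    obtain ⟨x, hx, h3⟩ := h2
    have h4 := hτ _ (Finset.mem_image_of_mem _ hx)
    have h5 := hδ' x hx
    simp only [Set.mem_ofPred_eq] at h3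
    linarith


section helpers
abbrev Eu (d : ℕ) := EuclideanSpace ℝ (Fin d)

/-- The character `t ↦ exp (2πi⟨χ,t⟩)`. -/
def ex {d : ℕ} (χ t : Eu d) : ℂ := Complex.exp (((2 * Real.pi * ⟪χ, t⟫ : ℝ) : ℂ) * Complex.I)

variable {d : ℕ}

theorem ex_norm (χ t : Eu d) : ‖ex χ t‖ = 1 := Complex.norm_exp_ofReal_mul_I _

theorem ex_zero_left (t : Eu d) : ex 0 t = 1 := by simp [ex]

theorem ex_zero_right (χ : Eu d) : ex χ 0 = 1 := by simp [ex]

theorem ex_add_left (χ χ' t : Eu d) : ex (χ + χ') t = ex χ t * ex χ' t := by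
  simp only [ex, inner_add_left, ← Complex.exp_add]; congr 1; push_cast; ring

theorem ex_add_right (χ s t : Eu d) : ex χ (s + t) = ex χ s * ex χ t := by
  simp only [ex, inner_add_right, ← Complex.exp_add]; congr 1; push_cast; ring

theorem ex_neg_left (χ t : Eu d) : ex (-χ) t = (starRingEnd ℂ) (ex χ t) := by
  simp only [ex, ← Complex.exp_conj, map_mul, Complex.conj_ofReal, Complex.conj_I, inner_neg_left]
  congr 1; push_cast; ring

theorem ex_neg_right (χ t : Eu d) : ex χ (-t) = ex (-χ) t := by
  simp only [ex, inner_neg_left, inner_neg_right]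

theorem ex_neg (χ t : Eu d) :
    ex (-χ) t = Complex.exp (((-(2 * Real.pi * ⟪χ, t⟫)) : ℝ) * Complex.I) := by
  simp only [ex, inner_neg_left]; congr 3; ring

theorem ex_continuous (χ : Eu d) : Continuous (ex χ) := by
  unfold ex; fun_prop

theorem ex_smul_nat (n : ℕ) (χ t : Eu d) : ex (n • χ) t = ex χ t ^ n := by
  induction n with
  | zero => simp [ex_zero_left]
  | succ n ih => rw [succ_nsmul, ex_add_left, ih, pow_succ]

/-- Continuous characters of `ℝ^d` are exponentials. -/
theorem char_eq_ex (χ : Eu d → ℂ) (hc : Continuous χ) (ha : ∀ s t, χ (s + t) = χ s * χ t)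
    (hn : ∀ s, ‖χ s‖ = 1) : ∃ β : Eu d, ∀ t, χ t = ex β t := by
  have h0 : χ 0 = 1 := by
    have := ha 0 0
    rw [add_zero] at this
    have hne : χ 0 ≠ 0 := by
      intro h; have := hn 0; rw [h] at this; simp at this
    exact (mul_eq_left₀ hne).1 this.symm
  let g : C(Eu d, Circle) := ⟨fun t => ⟨χ t, by simp [Submonoid.unitSphere, hn]⟩, by
    exact Continuous.subtype_mk hc _⟩
  have hg : ∀ t, (g t : ℂ) = χ t := fun t => rfl
  obtain ⟨L, ⟨hL0, hL⟩, -⟩ := Circle.isCoveringMap_exp.existsUnique_continuousMap_lifts g 0 0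
    (by apply Circle.ext; rw [hg, h0]; simp)
  have hLe : ∀ t, Complex.exp (L t * Complex.I) = χ t := fun t => by
    rw [← hg, ← congrFun hL t]; simp
  -- L is additive
  have hadd : ∀ s t, L (s + t) = L s + L t := by
    intro s t
    -- continuous function u ↦ (L (s + u) - L s - L u) is integer multiple of 2π
    have hint : ∀ u, ∃ n : ℤ, L (s + u) - L s - L u = n * (2 * Real.pi) := by
      intro u
      have : Complex.exp ((L (s + u) - L s - L u : ℝ) * Complex.I) = 1 := by
        push_cast
        rw [sub_mul, sub_mul, Complex.exp_sub, Complex.exp_sub, hLe, hLe, hLe, ha]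
        have h1 : χ s ≠ 0 := by intro h; have := hn s; rw [h] at this; simp at this
        have h2 : χ u ≠ 0 := by intro h; have := hn u; rw [h] at this; simp at this
        field_simp
      obtain ⟨n, hn'⟩ := Complex.exp_eq_one_iff.1 this
      refine ⟨n, ?_⟩
      have h3 : ((L (s + u) - L s - L u : ℝ) : ℂ) = ((n * (2 * Real.pi) : ℝ) : ℂ) := by
        have := mul_right_cancel₀ Complex.I_ne_zero (hn'.trans (mul_assoc _ _ _).symm)
        rw [this]; push_cast; ring
      exact_mod_cast h3
    choose n hn' using hint
    have hcont : Continuous fun u => ((n u : ℤ) : ℝ) := by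
      have : (fun u => ((n u : ℤ) : ℝ)) = fun u => (L (s + u) - L s - L u) / (2 * Real.pi) := by
        ext u; rw [hn' u]; field_simp
      rw [this]; fun_prop
    have hcont' : Continuous n := (Int.isClosedEmbedding_coe_real.isInducing.continuous_iff).2 hcont
    have heq : n t = n 0 := PreconnectedSpace.constant inferInstance hcont'
    have h5 := hn' 0
    have h6 := hn' t
    rw [heq, ← h5, add_zero, hL0] at h6
    linarith
  let A : Eu d →+ ℝ := AddMonoidHom.mk' L hadd
  let Λ : Eu d →L[ℝ] ℝ := A.toRealLinearMap L.continuous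
  let b := (InnerProductSpace.toDual ℝ (Eu d)).symm Λ
  have hb : ∀ t, ⟪b, t⟫ = L t := fun t => by
    simp only [b, InnerProductSpace.toDual_symm_apply]; rfl
  refine ⟨(2 * Real.pi)⁻¹ • b, fun t => ?_⟩
  rw [← hLe, ex, inner_smul_left, hb]
  congr 3
  simp; field_simp

theorem bohr_cont {F : Eu d → ℂ} (hF : IsBohrAlmostPeriodic F) (ε : ℝ) (hε : 0 < ε) :
    ∃ (B : Finset (Eu d)) (δ : ℝ), 0 < δ ∧ ∀ τ, (∀ β ∈ B, ‖ex β τ - 1‖ < δ) → ‖F τ - F 0‖ ≤ ε := by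
  classical
  obtain ⟨hcont, ⟨C, hC⟩, htb⟩ := hF
  have hbd : ∀ s, BddAbove (Set.range fun t => ‖F (t - s) - F t‖) := fun s =>
    ⟨C + C, by rintro _ ⟨t, rfl⟩; exact (norm_sub_le _ _).trans (add_le_add (hC _) (hC _))⟩
  let p : AddGroupSeminorm (Eu d) :=
    { toFun := fun s => ⨆ t, ‖F (t - s) - F t‖
      map_zero' := by simp
      add_le' := fun s u => by
        apply ciSup_le
        intro t
        have h1 := le_ciSup (hbd s) (t - u)
        have h2 := le_ciSup (hbd u) t
        have h3 : F (t - (s + u)) - F t = (F (t - u - s) - F (t - u)) + (F (t - u) - F t) := by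
          rw [show t - (s + u) = t - u - s by abel]; ring
        rw [h3]
        exact (norm_add_le _ _).trans (add_le_add h1 h2)
      neg' := fun s => by
        have : ∀ s, (⨆ t, ‖F (t - -s) - F t‖) ≤ ⨆ t, ‖F (t - s) - F t‖ := fun s => by
          apply ciSup_le
          intro t
          have h1 := le_ciSup (hbd s) (t - -s)
          rw [norm_sub_rev]
          simpa using h1
        apply le_antisymm (this s)
        simpa using this (-s) }
  have hp : ∀ s, p s = ⨆ t, ‖F (t - s) - F t‖ := fun s => rfl
  have hple : ∀ s t, ‖F (t - s) - F t‖ ≤ p s := fun s t => le_ciSup (hbd s) t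
  obtain ⟨B, δ, hδ, hB, hBε⟩ := hull_chars p (fun η hη => by
    obtain ⟨S, hS⟩ := htb η hη
    refine ⟨S, fun s => ?_⟩
    obtain ⟨s₀, h0, h1⟩ := hS s
    refine ⟨s₀, h0, ?_⟩
    rw [hp]
    apply ciSup_le
    intro t
    have := h1 (t + s₀)
    rwa [add_sub_cancel_right, show t + s₀ - s = t - (s - s₀) by abel] at this) ε hε
  -- continuity of p at 0
  have hpc : ∀ ρ : ℝ, 0 < ρ → ∃ r : ℝ, 0 < r ∧ ∀ s : Eu d, ‖s‖ < r → p s < ρ := by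
    intro ρ hρ
    obtain ⟨S, hS⟩ := htb (ρ / 4) (by positivity)
    have h1 : ∀ᶠ s in 𝓝 (0 : Eu d), ∀ s₀ ∈ S, ‖F (-s - s₀) - F (-s₀)‖ < ρ / 4 := by
      rw [Filter.eventually_all_finset]
      intro s₀ _
      have : Continuous fun s => ‖F (-s - s₀) - F (-s₀)‖ := by fun_prop
      have h2 := this.tendsto 0
      simp only [neg_zero, zero_sub, sub_self, norm_zero] at h2
      exact h2.eventually_lt_const (by positivity)
    obtain ⟨r, hr, h2⟩ := Metric.eventually_nhds_iff.1 h1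
    refine ⟨r, hr, fun s hs => ?_⟩
    have h3 := h2 (y := s) (by simpa using hs)
    have : p s ≤ 3 * (ρ / 4) := by
      rw [hp]
      apply ciSup_le
      intro t
      obtain ⟨s₀, h0, h4⟩ := hS (-t)
      have h5 := h4 (-s)
      have h6 := h4 0
      have h7 := h3 s₀ h0
      rw [show -s - -t = t - s by abel] at h5
      rw [show (0 : Eu d) - -t = t by abel, zero_sub] at h6
      have h8 : F (t - s) - F t = (F (t - s) - F (-s - s₀)) + (F (-s - s₀) - F (-s₀)) - (F t - F (-s₀)) := by ring
      rw [h8]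
      refine (norm_sub_le _ _).trans ?_
      have := norm_add_le (F (t - s) - F (-s - s₀)) (F (-s - s₀) - F (-s₀))
      linarith
    linarith
  have hex : ∀ χ ∈ B, ∃ β : Eu d, ∀ t, χ t = ex β t := by
    intro χ hχ
    obtain ⟨h1, h2, h3⟩ := hB χ hχ
    refine char_eq_ex χ ?_ h1 h2
    rw [Metric.continuous_iff]
    intro b η hη
    obtain ⟨ρ, hρ, h4⟩ := h3 η hη
    obtain ⟨r, hr, h5⟩ := hpc ρ hρ
    refine ⟨r, hr, fun a hab => ?_⟩
    have h6 := h4 (a - b) (h5 _ (by rwa [← dist_eq_norm]))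
    have h7 : χ a - χ b = χ b * (χ (a - b) - 1) := by
      rw [mul_sub, ← h1]; simp
    rw [dist_eq_norm, h7, norm_mul, h2, one_mul]
    exact h6
  choose! β hβ using hex
  refine ⟨B.image β, δ, hδ, fun τ hτ => ?_⟩
  have h1 := hBε τ (fun χ hχ => by
    rw [hβ χ hχ]; exact hτ _ (Finset.mem_image_of_mem _ hχ))
  have h2 := hple τ τ
  rw [sub_self, norm_sub_rev] at h2
  linarith

/-- Volume of the ball. -/
def volB (d : ℕ) (R : ℝ) : ℝ := (volume (ball (0 : Eu d) R)).toReal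

theorem volB_nonneg (R : ℝ) : 0 ≤ volB d R := ENNReal.toReal_nonneg

theorem volB_pos {R : ℝ} (hR : 0 < R) : 0 < volB d R :=
  ENNReal.toReal_pos (measure_ball_pos _ _ hR).ne' measure_ball_lt_top.ne

theorem volB_eq {R : ℝ} (hR : 0 < R) : volB d R = R ^ d * volB d 1 := by
  unfold volB
  rw [Measure.addHaar_ball_of_pos _ _ hR, ENNReal.toReal_mul, ENNReal.toReal_ofReal (by positivity)]
  simp

theorem volB_ratio (r : ℝ) : Tendsto (fun R => (volB d R)⁻¹ * volB d (R + r)) atTop (𝓝 1) := by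
  have h1 : Tendsto (fun R : ℝ => (1 + r * R⁻¹) ^ d) atTop (𝓝 1) := by
    have := ((tendsto_inv_atTop_zero (𝕜 := ℝ)).const_mul r).const_add 1
    simpa using this.pow d
  refine h1.congr' ?_
  filter_upwards [eventually_gt_atTop 0, eventually_gt_atTop (-r)] with R h2 h3
  rw [volB_eq h2, volB_eq (by linarith : 0 < R + r)]
  have := volB_pos (d := d) one_pos
  rw [show 1 + r * R⁻¹ = (R + r) / R by field_simp, div_pow]
  field_simp

/-- Averages over balls. -/
def avgM {V : Type*} [NormedAddCommGroup V] [NormedSpace ℝ V] (ν : Measure (Eu d)) (G : Eu d → V) (R : ℝ) : V :=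
  (volB d R)⁻¹ • ∫ t in ball (0 : Eu d) R, G t ∂ν

/-- `G` has mean `m` with respect to `ν`. -/
def HasMean {V : Type*} [NormedAddCommGroup V] [NormedSpace ℝ V] (ν : Measure (Eu d)) (G : Eu d → V) (m : V) : Prop :=
  Tendsto (avgM ν G) atTop (𝓝 m)

theorem setInt_diff_le {ν : Measure (Eu d)} {G : Eu d → ℂ} (hG : ∀ t, ‖G t‖ ≤ 1) {A B : Set (Eu d)}
    (hAB : A ⊆ B) (hA : MeasurableSet A) (hGi : IntegrableOn G B ν) (hBf : ν B ≠ ∞) :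
    ‖(∫ t in B, G t ∂ν) - ∫ t in A, G t ∂ν‖ ≤ (ν B).toReal - (ν A).toReal := by
  rw [← setIntegral_sdiff hA hGi hAB]
  have h1 : ν (B \ A) < ∞ := lt_of_le_of_lt (measure_mono Set.diff_subset) hBf.lt_top
  refine (norm_setIntegral_le_of_norm_le_const h1 (fun t _ => hG t)).trans ?_
  rw [one_mul, measureReal_def, measure_sdiff hAB hA.nullMeasurableSet (measure_ne_top_of_subset hAB hBf),
    ENNReal.toReal_sub_of_le (measure_mono hAB) hBf]

theorem cont_intOn {V : Type*} [NormedAddCommGroup V] {ν : Measure (Eu d)} [IsLocallyFiniteMeasure ν]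
    {G : Eu d → V} (hG : Continuous G) (R : ℝ) : IntegrableOn G (ball (0 : Eu d) R) ν :=
  (hG.continuousOn.integrableOn_compact (isCompact_closedBall (0 : Eu d) R)).mono_set ball_subset_closedBall

theorem mean_ex (χ : Eu d) [Decidable (χ = 0)] :
    HasMean volume (ex χ) (if χ = 0 then 1 else 0) := by
  unfold HasMean
  split_ifs with h
  · subst h
    refine tendsto_const_nhds.congr' ?_
    filter_upwards [eventually_gt_atTop 0] with R hR
    have := volB_pos (d := d) hR
    simp only [avgM, ex_zero_left]
    rw [integral_const, measureReal_restrict_apply_univ, measureReal_def]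
    change (1 : ℂ) = (volB d R)⁻¹ • (volB d R) • 1
    rw [smul_smul, inv_mul_cancel₀ this.ne', one_smul]
  · set s : Eu d := (2 * ‖χ‖ ^ 2)⁻¹ • χ with hs
    have hχ : ‖χ‖ ≠ 0 := norm_ne_zero_iff.2 h
    have hexs : ex χ s = -1 := by
      rw [ex, hs, inner_smul_right, real_inner_self_eq_norm_sq]
      rw [show 2 * Real.pi * ((2 * ‖χ‖ ^ 2)⁻¹ * ‖χ‖ ^ 2) = Real.pi by field_simp]
      exact Complex.exp_pi_mul_I
    have key : ∀ R, ‖∫ t in ball (0 : Eu d) R, ex χ t‖ ≤ volB d (R + ‖s‖) - volB d R := by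
      intro R
      have hi : IntegrableOn (ex χ) (ball (0 : Eu d) (R + ‖s‖)) :=
        cont_intOn (ex_continuous χ) _
      have h1 := setInt_diff_le (fun t => (ex_norm χ t).le) (ball_subset_ball (by linarith [norm_nonneg s]) : ball (0 : Eu d) R ⊆ ball 0 (R + ‖s‖))
        measurableSet_ball hi measure_ball_lt_top.ne
      have h2 := setInt_diff_le (fun t => (ex_norm χ t).le) (ball_subset_ball' (by simp) : ball s R ⊆ ball 0 (R + ‖s‖))
        measurableSet_ball hi measure_ball_lt_top.ne
      have h3 : volume (ball s R) = volume (ball (0 : Eu d) R) := Measure.addHaar_ball_center _ _ _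
      rw [h3] at h2
      have h4 : ∫ t in ball s R, ex χ t = - ∫ t in ball (0 : Eu d) R, ex χ t := by
        have h5 := (measurePreserving_add_right (volume : Measure (Eu d)) s).setIntegral_preimage_emb
          (MeasurableEquiv.addRight s).measurableEmbedding (ex χ) (ball s R)
        rw [← h5, ← integral_neg]
        have h6 : (fun x => x + s) ⁻¹' ball s R = ball (0 : Eu d) R := by
          ext x; simp [mem_ball, dist_eq_norm]
        rw [h6]
        congr 1; ext t
        rw [ex_add_right, hexs, mul_neg_one]
      rw [h4] at h2
      set I := ∫ t in ball (0 : Eu d) R, ex χ t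
      set J := ∫ t in ball (0 : Eu d) (R + ‖s‖), ex χ t
      have h7 : (2 : ℂ) * I = (J - -I) - (J - I) := by ring
      have h8 : 2 * ‖I‖ ≤ ‖J - -I‖ + ‖J - I‖ := by
        calc 2 * ‖I‖ = ‖(2 : ℂ) * I‖ := by simp
          _ ≤ _ := by rw [h7]; exact norm_sub_le _ _
      unfold volB
      linarith
    have h1 := (volB_ratio (d := d) ‖s‖).sub_const 1
    rw [sub_self] at h1
    refine squeeze_zero_norm' ?_ h1
    filter_upwards [eventually_gt_atTop 0] with R hR
    have hv := volB_pos (d := d) hR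
    rw [avgM, norm_smul, norm_inv, Real.norm_of_nonneg hv.le]
    calc (volB d R)⁻¹ * _ ≤ (volB d R)⁻¹ * (volB d (R + ‖s‖) - volB d R) := by
          gcongr; exact key R
      _ = _ := by field_simp

theorem HasMean.sum {ι : Type*} (s : Finset ι) {G : ι → Eu d → ℂ} {m : ι → ℂ}
    (hc : ∀ i ∈ s, Continuous (G i)) (h : ∀ i ∈ s, HasMean volume (G i) (m i)) :
    HasMean volume (fun t => ∑ i ∈ s, G i t) (∑ i ∈ s, m i) := by
  have h1 := tendsto_finsetSum s h
  refine h1.congr fun R => ?_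
  simp only [avgM]
  rw [integral_finsetSum _ (fun i hi => cont_intOn (hc i hi) R), Finset.smul_sum]

theorem HasMean.const_mul {G : Eu d → ℂ} {m : ℂ} (c : ℂ) (h : HasMean volume G m) :
    HasMean volume (fun t => c * G t) (c * m) := by
  refine (Tendsto.const_mul c h).congr fun R => ?_
  simp only [avgM]
  rw [integral_const_mul, mul_smul_comm]

open Classical in
/-- Trigonometric polynomials with nonnegative coefficients and mean `m`. -/
def IsPT (K : Eu d → ℝ) (m : ℝ) : Prop :=
  ∃ (ι : Type) (_ : Fintype ι) (a : ι → ℝ) (χ : ι → Eu d), (∀ i, 0 ≤ a i) ∧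
    (∀ t, (K t : ℂ) = ∑ i, (a i : ℂ) * ex (χ i) t) ∧ m = ∑ i, if χ i = 0 then a i else 0

theorem IsPT.continuous {K : Eu d → ℝ} {m : ℝ} (h : IsPT K m) : Continuous K := by
  obtain ⟨ι, _, a, χ, ha, hK, rfl⟩ := h
  have h1 : Continuous fun t => (K t : ℂ) := by
    simp only [hK]
    exact continuous_finsetSum _ fun i _ => continuous_const.mul (ex_continuous _)
  exact (Complex.continuous_re.comp h1)

theorem IsPT.hasMeanC {K : Eu d → ℝ} {m : ℝ} (h : IsPT K m) : HasMean volume (fun t => (K t : ℂ)) (m : ℂ) := by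
  classical
  obtain ⟨ι, _, a, χ, ha, hK, rfl⟩ := h
  simp only [hK]
  have := HasMean.sum Finset.univ (G := fun i t => (a i : ℂ) * ex (χ i) t) (fun i _ => continuous_const.mul (ex_continuous (χ i)))
    (fun i _ => (mean_ex (χ i)).const_mul (a i : ℂ))
  convert this using 1
  push_cast
  refine Finset.sum_congr rfl fun i _ => ?_
  split_ifs <;> simp

theorem IsPT.hasMean {K : Eu d → ℝ} {m : ℝ} (h : IsPT K m) : HasMean volume K m := by
  have h1 := (Complex.continuous_re.tendsto _).comp h.hasMeanC
  rw [Complex.ofReal_re] at h1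
  refine h1.congr fun R => ?_
  simp only [avgM, Function.comp]
  rw [integral_complex_ofReal, Complex.real_smul, ← Complex.ofReal_mul, Complex.ofReal_re, smul_eq_mul]

theorem IsPT.mul {K K' : Eu d → ℝ} {m m' : ℝ} (h : IsPT K m) (h' : IsPT K' m') :
    ∃ m'', IsPT (fun t => K t * K' t) m'' ∧ m * m' ≤ m'' := by
  classical
  obtain ⟨ι, _, a, χ, ha, hK, rfl⟩ := h
  obtain ⟨κ, _, b, ψ, hb, hK', rfl⟩ := h'
  refine ⟨_, ⟨ι × κ, inferInstance, fun p => a p.1 * b p.2, fun p => χ p.1 + ψ p.2,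
    fun p => mul_nonneg (ha _) (hb _), fun t => ?_, rfl⟩, ?_⟩
  · push_cast
    rw [hK, hK', Finset.sum_mul_sum, Fintype.sum_prod_type]
    refine Finset.sum_congr rfl fun i _ => Finset.sum_congr rfl fun j _ => ?_
    rw [ex_add_left]; ring
  · rw [Finset.sum_mul_sum, Fintype.sum_prod_type]
    refine Finset.sum_le_sum fun i _ => Finset.sum_le_sum fun j _ => ?_
    have h1 := mul_nonneg (ha i) (hb j)
    by_cases h2 : χ i = 0 <;> by_cases h3 : ψ j = 0 <;> simp [h2, h3]
    split_ifs
    exacts [h1, le_rfl]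

theorem IsPT.one : IsPT (fun _ : Eu d => 1) 1 :=
  ⟨Unit, inferInstance, fun _ => 1, fun _ => 0, by simp, by simp [ex_zero_left], by simp⟩

/-- Fejér kernel. -/
def fej (n : ℕ) (β t : Eu d) : ℝ := (n : ℝ)⁻¹ * ‖∑ j ∈ Finset.range n, ex β t ^ j‖ ^ 2

theorem fej_nonneg (n : ℕ) (β t : Eu d) : 0 ≤ fej n β t := by unfold fej; positivity

theorem fej_PT (n : ℕ) (hn : 0 < n) (β : Eu d) : ∃ m, IsPT (fej n β) m ∧ 1 ≤ m := by
  classical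
  refine ⟨_, ⟨Fin n × Fin n, inferInstance, fun _ => (n : ℝ)⁻¹, fun p => (p.1 : ℕ) • β + (-((p.2 : ℕ) • β)),
    fun _ => by positivity, fun t => ?_, rfl⟩, ?_⟩
  · unfold fej
    push_cast
    rw [← Complex.mul_conj', map_sum, Finset.sum_mul_sum, Finset.mul_sum, Fintype.sum_prod_type,
      Finset.sum_range]
    refine Finset.sum_congr rfl fun i _ => ?_
    rw [Finset.mul_sum, Finset.sum_range]
    refine Finset.sum_congr rfl fun j _ => ?_
    rw [ex_add_left, ex_neg_left, ex_smul_nat, ex_smul_nat]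
  · rw [Fintype.sum_prod_type]
    have hn' : (n : ℝ) ≠ 0 := by positivity
    calc (1 : ℝ) = ∑ i : Fin n, (n : ℝ)⁻¹ := by simp [hn']
      _ ≤ _ := by
        refine Finset.sum_le_sum fun i _ => ?_
        have := Finset.single_le_sum (f := fun j : Fin n => if (i : ℕ) • β + (-((j : ℕ) • β)) = 0 then (n : ℝ)⁻¹ else 0)
          (fun j _ => by split_ifs <;> positivity) (Finset.mem_univ i)
        simpa using this

theorem fej_le (n : ℕ) (hn : 0 < n) (β t : Eu d) {δ : ℝ} (hδ : 0 < δ) (h : δ ≤ ‖ex β t - 1‖) :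
    fej n β t ≤ 4 / (n * δ ^ 2) := by
  have hne : ex β t ≠ 1 := by
    intro h1; rw [h1] at h; simp at h; linarith
  unfold fej
  have h1 : ‖∑ j ∈ Finset.range n, ex β t ^ j‖ ≤ 2 / δ := by
    rw [geom_sum_eq hne, norm_div]
    gcongr
    refine (norm_sub_le _ _).trans ?_
    rw [norm_pow, ex_norm]; norm_num
  calc (n : ℝ)⁻¹ * ‖∑ j ∈ Finset.range n, ex β t ^ j‖ ^ 2 ≤ (n : ℝ)⁻¹ * (2 / δ) ^ 2 := by gcongr
    _ = _ := by field_simp; norm_num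

/-- Product of Fejér kernels. -/
def fejP (n : ℕ) (B : Finset (Eu d)) (t : Eu d) : ℝ := ∏ β ∈ B, fej n β t

theorem fejP_nonneg (n : ℕ) (B : Finset (Eu d)) (t : Eu d) : 0 ≤ fejP n B t :=
  Finset.prod_nonneg fun _ _ => fej_nonneg _ _ _

theorem fejP_insert [DecidableEq (Eu d)] (n : ℕ) (hn : 0 < n) (B : Finset (Eu d)) (β : Eu d) (hβ : β ∉ B) {m : ℝ} (hm : 0 ≤ m) (h : IsPT (fejP n B) m) :
    ∃ m', IsPT (fejP n (insert β B)) m' ∧ m ≤ m' := by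
  obtain ⟨m₁, h1, h2⟩ := fej_PT n hn β
  obtain ⟨m₂, h3, h4⟩ := h1.mul h
  refine ⟨m₂, ?_, le_trans (by nlinarith) h4⟩
  convert h3 using 2 with t
  rw [fejP, Finset.prod_insert hβ, fejP]

theorem fejP_PT (n : ℕ) (hn : 0 < n) (B : Finset (Eu d)) : ∃ m, IsPT (fejP n B) m ∧ 1 ≤ m := by
  classical
  induction B using Finset.induction_on with
  | empty =>
    have h0 : fejP n (∅ : Finset (Eu d)) = fun _ => 1 := by ext t; simp [fejP]
    exact ⟨1, by rw [h0]; exact IsPT.one, le_rfl⟩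
  | insert β B hβ ih =>
    obtain ⟨m, h1, h2⟩ := ih
    obtain ⟨m', h3, h4⟩ := fejP_insert n hn B β hβ (by linarith) h1
    exact ⟨m', h3, h2.trans h4⟩

theorem IsPT.hasMean_mul {K : Eu d → ℝ} {m : ℝ} (h : IsPT K m) {F : Eu d → ℂ} (hF : Continuous F)
    {a : Eu d → ℝ} (ha : ∀ χ, 0 ≤ a χ) (hm : ∀ χ, HasMean volume (fun t => ex (-χ) t * F t) (a χ : ℂ)) :
    ∃ L : ℝ, 0 ≤ L ∧ HasMean volume (fun t => (K t : ℂ) * F t) (L : ℂ) := by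
  obtain ⟨ι, _, b, χ, hb, hK, rfl⟩ := h
  refine ⟨∑ i, b i * a (-χ i), Finset.sum_nonneg fun i _ => mul_nonneg (hb i) (ha _), ?_⟩
  have := HasMean.sum Finset.univ (G := fun i t => (b i : ℂ) * (ex (χ i) t * F t))
    (fun i _ => continuous_const.mul ((ex_continuous (χ i)).mul hF))
    (fun i _ => (by have := hm (-χ i); rw [neg_neg] at this; exact this.const_mul (b i : ℂ)))
  convert this using 1
  · ext t; rw [hK, Finset.sum_mul]; exact Finset.sum_congr rfl fun i _ => by ring
  · push_cast; rfl

/-- Continuity at zero for the Bohr topology. -/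
def BohrCont (F : Eu d → ℂ) : Prop := ∀ ε : ℝ, 0 < ε → 
    ∃ (B : Finset (Eu d)) (δ : ℝ), 0 < δ ∧ ∀ τ, (∀ β ∈ B, ‖ex β τ - 1‖ < δ) → ‖F τ - F 0‖ ≤ ε

theorem kernel_lemma {F : Eu d → ℂ} (hF : Continuous F) {C : ℝ} (hC : ∀ t, ‖F t‖ ≤ C) (hB : BohrCont F)
    {a : Eu d → ℝ} (ha : ∀ χ, 0 ≤ a χ) (hm : ∀ χ, HasMean volume (fun t => ex (-χ) t * F t) (a χ : ℂ)) :
    ∃ r : ℝ, 0 ≤ r ∧ F 0 = (r : ℂ) := by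
  classical
  have hC0 : 0 ≤ C := (norm_nonneg _).trans (hC 0)
  have key : ∀ ε : ℝ, 0 < ε → ∃ r : ℝ, 0 ≤ r ∧ ‖(r : ℂ) - F 0‖ ≤ 2 * ε := by
    intro ε hε
    obtain ⟨B, δ, hδ, hBδ⟩ := hB ε hε
    obtain ⟨n, hn0, hn⟩ : ∃ n : ℕ, 0 < n ∧ 2 * C * (4 / (n * δ ^ 2)) * B.card ≤ ε := by
      obtain ⟨n, hn⟩ := exists_nat_gt (2 * C * 4 / δ ^ 2 * B.card / ε)
      have hn0 : 0 < (n : ℝ) := lt_of_le_of_lt (by positivity) hn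
      refine ⟨n, by exact_mod_cast hn0, ?_⟩
      rw [div_lt_iff₀ hε] at hn
      have : 2 * C * (4 / (n * δ ^ 2)) * B.card = (2 * C * 4 / δ ^ 2 * B.card) / n := by field_simp
      rw [this, div_le_iff₀ hn0]
      linarith
    set κ := 2 * C * (4 / (n * δ ^ 2)) with hκ
    have hκ0 : 0 ≤ κ := by positivity
    obtain ⟨m, hmPT, hm1⟩ := fejP_PT n hn0 B
    have hme : ∀ β : Eu d, ∃ m', β ∈ B → (IsPT (fejP n (B.erase β)) m' ∧ m' ≤ m) := by
      intro β
      by_cases hβ : β ∈ B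
      · obtain ⟨m', h1, h2⟩ := fejP_PT n hn0 (B.erase β)
        obtain ⟨m'', h3, h4⟩ := fejP_insert n hn0 (B.erase β) β (Finset.notMem_erase _ _) (by linarith) h1
        rw [Finset.insert_erase hβ] at h3
        have : m'' = m := tendsto_nhds_unique h3.hasMean hmPT.hasMean
        exact ⟨m', fun _ => ⟨h1, this ▸ h4⟩⟩
      · exact ⟨0, fun h => absurd h hβ⟩
    choose me hme using hme
    obtain ⟨L, hL0, hL⟩ := hmPT.hasMean_mul hF ha hm
    have hpt : ∀ t, ‖(fejP n B t : ℂ) * F t - F 0 * (fejP n B t : ℂ)‖ ≤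
        ε * fejP n B t + ∑ β ∈ B, κ * fejP n (B.erase β) t := by
      intro t
      have hK := fejP_nonneg n B t
      have hsum : 0 ≤ ∑ β ∈ B, κ * fejP n (B.erase β) t :=
        Finset.sum_nonneg fun β _ => mul_nonneg hκ0 (fejP_nonneg _ _ _)
      have h1 : (fejP n B t : ℂ) * F t - F 0 * (fejP n B t : ℂ) = (fejP n B t : ℂ) * (F t - F 0) := by ring
      rw [h1, norm_mul, Complex.norm_real, Real.norm_of_nonneg hK]
      by_cases hall : ∀ β ∈ B, ‖ex β t - 1‖ < δ
      · have := hBδ t hall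
        nlinarith
      · push Not at hall
        obtain ⟨β, hβ, h2⟩ := hall
        have h3 : fejP n B t = fej n β t * fejP n (B.erase β) t := by
          unfold fejP; rw [Finset.mul_prod_erase _ (fun β => fej n β t) hβ]
        have h4 := fej_le n hn0 β t hδ h2
        have h5 : ‖F t - F 0‖ ≤ 2 * C := (norm_sub_le _ _).trans (by linarith [hC t, hC 0])
        have h6 := Finset.single_le_sum (f := fun β => κ * fejP n (B.erase β) t)
          (fun β _ => mul_nonneg hκ0 (fejP_nonneg _ _ _)) hβ
        have h7 := fejP_nonneg n (B.erase β) t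
        have h8 := fej_nonneg n β t
        calc fejP n B t * ‖F t - F 0‖ ≤ ((4 / (n * δ ^ 2)) * fejP n (B.erase β) t) * (2 * C) := by
              rw [h3]; gcongr
          _ = κ * fejP n (B.erase β) t := by rw [hκ]; ring
          _ ≤ ∑ β ∈ B, κ * fejP n (B.erase β) t := h6
          _ ≤ _ := by nlinarith
    have hKc := hmPT.continuous
    have hKc' : Continuous fun t => (fejP n B t : ℂ) := Complex.continuous_ofReal.comp hKc
    have hlim1 : Tendsto (fun R => ‖avgM volume (fun t => (fejP n B t : ℂ) * F t) R - F 0 * avgM volume (fun t => (fejP n B t : ℂ)) R‖)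
        atTop (𝓝 ‖(L : ℂ) - F 0 * m‖) := (Tendsto.sub hL (Tendsto.const_mul (F 0) hmPT.hasMeanC)).norm
    have hlim2 : Tendsto (fun R => ε * avgM volume (fejP n B) R + ∑ β ∈ B, κ * avgM volume (fejP n (B.erase β)) R) atTop
        (𝓝 (ε * m + ∑ β ∈ B, κ * me β)) :=
      (Tendsto.const_mul ε hmPT.hasMean).add (tendsto_finsetSum _ fun β hβ => Tendsto.const_mul κ (hme β hβ).1.hasMean)
    have hle : ‖(L : ℂ) - F 0 * m‖ ≤ ε * m + ∑ β ∈ B, κ * me β := by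
      refine le_of_tendsto_of_tendsto' hlim1 hlim2 fun R => ?_
      have hv := inv_nonneg.2 (volB_nonneg (d := d) R)
      have e1 : avgM volume (fun t => (fejP n B t : ℂ) * F t) R - F 0 * avgM volume (fun t => (fejP n B t : ℂ)) R
          = (volB d R)⁻¹ • ∫ t in ball (0 : Eu d) R, ((fejP n B t : ℂ) * F t - F 0 * (fejP n B t : ℂ)) := by
        have i1 : IntegrableOn (fun t => (fejP n B t : ℂ) * F t) (ball (0 : Eu d) R) := cont_intOn (hKc'.mul hF) R
        have i2 : IntegrableOn (fun t => F 0 * (fejP n B t : ℂ)) (ball (0 : Eu d) R) := cont_intOn (continuous_const.mul hKc') R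
        rw [integral_sub i1 i2, integral_const_mul,
          smul_sub, avgM, avgM, mul_smul_comm]
      have e2 : ε * avgM volume (fejP n B) R + ∑ β ∈ B, κ * avgM volume (fejP n (B.erase β)) R
          = (volB d R)⁻¹ * ∫ t in ball (0 : Eu d) R, (ε * fejP n B t + ∑ β ∈ B, κ * fejP n (B.erase β) t) := by
        have i1 : IntegrableOn (fun t => ε * fejP n B t) (ball (0 : Eu d) R) := cont_intOn (continuous_const.mul hKc) R
        have i2 : ∀ β ∈ B, IntegrableOn (fun t => κ * fejP n (B.erase β) t) (ball (0 : Eu d) R) := fun β hβ =>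
          cont_intOn (continuous_const.mul (hme β hβ).1.continuous) R
        have i3 : IntegrableOn (fun t => ∑ β ∈ B, κ * fejP n (B.erase β) t) (ball (0 : Eu d) R) :=
          cont_intOn (continuous_finsetSum _ fun β hβ => continuous_const.mul (hme β hβ).1.continuous) R
        rw [integral_add i1 i3, integral_finsetSum _ i2]
        simp only [integral_const_mul, avgM, smul_eq_mul]
        rw [mul_add, Finset.mul_sum]
        congr 1
        · ring
        · exact Finset.sum_congr rfl fun _ _ => by ring
      rw [e1, e2, norm_smul, Real.norm_of_nonneg hv]
      gcongr
      refine norm_integral_le_of_norm_le ?_ (Eventually.of_forall hpt)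
      exact cont_intOn ((continuous_const.mul hKc).add
        (continuous_finsetSum _ fun β hβ => continuous_const.mul (hme β hβ).1.continuous)) R
    have hle2 : ε * m + ∑ β ∈ B, κ * me β ≤ 2 * ε * m := by
      have : ∑ β ∈ B, κ * me β ≤ ∑ β ∈ B, κ * m :=
        Finset.sum_le_sum fun β hβ => mul_le_mul_of_nonneg_left (hme β hβ).2 hκ0
      rw [Finset.sum_const, nsmul_eq_mul] at this
      nlinarith
    have hm0 : 0 < m := by linarith
    refine ⟨L / m, div_nonneg hL0 hm0.le, ?_⟩
    have e3 : ((L / m : ℝ) : ℂ) - F 0 = ((L : ℂ) - F 0 * m) / m := by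
      have : (m : ℂ) ≠ 0 := by exact_mod_cast hm0.ne'
      push_cast; field_simp
    rw [e3, norm_div, Complex.norm_real, Real.norm_of_nonneg hm0.le, div_le_iff₀ hm0]
    exact hle.trans hle2
  have him : (F 0).im = 0 := by
    apply abs_nonpos_iff.1
    apply le_of_forall_pos_le_add
    intro ε hε
    obtain ⟨r, h0, h1⟩ := key (ε / 2) (by positivity)
    have := (Complex.abs_im_le_norm _).trans h1
    simp at this
    linarith
  have hre : 0 ≤ (F 0).re := by
    apply le_of_forall_pos_le_add
    intro ε hε
    obtain ⟨r, h0, h1⟩ := key (ε / 2) (by positivity)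
    have := (Complex.abs_re_le_norm _).trans h1
    simp at this
    have := abs_le.1 this
    linarith
  exact ⟨_, hre, Complex.ext rfl (by simpa using him)⟩

theorem BohrCont.sub_trig {F : Eu d → ℂ} (h : BohrCont F) (χ : Eu d) (b : ℂ) :
    BohrCont (fun t => F t - b * ex χ t) := by
  classical
  intro ε hε
  obtain ⟨B, δ, hδ, hB⟩ := h (ε / 2) (by positivity)
  refine ⟨insert χ B, min δ (ε / (2 * (‖b‖ + 1))), lt_min hδ (by positivity), fun τ hτ => ?_⟩
  have h1 := hB τ fun β hβ => (hτ β (Finset.mem_insert_of_mem hβ)).trans_le (min_le_left _ _)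
  have h2 := (hτ χ (Finset.mem_insert_self _ _)).trans_le (min_le_right _ _)
  have e : F τ - b * ex χ τ - (F 0 - b * ex χ 0) = (F τ - F 0) - b * (ex χ τ - 1) := by
    rw [ex_zero_right]; ring
  show ‖F τ - b * ex χ τ - (F 0 - b * ex χ 0)‖ ≤ ε
  rw [e]
  refine (norm_sub_le _ _).trans ?_
  rw [norm_mul]
  have h3 : ‖b‖ * ‖ex χ τ - 1‖ ≤ ε / 2 := by
    calc ‖b‖ * ‖ex χ τ - 1‖ ≤ (‖b‖ + 1) * (ε / (2 * (‖b‖ + 1))) := by gcongr; linarith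
      _ = ε / 2 := by field_simp
  linarith

theorem bessel {F : Eu d → ℂ} (S : Finset (Eu d)) (hF : Continuous F) {C : ℝ} (hC : ∀ t, ‖F t‖ ≤ C) (hB : BohrCont F)
    {a : Eu d → ℝ} (ha : ∀ χ, 0 ≤ a χ) (hm : ∀ χ, HasMean volume (fun t => ex (-χ) t * F t) (a χ : ℂ)) :
    ∃ r : ℝ, F 0 = (r : ℂ) ∧ ∑ χ ∈ S, a χ ≤ r := by
  classical
  induction S using Finset.induction_on generalizing F C a with
  | empty =>
    obtain ⟨r, h1, h2⟩ := kernel_lemma hF hC hB ha hm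
    exact ⟨r, h2, by simpa using h1⟩
  | insert χ₀ S hχ ih =>
    let a' : Eu d → ℝ := fun χ => if χ = χ₀ then 0 else a χ
    obtain ⟨r, h1, h2⟩ := ih (F := fun t => F t - (a χ₀ : ℂ) * ex χ₀ t) (C := C + ‖(a χ₀ : ℂ)‖) (a := a')
      (hF.sub (continuous_const.mul (ex_continuous _)))
      (fun t => (norm_sub_le _ _).trans (by rw [norm_mul, ex_norm, mul_one]; gcongr; exact hC t))
      (hB.sub_trig _ _) (fun χ => by simp only [a']; split_ifs; exacts [le_rfl, ha _]) (fun χ => by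
        have h3 := mean_ex (χ₀ + -χ)
        have h4 := (h3.const_mul (-(a χ₀ : ℂ)))
        have h5 := HasMean.sum (Finset.univ : Finset (Fin 2))
          (G := ![fun t => ex (-χ) t * F t, fun t => (-(a χ₀ : ℂ)) * ex (χ₀ + -χ) t])
          (m := ![(a χ : ℂ), (-(a χ₀ : ℂ)) * (if χ₀ + -χ = 0 then 1 else 0)])
          (by
            intro i _
            fin_cases i
            · exact (ex_continuous _).mul hF
            · exact continuous_const.mul (ex_continuous _))
          (by
            intro i _
            fin_cases i
            · exact hm χ
            · exact h4)
        simp only [Fin.sum_univ_two, Matrix.cons_val_zero, Matrix.cons_val_one] at h5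
        convert h5 using 1
        · ext t; rw [ex_add_left]; ring
        · simp only [a']
          have : χ₀ + -χ = 0 ↔ χ = χ₀ := by rw [← sub_eq_add_neg, sub_eq_zero, eq_comm]
          simp only [this]
          split_ifs with h
          · subst h; simp
          · simp)
    simp only [ex_zero_right, mul_one] at h1
    refine ⟨r + a χ₀, by push_cast; rw [← h1]; ring, ?_⟩
    rw [Finset.sum_insert hχ]
    have : ∑ χ ∈ S, a χ = ∑ χ ∈ S, a' χ := Finset.sum_congr rfl fun χ h => by
      simp only [a']; rw [if_neg]; rintro rfl; exact hχ h
    linarith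

theorem HasMean.shift {V : Type*} [NormedAddCommGroup V] [NormedSpace ℝ V] {ν : Measure (Eu d)} {G : Eu d → V} {m : V}
    (h : HasMean ν G m) (r : ℝ) :
    Tendsto (fun R => (volB d R)⁻¹ • ∫ t in ball (0 : Eu d) (R + r), G t ∂ν) atTop (𝓝 m) := by
  have h1 : Tendsto (fun R => avgM ν G (R + r)) atTop (𝓝 m) := Tendsto.comp h (tendsto_atTop_add_const_right _ r tendsto_id)
  have h2 := (volB_ratio (d := d) r).smul h1
  rw [one_smul] at h2
  refine h2.congr' ?_
  filter_upwards [eventually_gt_atTop (-r)] with R hR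
  have := volB_pos (d := d) (by linarith : 0 < R + r)
  rw [avgM, smul_smul, mul_assoc, mul_inv_cancel₀ this.ne', mul_one]

theorem HasMean.meas {ν : Measure (Eu d)} {m : ℂ}
    (h : HasMean ν (fun _ => (1 : ℂ)) m) (r : ℝ) :
    Tendsto (fun R => (volB d R)⁻¹ * (ν (ball (0 : Eu d) (R + r))).toReal) atTop (𝓝 m.re) := by
  refine ((Complex.continuous_re.tendsto _).comp (h.shift r)).congr fun R => ?_
  simp [measureReal_def]

theorem hasMean_conv {μ : Measure (Eu d)} [IsLocallyFiniteMeasure μ] {c : Eu d → ℂ}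
    (hc : ∀ χ, HasMean μ (ex (-χ)) (c χ)) {h : Eu d → ℂ} (hcont : Continuous h) (hsupp : HasCompactSupport h)
    (χ : Eu d) :
    HasMean volume (fun t => ex (-χ) t * ∫ x, h (t - x) ∂μ) ((∫ u, h u * ex (-χ) u) * c χ) := by
  obtain ⟨r, hr0, hr⟩ : ∃ r : ℝ, 0 < r ∧ ∀ u, r ≤ ‖u‖ → h u = 0 := by
    obtain ⟨r, hr⟩ := hsupp.isCompact.isBounded.subset_ball (0 : Eu d)
    refine ⟨max r 1, by positivity, fun u hu => ?_⟩
    by_contra h0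
    have h1 := hr (subset_tsupport _ (Function.mem_support.2 h0))
    rw [mem_ball_zero_iff] at h1
    exact absurd (le_max_left r 1) (by linarith)
  obtain ⟨M, hM⟩ := hcont.bounded_above_of_compact_support hsupp
  set A := ∫ u, h u * ex (-χ) u with hA
  set N := ∫ u, ‖h u‖ with hN
  have hN0 : 0 ≤ N := integral_nonneg fun _ => norm_nonneg _
  have hhi : Integrable h := hcont.integrable_of_hasCompactSupport hsupp
  have hfin : ∀ R, μ (ball (0 : Eu d) R) ≠ ∞ := fun R => measure_ball_lt_top.ne
  have hAx : ∀ x, ∫ t, ex (-χ) t * h (t - x) = A * ex (-χ) x := by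
    intro x
    rw [hA, ← integral_mul_const, ← integral_sub_right_eq_self (fun u => h u * ex (-χ) u * ex (-χ) x) x]
    congr 1; ext t
    rw [mul_assoc, ← ex_add_right, sub_add_cancel, mul_comm]
  have hnx : ∀ x, ∫ t, ‖ex (-χ) t * h (t - x)‖ = N := by
    intro x
    rw [hN, ← integral_sub_right_eq_self (fun u => ‖h u‖) x]
    congr 1; ext t
    rw [norm_mul, ex_norm, one_mul]
  have hix : ∀ x, Integrable (fun t => ex (-χ) t * h (t - x)) := by
    intro x
    refine (hhi.comp_sub_right x).bdd_mul (c := 1) (ex_continuous _).aestronglyMeasurable (Eventually.of_forall fun t => (ex_norm _ _).le)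
  have key : ∀ R, ‖(∫ t in ball (0 : Eu d) R, ex (-χ) t * ∫ x, h (t - x) ∂μ) - A * ∫ x in ball (0 : Eu d) (R + r), ex (-χ) x ∂μ‖
      ≤ 2 * N * ((μ (ball (0 : Eu d) (R + r))).toReal - (μ (ball (0 : Eu d) (R + -r))).toReal) := by
    intro R
    set D := ball (0 : Eu d) (R + r)
    set P : Eu d → ℂ := fun x => ∫ t in ball (0 : Eu d) R, ex (-χ) t * h (t - x) with hP
    have : IsFiniteMeasure (μ.restrict D) := ⟨by rw [Measure.restrict_apply_univ]; exact (hfin _).lt_top⟩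
    have : IsFiniteMeasure ((volume : Measure (Eu d)).restrict (ball (0 : Eu d) R)) := ⟨by rw [Measure.restrict_apply_univ]; exact measure_ball_lt_top⟩
    have hint : Integrable (Function.uncurry fun t x => ex (-χ) t * h (t - x))
        (((volume : Measure (Eu d)).restrict (ball (0 : Eu d) R)).prod (μ.restrict D)) := by
      refine Integrable.of_bound (C := M) ?_ (Eventually.of_forall ?_)
      · refine Continuous.aestronglyMeasurable ?_
        exact ((ex_continuous _).comp continuous_fst).mul (hcont.comp (continuous_fst.sub continuous_snd))
      · rintro ⟨t, x⟩
        simp only [Function.uncurry, norm_mul, ex_norm, one_mul]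
        exact hM _
    have e1 : (∫ t in ball (0 : Eu d) R, ex (-χ) t * ∫ x, h (t - x) ∂μ) = ∫ x in D, P x ∂μ := by
      rw [hP, ← integral_integral_swap hint]
      refine setIntegral_congr_fun measurableSet_ball fun t ht => ?_
      rw [integral_const_mul, setIntegral_eq_integral_of_forall_compl_eq_zero]
      intro x hx
      apply hr
      rw [mem_ball_zero_iff] at ht
      have hx' : R + r ≤ ‖x‖ := by
        by_contra h0; exact hx (mem_ball_zero_iff.2 (not_le.1 h0))
      have := norm_sub_norm_le x t
      rw [norm_sub_rev] at this
      linarith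
    have hPi : IntegrableOn P D μ := hint.integral_prod_right
    have hei : IntegrableOn (fun x => A * ex (-χ) x) D μ := (cont_intOn (ex_continuous _) _).const_mul A
    rw [e1, ← integral_const_mul, ← integral_sub hPi hei]
    have hzero : ∀ x ∈ ball (0 : Eu d) (R + -r), P x - A * ex (-χ) x = 0 := by
      intro x hx
      rw [mem_ball_zero_iff] at hx
      rw [sub_eq_zero, hP, ← hAx]
      apply setIntegral_eq_integral_of_forall_compl_eq_zero
      intro t ht
      have ht' : R ≤ ‖t‖ := by
        by_contra h0; exact ht (mem_ball_zero_iff.2 (not_le.1 h0))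
      rw [hr, mul_zero]
      have := norm_sub_norm_le t x
      linarith
    have hbd : ∀ x, ‖P x - A * ex (-χ) x‖ ≤ 2 * N := by
      intro x
      have h1 : ‖P x‖ ≤ N := by
        refine (norm_integral_le_integral_norm _).trans ?_
        rw [← hnx x]
        exact setIntegral_le_integral (hix x).norm (Eventually.of_forall fun _ => norm_nonneg _)
      have h2 : ‖A * ex (-χ) x‖ ≤ N := by
        rw [← hAx, ← hnx x]; exact norm_integral_le_integral_norm _
      exact (norm_sub_le _ _).trans (by linarith)
    have hsub : ball (0 : Eu d) (R + -r) ⊆ D := ball_subset_ball (by linarith)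
    have h0 : ∫ x in ball (0 : Eu d) (R + -r), (P x - A * ex (-χ) x) ∂μ = 0 :=
      setIntegral_eq_zero_of_forall_eq_zero hzero
    have h1 := setIntegral_sdiff measurableSet_ball (hPi.sub hei) hsub
    simp only [Pi.sub_apply] at h1
    rw [h0, sub_zero] at h1
    rw [← h1]
    refine (norm_setIntegral_le_of_norm_le_const (lt_of_le_of_lt (measure_mono Set.sdiff_subset) (hfin _).lt_top) (fun t _ => hbd t)).trans ?_
    rw [measureReal_def, measure_sdiff hsub measurableSet_ball.nullMeasurableSet (hfin _),
      ENNReal.toReal_sub_of_le (measure_mono hsub) (hfin _)]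
  have h1 : HasMean μ (fun _ => (1 : ℂ)) (c 0) := by
    have := hc 0
    have e : ex (-(0 : Eu d)) = fun _ => 1 := by ext t; rw [neg_zero, ex_zero_left]
    rwa [e] at this
  have herr := (((h1.meas r).sub (h1.meas (-r))).const_mul (2 * N))
  rw [sub_self, mul_zero] at herr
  have hmain := ((hc χ).shift r).const_mul A
  have hdiff : Tendsto (fun R => avgM volume (fun t => ex (-χ) t * ∫ x, h (t - x) ∂μ) R -
      A * ((volB d R)⁻¹ • ∫ t in ball (0 : Eu d) (R + r), ex (-χ) t ∂μ)) atTop (𝓝 0) := by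
    refine squeeze_zero_norm (fun R => ?_) herr
    rw [avgM, mul_smul_comm, ← smul_sub, norm_smul, Real.norm_of_nonneg (inv_nonneg.2 (volB_nonneg R)), ← mul_sub]
    calc _ ≤ (volB d R)⁻¹ * (2 * N * ((μ (ball (0 : Eu d) (R + r))).toReal - (μ (ball (0 : Eu d) (R + -r))).toReal)) := by
          have := inv_nonneg.2 (volB_nonneg (d := d) R)
          gcongr; exact key R
      _ = _ := by ring
  have := hdiff.add hmain
  rw [zero_add] at this
  exact this.congr fun R => by ring

/-- The autocorrelation of `f`. -/
def acor (f : Eu d → ℂ) (t : Eu d) : ℂ := ∫ s, f s * (starRingEnd ℂ) (f (s - t))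

theorem acor_eq_conv (f : Eu d → ℂ) :
    acor f = convolution f (fun y => (starRingEnd ℂ) (f (-y))) (ContinuousLinearMap.mul ℝ ℂ) volume := by
  ext t
  simp only [acor, convolution, ContinuousLinearMap.mul_apply', neg_sub]

theorem tilde_cont {f : Eu d → ℂ} (hf : Continuous f) : Continuous fun y => (starRingEnd ℂ) (f (-y)) :=
  Complex.continuous_conj.comp (hf.comp continuous_neg)

theorem tilde_supp {f : Eu d → ℂ} (hs : HasCompactSupport f) :
    HasCompactSupport fun y => (starRingEnd ℂ) (f (-y)) := by
  have h1 : HasCompactSupport fun y => f (-y) := hs.comp_homeomorph (Homeomorph.neg (Eu d))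
  exact h1.comp_left (map_zero _)

theorem acor_cont {f : Eu d → ℂ} (hf : Continuous f) (hs : HasCompactSupport f) : Continuous (acor f) := by
  rw [acor_eq_conv]
  exact (tilde_supp hs).continuous_convolution_right _ hf.locallyIntegrable (tilde_cont hf)

theorem acor_supp {f : Eu d → ℂ} (hs : HasCompactSupport f) : HasCompactSupport (acor f) := by
  rw [acor_eq_conv]
  exact hs.convolution _ (tilde_supp hs)

theorem acor_fourier {f : Eu d → ℂ} (hf : Continuous f) (hs : HasCompactSupport f) (χ : Eu d) :
    ∫ u, acor f u * ex χ u = ((‖∫ s, f s * ex χ s‖ ^ 2 : ℝ) : ℂ) := by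
  have i1 : Integrable fun s => f s * ex χ s :=
    (hf.mul (ex_continuous χ)).integrable_of_hasCompactSupport hs.mul_right
  have i2 : Integrable fun s => (starRingEnd ℂ) (f (-s)) * ex χ s :=
    ((tilde_cont hf).mul (ex_continuous χ)).integrable_of_hasCompactSupport (tilde_supp hs).mul_right
  have h := integral_convolution (μ := (volume : Measure (Eu d))) (ν := volume) (ContinuousLinearMap.mul ℝ ℂ) i1 i2
  have e1 : (convolution (fun s => f s * ex χ s) (fun s => (starRingEnd ℂ) (f (-s)) * ex χ s)
      (ContinuousLinearMap.mul ℝ ℂ) volume) = fun u => acor f u * ex χ u := by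
    ext u
    simp only [acor, convolution, ContinuousLinearMap.mul_apply', neg_sub]
    rw [← integral_mul_const]
    congr 1; ext s
    have : ex χ u = ex χ s * ex χ (u - s) := by rw [← ex_add_right, add_sub_cancel]
    rw [this]; ring
  rw [e1] at h
  rw [h, ContinuousLinearMap.mul_apply']
  have e2 : ∫ s, (starRingEnd ℂ) (f (-s)) * ex χ s = (starRingEnd ℂ) (∫ s, f s * ex χ s) := by
    rw [← integral_conj, ← integral_neg_eq_self]
    congr 1; ext s
    rw [neg_neg, ex_neg_right, ex_neg_left, map_mul]
  rw [e2, Complex.mul_conj']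
  push_cast; rfl

theorem acor_bessel {μ : Measure (Eu d)} [IsLocallyFiniteMeasure μ]
    (hSAP : ∀ f : Eu d → ℂ, Continuous f → HasCompactSupport f →
      IsBohrAlmostPeriodic fun t => ∫ x, f (t - x) ∂μ)
    {a : Eu d → ℝ} (ha : ∀ χ, 0 ≤ a χ)
    (hc : ∀ χ, HasMean μ (ex (-χ)) (a χ : ℂ)) {f : Eu d → ℂ} (hf : Continuous f) (hs : HasCompactSupport f)
    (S : Finset (Eu d)) :
    ∃ r : ℝ, ∫ t, acor f t ∂μ = (r : ℂ) ∧ ∑ χ ∈ S, ‖∫ s, f s * ex χ s‖ ^ 2 * a χ ≤ r := by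
  have hWc : Continuous fun u => acor f (-u) := (acor_cont hf hs).comp continuous_neg
  have hWs : HasCompactSupport fun u => acor f (-u) := (acor_supp hs).comp_homeomorph (Homeomorph.neg (Eu d))
  have hAP := hSAP _ hWc hWs
  obtain ⟨C, hC⟩ := hAP.2.1
  obtain ⟨r, h1, h2⟩ := bessel S hAP.1 hC (fun ε hε => bohr_cont hAP ε hε)
    (a := fun χ => ‖∫ s, f s * ex χ s‖ ^ 2 * a χ) (fun χ => mul_nonneg (by positivity) (ha χ)) (fun χ => by
      have h := hasMean_conv hc hWc hWs χ
      convert h using 1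
      push_cast
      congr 1
      rw [← Complex.ofReal_pow, ← acor_fourier hf hs, ← integral_neg_eq_self]
      congr 1; ext u
      rw [ex_neg_right])
  refine ⟨r, ?_, h2⟩
  rw [← h1]
  congr 1; ext x
  rw [zero_sub, neg_neg]

/-- The tent function. -/
def tent (r : ℝ) (s : Eu d) : ℝ := max 0 (r - ‖s‖)

theorem tent_nonneg (r : ℝ) (s : Eu d) : 0 ≤ tent r s := le_max_left _ _

theorem tent_cont (r : ℝ) : Continuous (tent r : Eu d → ℝ) := continuous_const.max (continuous_const.sub continuous_norm)

theorem tent_zero {r : ℝ} {s : Eu d} (h : r ≤ ‖s‖) : tent r s = 0 := max_eq_left (by linarith)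

theorem tent_supp (r : ℝ) : HasCompactSupport (tent r : Eu d → ℝ) :=
  HasCompactSupport.intro (isCompact_closedBall (0 : Eu d) r) fun s hs => tent_zero (by
    by_contra h; exact hs (mem_closedBall_zero_iff.2 (not_le.1 h).le))

theorem tent_int (r : ℝ) : Integrable (tent r : Eu d → ℝ) := (tent_cont r).integrable_of_hasCompactSupport (tent_supp r)

theorem tent_int_pos {r : ℝ} (hr : 0 < r) : 0 < ∫ s : Eu d, tent r s :=
  (tent_cont r).integral_pos_of_hasCompactSupport_nonneg_nonzero (tent_supp r) (tent_nonneg r) (x := 0) (by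
    simp [tent, hr.le, hr.ne'])

theorem tentC_cont (r : ℝ) : Continuous fun s : Eu d => (tent r s : ℂ) := Complex.continuous_ofReal.comp (tent_cont r)

theorem tentC_supp (r : ℝ) : HasCompactSupport fun s : Eu d => (tent r s : ℂ) := (tent_supp r).comp_left (g := fun x : ℝ => (x : ℂ)) (by simp)

theorem acor_mod (f : Eu d → ℂ) (χ u : Eu d) : acor (fun s => f s * ex χ s) u = acor f u * ex χ u := by
  unfold acor
  rw [← integral_mul_const]
  congr 1; ext s
  have h1 : ex χ s = ex χ u * ex χ (s - u) := by rw [← ex_add_right, add_sub_cancel]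
  have h2 : ex χ (s - u) * (starRingEnd ℂ) (ex χ (s - u)) = 1 := by
    rw [Complex.mul_conj', ex_norm]; simp
  simp only [map_mul]
  rw [h1]
  linear_combination f s * (starRingEnd ℂ) (f (s - u)) * ex χ u * h2

theorem ex_re_ge {η s : Eu d} (h : |2 * Real.pi * ⟪η, s⟫| ≤ 1) : 1 / 2 ≤ (ex η s).re := by
  rw [ex, Complex.exp_ofReal_mul_I_re]
  have h1 := Real.one_sub_sq_div_two_le_cos (x := 2 * Real.pi * ⟪η, s⟫)
  have h2 : (2 * Real.pi * ⟪η, s⟫) ^ 2 ≤ 1 := by rw [← sq_abs]; nlinarith [abs_nonneg (2 * Real.pi * ⟪η, s⟫)]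
  linarith

theorem c_tb {μ : Measure (Eu d)} [IsLocallyFiniteMeasure μ]
    (hSAP : ∀ f : Eu d → ℂ, Continuous f → HasCompactSupport f →
      IsBohrAlmostPeriodic fun t => ∫ x, f (t - x) ∂μ)
    {a : Eu d → ℝ} (ha : ∀ χ, 0 ≤ a χ)
    (hc : ∀ χ, HasMean μ (ex (-χ)) (a χ : ℂ)) (K : Set (Eu d)) (hK : IsCompact K) :
    ∃ Q : ℝ, ∀ (t : Eu d) (S : Finset (Eu d)), (∀ χ ∈ S, χ - t ∈ K) → ∑ χ ∈ S, a χ ≤ Q := by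
  obtain ⟨ρ, hρ0, hρ⟩ : ∃ ρ : ℝ, 0 < ρ ∧ ∀ η ∈ K, ‖η‖ ≤ ρ := by
    obtain ⟨ρ, hρ⟩ := hK.isBounded.exists_norm_le
    exact ⟨max ρ 1, by positivity, fun η hη => (hρ η hη).trans (le_max_left _ _)⟩
  set r : ℝ := (2 * Real.pi * ρ)⁻¹ with hr
  have hr0 : 0 < r := by have := Real.pi_pos; positivity
  set q : ℝ := (∫ s : Eu d, tent r s) / 2 with hq
  have hq0 : 0 < q := by have := tent_int_pos (d := d) hr0; positivity
  set Bd : ℝ := ∫ u, ‖acor (fun s : Eu d => (tent r s : ℂ)) u‖ ∂μ with hBd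
  refine ⟨Bd / q ^ 2, fun t S hS => ?_⟩
  obtain ⟨r', h1, h2⟩ := acor_bessel hSAP ha hc (f := fun s => (tent r s : ℂ) * ex (-t) s)
    ((tentC_cont r).mul (ex_continuous _)) (tentC_supp r).mul_right S
  have h3 : r' ≤ Bd := by
    have h4 : ‖(r' : ℂ)‖ ≤ Bd := by
      rw [← h1]
      refine (norm_integral_le_integral_norm _).trans (le_of_eq ?_)
      rw [hBd]
      congr 1; ext u
      rw [acor_mod, norm_mul, ex_norm, mul_one]
    rw [Complex.norm_real] at h4
    exact (le_abs_self _).trans h4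
  have h5 : ∀ χ ∈ S, q ^ 2 * a χ ≤ ‖∫ s, ((tent r s : ℂ) * ex (-t) s) * ex χ s‖ ^ 2 * a χ := by
    intro χ hχ
    have hη := hρ _ (hS χ hχ)
    refine mul_le_mul_of_nonneg_right ?_ (ha χ)
    refine pow_le_pow_left₀ hq0.le ?_ 2
    have e : (fun s : Eu d => ((tent r s : ℂ) * ex (-t) s) * ex χ s) = fun s => (tent r s : ℂ) * ex (χ - t) s := by
      ext s; rw [sub_eq_add_neg, ex_add_left]; ring
    rw [e]
    have hi : Integrable fun s : Eu d => (tent r s : ℂ) * ex (χ - t) s :=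
      ((tentC_cont r).mul (ex_continuous _)).integrable_of_hasCompactSupport (tentC_supp r).mul_right
    refine le_trans ?_ (Complex.re_le_norm _)
    have hre : (∫ s : Eu d, (tent r s : ℂ) * ex (χ - t) s).re = ∫ s : Eu d, ((tent r s : ℂ) * ex (χ - t) s).re :=
      (integral_re hi).symm
    rw [hre, hq, ← integral_div]
    refine integral_mono ((tent_int r).div_const 2) hi.re fun s => ?_
    simp only [Complex.re_ofReal_mul]
    by_cases hs : r ≤ ‖s‖
    · rw [tent_zero hs]; simp
    · have h6 : |2 * Real.pi * ⟪χ - t, s⟫| ≤ 1 := by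
        rw [abs_mul, abs_of_pos (by have := Real.pi_pos; positivity : 0 < 2 * Real.pi)]
        have h7 := abs_real_inner_le_norm (χ - t) s
        have h8 : ‖χ - t‖ * ‖s‖ ≤ ρ * r := by
          have := norm_nonneg s
          have := not_le.1 hs
          gcongr
        calc 2 * Real.pi * |⟪χ - t, s⟫| ≤ 2 * Real.pi * (ρ * r) := by
              have := Real.pi_pos
              gcongr; exact h7.trans h8
          _ = 1 := by rw [hr]; have := Real.pi_pos; field_simp
      have h9 := ex_re_ge h6
      have := tent_nonneg r s
      nlinarith
  have h6 := Finset.sum_le_sum h5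
  rw [← Finset.mul_sum] at h6
  rw [le_div_iff₀ (by positivity)]
  linarith

theorem step_approx {q : ℝ → ℂ} (hq : Continuous q) {ε : ℝ} (hε : 0 < ε) :
    ∃ N : ℕ, 0 < N ∧ ∀ ρ : ℝ, 0 ≤ ρ → ρ < 2 → ∀ k : ℕ, (k : ℝ) = ⌊ρ * N / 2⌋₊ → ‖q ρ - q (2 * k / N)‖ ≤ ε := by
  have h1 : UniformContinuousOn q (Set.Icc 0 2) := isCompact_Icc.uniformContinuousOn_of_continuous hq.continuousOn
  rw [Metric.uniformContinuousOn_iff] at h1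
  obtain ⟨δ, hδ, h2⟩ := h1 ε hε
  obtain ⟨N, hN⟩ := exists_nat_gt (2 / δ)
  have hN0 : 0 < (N : ℝ) := lt_trans (by positivity) hN
  refine ⟨N, by exact_mod_cast hN0, fun ρ h0 h3 k hk => ?_⟩
  have h4 : (k : ℝ) ≤ ρ * N / 2 := by rw [hk]; exact Nat.floor_le (by positivity)
  have h5 : ρ * N / 2 < k + 1 := by rw [hk]; exact Nat.lt_floor_add_one _
  have h6 : 2 * k / N ≤ ρ := by rw [div_le_iff₀ hN0]; linarith
  have h7 : ρ - 2 * k / N < δ := by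
    have : ρ < 2 * (k + 1) / N := by rw [lt_div_iff₀ hN0]; linarith
    have h8 : 2 / (N : ℝ) < δ := by rw [div_lt_iff₀ hN0]; rw [div_lt_iff₀ hδ] at hN; linarith
    have h9 : 2 * ((k : ℝ) + 1) / N = 2 * k / N + 2 / N := by ring
    linarith
  rw [← dist_eq_norm]
  refine (h2 ρ ⟨h0, h3.le⟩ _ ⟨by positivity, by linarith⟩ ?_).le
  rw [Real.dist_eq, abs_of_nonneg (by linarith)]
  exact h7

/-- Step sums. -/
def stepSum (q : ℝ → ℂ) (N : ℕ) (E : ℝ → ℂ) : ℂ :=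
  ∑ k ∈ Finset.range N, q (2 * k / N) * (E (2 * (k + 1) / N) - E (2 * k / N))

theorem radial_approx {q : ℝ → ℂ} {w : Eu d → ℂ} (hw : Continuous w) (hwq : ∀ t, w t = q ‖t‖)
    (hw0 : ∀ t, 2 ≤ ‖t‖ → w t = 0) {ε : ℝ} (hε : 0 < ε) {N : ℕ} (hN0 : 0 < N)
    (hN : ∀ ρ : ℝ, 0 ≤ ρ → ρ < 2 → ∀ k : ℕ, (k : ℝ) = ⌊ρ * N / 2⌋₊ → ‖q ρ - q (2 * k / N)‖ ≤ ε)
    (ν : Measure (Eu d)) [IsLocallyFiniteMeasure ν] {g : Eu d → ℂ} (hg : Continuous g) (hg1 : ∀ t, ‖g t‖ ≤ 1)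
    {R : ℝ} (hR : 0 < R) :
    ‖(∫ t, g t * w (R⁻¹ • t) ∂ν) - stepSum q N (fun u => ∫ t in ball (0 : Eu d) (u * R), g t ∂ν)‖
      ≤ ε * (ν (ball (0 : Eu d) (2 * R))).toReal := by
  have hNp : (0 : ℝ) < N := by exact_mod_cast hN0
  set p : Eu d → ℂ := fun t => ∑ k ∈ Finset.range N, q (2 * k / N) *
    ((ball (0 : Eu d) ((2 * (k + 1) / N) * R)).indicator g t - (ball (0 : Eu d) ((2 * k / N) * R)).indicator g t) with hp
  have hii : ∀ u : ℝ, Integrable ((ball (0 : Eu d) (u * R)).indicator g) ν := fun u =>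
    (integrable_indicator_iff measurableSet_ball).2 (cont_intOn hg _)
  have hpi1 : ∀ k ∈ Finset.range N, Integrable (fun t => q (2 * k / N) *
    ((ball (0 : Eu d) ((2 * (k + 1) / N) * R)).indicator g t - (ball (0 : Eu d) ((2 * k / N) * R)).indicator g t)) ν :=
    fun k _ => ((hii _).sub (hii _)).const_mul _
  have hpi : Integrable p ν := integrable_finsetSum _ hpi1
  have hpint : ∫ t, p t ∂ν = stepSum q N (fun u => ∫ t in ball (0 : Eu d) (u * R), g t ∂ν) := by
    rw [hp, integral_finsetSum _ hpi1, stepSum]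
    refine Finset.sum_congr rfl fun k _ => ?_
    rw [integral_const_mul, integral_sub (hii _) (hii _), integral_indicator measurableSet_ball, integral_indicator measurableSet_ball]
  have hnorm : ∀ t : Eu d, ‖R⁻¹ • t‖ = ‖t‖ / R := fun t => by
    rw [norm_smul, norm_inv, Real.norm_of_nonneg hR.le]; ring
  have hgi : Integrable (fun t => g t * w (R⁻¹ • t)) ν := by
    refine Continuous.integrable_of_hasCompactSupport (hg.mul (hw.comp (continuous_const_smul _))) ?_
    refine HasCompactSupport.intro (isCompact_closedBall (0 : Eu d) (2 * R)) fun t ht => ?_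
    rw [hw0, mul_zero]
    rw [hnorm, le_div_iff₀ hR]
    by_contra h; exact ht (mem_closedBall_zero_iff.2 (not_le.1 h).le)
  rw [← hpint, ← integral_sub hgi hpi]
  have hout : ∀ t, t ∉ ball (0 : Eu d) (2 * R) → g t * w (R⁻¹ • t) - p t = 0 := by
    intro t ht
    have ht' : 2 * R ≤ ‖t‖ := by by_contra h; exact ht (mem_ball_zero_iff.2 (not_le.1 h))
    rw [hw0 _ (by rw [hnorm, le_div_iff₀ hR]; exact ht'), mul_zero, zero_sub, neg_eq_zero]
    refine Finset.sum_eq_zero fun k hk => ?_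
    have hk' : (k : ℝ) + 1 ≤ N := by exact_mod_cast Finset.mem_range.1 hk
    have a1 : ∀ u : ℝ, u ≤ 2 → (ball (0 : Eu d) (u * R)).indicator g t = 0 := fun u hu => by
      refine Set.indicator_of_notMem (fun h => ?_) _
      rw [mem_ball_zero_iff] at h
      nlinarith
    rw [a1 _ (by rw [div_le_iff₀ hNp]; linarith), a1 _ (by rw [div_le_iff₀ hNp]; linarith), sub_zero, mul_zero]
  rw [← setIntegral_eq_integral_of_forall_compl_eq_zero hout]
  refine norm_setIntegral_le_of_norm_le_const measure_ball_lt_top fun t ht => ?_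
  rw [mem_ball_zero_iff] at ht
  have hρ2 : ‖t‖ / R < 2 := by rw [div_lt_iff₀ hR]; exact ht
  have hρ0 : 0 ≤ ‖t‖ / R := by positivity
  set k₀ := ⌊‖t‖ / R * N / 2⌋₊ with hk₀
  have hmem : ∀ u : ℝ, (ball (0 : Eu d) (u * R)).indicator g t = if ‖t‖ / R < u then g t else 0 := fun u => by
    by_cases hu : ‖t‖ / R < u
    · rw [if_pos hu, Set.indicator_of_mem]
      rw [mem_ball_zero_iff]; exact (div_lt_iff₀ hR).1 hu
    · rw [if_neg hu, Set.indicator_of_notMem]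
      rw [mem_ball_zero_iff]; exact fun h => hu ((div_lt_iff₀ hR).2 h)
  have h4 : (k₀ : ℝ) ≤ ‖t‖ / R * N / 2 := Nat.floor_le (by positivity)
  have h5 : ‖t‖ / R * N / 2 < k₀ + 1 := Nat.lt_floor_add_one _
  have hpt : p t = q (2 * k₀ / N) * g t := by
    rw [hp]
    simp only [hmem]
    rw [Finset.sum_eq_single k₀]
    · rw [if_pos (by rw [lt_div_iff₀ hNp]; linarith), if_neg (by rw [lt_div_iff₀ hNp]; linarith), sub_zero]
    · intro k _ hk
      rcases lt_or_gt_of_ne hk with h | h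
      · have : (k : ℝ) + 1 ≤ k₀ := by exact_mod_cast h
        rw [if_neg (by rw [lt_div_iff₀ hNp]; linarith), if_neg (by rw [lt_div_iff₀ hNp]; linarith), sub_zero, mul_zero]
      · have : (k₀ : ℝ) + 1 ≤ k := by exact_mod_cast h
        rw [if_pos (by rw [lt_div_iff₀ hNp]; linarith), if_pos (by rw [lt_div_iff₀ hNp]; linarith), sub_self, mul_zero]
    · intro h
      exfalso; apply h
      rw [Finset.mem_range]
      have : (k₀ : ℝ) < N := by nlinarith
      exact_mod_cast this
  rw [hpt, hwq, hnorm, show g t * q (‖t‖ / R) - q (2 * k₀ / N) * g t = g t * (q (‖t‖ / R) - q (2 * k₀ / N)) by ring, norm_mul]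
  calc _ ≤ 1 * ε := mul_le_mul (hg1 t) (hN _ hρ0 hρ2 k₀ rfl) (norm_nonneg _) zero_le_one
    _ = ε := one_mul _

theorem HasMean.scale {V : Type*} [NormedAddCommGroup V] [NormedSpace ℝ V] {ν : Measure (Eu d)} {G : Eu d → V} {m : V}
    (h : HasMean ν G m) {u : ℝ} (hu : 0 ≤ u) :
    Tendsto (fun R => (volB d R)⁻¹ • ∫ t in ball (0 : Eu d) (u * R), G t ∂ν) atTop (𝓝 (((volB d 1)⁻¹ * volB d u) • m)) := by
  rcases hu.eq_or_lt with rfl | hu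
  · simp [volB]
  have h1 : Tendsto (fun R => avgM ν G (u * R)) atTop (𝓝 m) := Tendsto.comp h (tendsto_id.const_mul_atTop hu)
  refine (h1.const_smul ((volB d 1)⁻¹ * volB d u)).congr' ?_
  filter_upwards [eventually_gt_atTop 0] with R hR
  have h1 := volB_pos (d := d) one_pos
  rw [avgM, smul_smul]
  congr 1
  rw [volB_eq hR, volB_eq hu, volB_eq (mul_pos hu hR), mul_pow]
  field_simp

theorem radial_limit {q : ℝ → ℂ} (hq : Continuous q) {w : Eu d → ℂ} (hw : Continuous w) (hwq : ∀ t, w t = q ‖t‖)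
    (hw0 : ∀ t, 2 ≤ ‖t‖ → w t = 0)
    (ν : Measure (Eu d)) [IsLocallyFiniteMeasure ν] {g : Eu d → ℂ} (hg : Continuous g) (hg1 : ∀ t, ‖g t‖ ≤ 1)
    {m m0 : ℂ} (hm : HasMean ν g m) (hm0 : HasMean ν (fun _ => (1 : ℂ)) m0) :
    Tendsto (fun R => (volB d R)⁻¹ • ∫ t, g t * w (R⁻¹ • t) ∂ν) atTop (𝓝 (m * ((volB d 1)⁻¹ • ∫ t, w t))) := by
  have hv1 := volB_pos (d := d) one_pos
  set J := (volB d 1)⁻¹ • ∫ t, w t with hJ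
  set κ : ℝ → ℝ := fun u => (volB d 1)⁻¹ * volB d u with hκ
  have hms : Tendsto (fun R => (volB d R)⁻¹ * (ν (ball (0 : Eu d) (2 * R))).toReal) atTop (𝓝 (κ 2 * m0.re)) := by
    have := (Complex.continuous_re.tendsto _).comp (hm0.scale (zero_le_two))
    rw [Complex.real_smul, Complex.re_ofReal_mul] at this
    refine this.congr fun R => ?_
    simp [measureReal_def]
  rw [Metric.tendsto_atTop']
  intro η hη
  obtain ⟨ε, hε, hεη⟩ : ∃ ε : ℝ, 0 < ε ∧ ε * (|κ 2 * m0.re| + 1 + ‖m‖ * |κ 2| + 1) < η := by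
    have : 0 < |κ 2 * m0.re| + 1 + ‖m‖ * |κ 2| + 1 := by positivity
    refine ⟨η / (2 * (|κ 2 * m0.re| + 1 + ‖m‖ * |κ 2| + 1)), by positivity, ?_⟩
    rw [div_mul_eq_mul_div, div_lt_iff₀ (by positivity)]
    nlinarith
  obtain ⟨N, hN0, hN⟩ := step_approx hq hε
  have hNp : (0 : ℝ) < N := by exact_mod_cast hN0
  set σ := stepSum q N (fun u => (κ u : ℂ)) with hσ
  have hstep : Tendsto (fun R => (volB d R)⁻¹ • stepSum q N (fun u => ∫ t in ball (0 : Eu d) (u * R), g t ∂ν)) atTop (𝓝 (m * σ)) := by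
    have h1 := tendsto_finsetSum (Finset.range N) (fun k _ =>
      ((hm.scale (u := 2 * ((k : ℝ) + 1) / N) (by positivity)).sub (hm.scale (u := 2 * (k : ℝ) / N) (by positivity))).const_mul (q (2 * k / N)))
    refine (h1.congr fun R => ?_).trans_eq ?_
    · rw [stepSum, Finset.smul_sum]
      refine Finset.sum_congr rfl fun k _ => ?_
      rw [← smul_sub, mul_smul_comm]
    · congr 1
      rw [hσ, stepSum, Finset.mul_sum]
      refine Finset.sum_congr rfl fun k _ => ?_
      simp only [Complex.real_smul, hκ]
      ring
  have hJσ : ‖J - σ‖ ≤ ε * κ 2 := by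
    have h1 := radial_approx hw hwq hw0 hε hN0 hN volume (g := fun _ => 1) continuous_const (by simp) one_pos
    simp only [one_mul, inv_one, one_smul, mul_one] at h1
    have h2 : σ = (volB d 1)⁻¹ • stepSum q N (fun u => ∫ t in ball (0 : Eu d) u, (1 : ℂ)) := by
      rw [hσ, stepSum, stepSum, Finset.smul_sum]
      refine Finset.sum_congr rfl fun k _ => ?_
      have h3 : ∀ u : ℝ, ∫ t in ball (0 : Eu d) u, (1 : ℂ) = (volB d u : ℂ) := fun u => by
        simp [volB, measureReal_def]
      simp only [h3, hκ, Complex.real_smul]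
      push_cast; ring
    rw [hJ, h2, ← smul_sub, norm_smul, Real.norm_of_nonneg (by positivity)]
    calc _ ≤ (volB d 1)⁻¹ * (ε * (volume (ball (0 : Eu d) 2)).toReal) := by gcongr
      _ = _ := by rw [hκ]; unfold volB; ring
  have e1 := (Metric.tendsto_atTop'.1 hstep) ε hε
  obtain ⟨R1, hR1⟩ := e1
  obtain ⟨R2, hR2⟩ := eventually_atTop.1 (hms.eventually (gt_mem_nhds (lt_of_le_of_lt (le_abs_self _) (lt_add_one |κ 2 * m0.re|))))
  refine ⟨max (max R1 R2) 0, fun R hR => ?_⟩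
  have hRpos : 0 < R := lt_of_le_of_lt (le_max_right _ _) hR
  have g1 := hR1 R (lt_of_le_of_lt ((le_max_left _ _).trans (le_max_left _ _)) hR)
  have g2 := hR2 R (lt_of_le_of_lt ((le_max_right _ _).trans (le_max_left _ _)) hR).le
  have g3 := radial_approx hw hwq hw0 hε hN0 hN ν hg hg1 hRpos
  have hv := inv_nonneg.2 (volB_nonneg (d := d) R)
  set X := ∫ t, g t * w (R⁻¹ • t) ∂ν
  set Y := stepSum q N (fun u => ∫ t in ball (0 : Eu d) (u * R), g t ∂ν)
  rw [dist_eq_norm] at g1 ⊢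
  have e : (volB d R)⁻¹ • X - m * J = (volB d R)⁻¹ • (X - Y) + (((volB d R)⁻¹ • Y - m * σ) + m * (σ - J)) := by
    rw [smul_sub]; ring
  have g4 : ‖(volB d R)⁻¹ • (X - Y)‖ ≤ ε * (|κ 2 * m0.re| + 1) := by
    rw [norm_smul, Real.norm_of_nonneg hv]
    calc _ ≤ (volB d R)⁻¹ * (ε * (ν (ball (0 : Eu d) (2 * R))).toReal) := by gcongr
      _ = ε * ((volB d R)⁻¹ * (ν (ball (0 : Eu d) (2 * R))).toReal) := by ring
      _ ≤ _ := by gcongr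
  have g5 : ‖m * (σ - J)‖ ≤ ε * (‖m‖ * |κ 2|) := by
    rw [norm_mul, norm_sub_rev]
    have := mul_le_mul_of_nonneg_left (hJσ.trans (mul_le_mul_of_nonneg_left (le_abs_self (κ 2)) hε.le)) (norm_nonneg m)
    linarith
  rw [e]
  have t1 := norm_add_le ((volB d R)⁻¹ • (X - Y)) (((volB d R)⁻¹ • Y - m * σ) + m * (σ - J))
  have t2 := norm_add_le ((volB d R)⁻¹ • Y - m * σ) (m * (σ - J))
  nlinarith

/-- Autocorrelation of the tent. -/
def wt (t : Eu d) : ℂ := acor (fun s : Eu d => (tent 1 s : ℂ)) t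

theorem wt_cont : Continuous (wt : Eu d → ℂ) := acor_cont (tentC_cont 1) (tentC_supp 1)

theorem wt_zero (t : Eu d) (ht : 2 ≤ ‖t‖) : wt t = 0 := by
  unfold wt acor
  refine integral_eq_zero_of_ae (Eventually.of_forall fun s => ?_)
  simp only [Pi.zero_apply, Complex.conj_ofReal]
  by_cases hs : 1 ≤ ‖s‖
  · rw [tent_zero hs]; simp
  · have : 1 ≤ ‖s - t‖ := by
      have := norm_sub_norm_le t s
      rw [norm_sub_rev] at this
      linarith
    rw [tent_zero this]; simp

theorem wt_radial {t t' : Eu d} (h : ‖t‖ = ‖t'‖) : wt t = wt t' := by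
  set e : Eu d ≃ₗᵢ[ℝ] Eu d := (Submodule.span ℝ {t - t'})ᗮ.reflection with he
  have het : e t = t' := Submodule.reflection_sub h
  unfold wt acor
  rw [← e.measurePreserving.integral_comp e.toHomeomorph.measurableEmbedding
    (fun s : Eu d => (tent 1 s : ℂ) * (starRingEnd ℂ) (tent 1 (s - t') : ℂ))]
  congr 1; ext s
  have h1 : e s - t' = e (s - t) := by rw [map_sub, het]
  simp only [h1, tent, e.norm_map]

theorem wt_int_pos : ∃ J : ℝ, 0 < J ∧ ∫ t : Eu d, wt t = (J : ℂ) := by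
  have h := acor_fourier (tentC_cont (d := d) 1) (tentC_supp 1) 0
  simp only [ex_zero_left, mul_one] at h
  refine ⟨_, ?_, h⟩
  rw [integral_complex_ofReal, Complex.norm_real]
  have := tent_int_pos (d := d) one_pos
  exact pow_pos (norm_pos_iff.2 this.ne') 2

theorem acor_scale {f : Eu d → ℂ} {R : ℝ} (hR : 0 < R) (t : Eu d) :
    acor (fun s => f (R⁻¹ • s)) t = ((R ^ d : ℝ) : ℂ) * acor f (R⁻¹ • t) := by
  unfold acor
  have h := Measure.integral_comp_inv_smul_of_nonneg (volume : Measure (Eu d)) (fun s => f s * (starRingEnd ℂ) (f (s - R⁻¹ • t))) hR.le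
  simp only [smul_sub]
  rw [h, finrank_euclideanSpace_fin, Complex.real_smul]

theorem c_nonneg {μ : Measure (Eu d)} [IsLocallyFiniteMeasure μ] {c : Eu d → ℂ}
    (hPD : ∀ f : Eu d → ℂ, Continuous f → HasCompactSupport f → ∃ r : ℝ, 0 ≤ r ∧ ∫ t, acor f t ∂μ = (r : ℂ))
    (hc : ∀ χ, HasMean μ (ex (-χ)) (c χ)) (χ : Eu d) : ∃ r : ℝ, 0 ≤ r ∧ c χ = (r : ℂ) := by
  obtain ⟨e, he⟩ : ∃ e : Eu d, ∀ t : Eu d, ‖‖t‖ • e‖ = ‖t‖ := by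
    rcases subsingleton_or_nontrivial (Eu d) with h | h
    · exact ⟨0, fun t => by rw [Subsingleton.elim t 0]; simp⟩
    · obtain ⟨e, he⟩ := exists_norm_eq (Eu d) zero_le_one
      exact ⟨e, fun t => by rw [norm_smul, he, norm_norm, mul_one]⟩
  have h1 : HasMean μ (fun _ => (1 : ℂ)) (c 0) := by
    have := hc 0
    have e : ex (-(0 : Eu d)) = fun _ => 1 := by ext t; rw [neg_zero, ex_zero_left]
    rwa [e] at this
  have hlim := radial_limit (q := fun ρ => wt (ρ • e)) (wt_cont.comp (continuous_id.smul continuous_const)) wt_cont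
    (fun t => wt_radial (he t).symm) wt_zero μ (ex_continuous (-χ)) (fun t => (ex_norm _ _).le) (hc χ) h1
  obtain ⟨J, hJ0, hJ⟩ := wt_int_pos (d := d)
  rw [hJ] at hlim
  have hv1 := volB_pos (d := d) one_pos
  have hpos : ∀ R : ℝ, 0 < R → ∃ r : ℝ, 0 ≤ r ∧ (volB d R)⁻¹ • ∫ t, ex (-χ) t * wt (R⁻¹ • t) ∂μ = (r : ℂ) := by
    intro R hR
    obtain ⟨r, hr, hr'⟩ := hPD (fun s => (tent 1 (R⁻¹ • s) : ℂ) * ex (-χ) s)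
      (((tentC_cont 1).comp (continuous_const_smul R⁻¹)).mul (ex_continuous _))
      (HasCompactSupport.mul_right ((tentC_supp 1).comp_homeomorph (Homeomorph.smulOfNeZero R⁻¹ (inv_ne_zero hR.ne'))))
    have h2 : ∀ t, acor (fun s : Eu d => (tent 1 (R⁻¹ • s) : ℂ) * ex (-χ) s) t = ((R ^ d : ℝ) : ℂ) * (ex (-χ) t * wt (R⁻¹ • t)) := by
      intro t
      rw [acor_mod, acor_scale (f := fun s => (tent 1 s : ℂ)) hR, wt]; ring
    simp only [h2] at hr'
    rw [integral_const_mul] at hr'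
    have hRd : (0 : ℝ) < R ^ d := by positivity
    refine ⟨(volB d R)⁻¹ * (r / R ^ d), ?_, ?_⟩
    · have := volB_nonneg (d := d) R
      positivity
    · rw [Complex.real_smul, Complex.ofReal_mul]
      congr 1
      have : ((R ^ d : ℝ) : ℂ) ≠ 0 := by exact_mod_cast hRd.ne'
      rw [Complex.ofReal_div, eq_div_iff this, mul_comm]
      exact hr'
  have hre := (Complex.continuous_re.tendsto _).comp hlim
  have him := (Complex.continuous_im.tendsto _).comp hlim
  have e1 : c χ * ((volB d 1)⁻¹ • (J : ℂ)) = (((volB d 1)⁻¹ * J : ℝ) : ℂ) * c χ := by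
    rw [Complex.real_smul, Complex.ofReal_mul]; ring
  rw [e1, Complex.re_ofReal_mul] at hre
  rw [e1, Complex.im_ofReal_mul] at him
  have hp : 0 < (volB d 1)⁻¹ * J := by positivity
  have k1 : 0 ≤ (volB d 1)⁻¹ * J * (c χ).re := by
    refine ge_of_tendsto hre ?_
    filter_upwards [eventually_gt_atTop 0] with R hR
    obtain ⟨r, hr, hr'⟩ := hpos R hR
    simp only [Function.comp, hr', Complex.ofReal_re]
    exact hr
  have k2 : (volB d 1)⁻¹ * J * (c χ).im = 0 := by
    refine tendsto_nhds_unique him (tendsto_const_nhds.congr' ?_)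
    filter_upwards [eventually_gt_atTop 0] with R hR
    obtain ⟨r, hr, hr'⟩ := hpos R hR
    simp only [Function.comp, hr', Complex.ofReal_im]
  refine ⟨(c χ).re, nonneg_of_mul_nonneg_right k1 hp, Complex.ext rfl ?_⟩
  rw [Complex.ofReal_im]
  exact (mul_eq_zero.1 k2).resolve_left hp.ne'

theorem main_thm
    (μ : Measure (Eu d)) [IsLocallyFiniteMeasure μ]
    (hSAP : ∀ f : Eu d → ℂ, Continuous f → HasCompactSupport f →
      IsBohrAlmostPeriodic fun t => ∫ x, f (t - x) ∂μ)
    (c : Eu d → ℂ)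
    (hc : ∀ χ, HasMean μ (ex (-χ)) (c χ)) :
    (∀ f : Eu d → ℂ, Continuous f → HasCompactSupport f →
      ∃ r : ℝ, 0 ≤ r ∧ ∫ t, acor f t ∂μ = (r : ℂ)) ↔
    ((∀ χ : Eu d, ∃ r : ℝ, 0 ≤ r ∧ c χ = (r : ℂ)) ∧
      (∀ K : Set (Eu d), IsCompact K →
        (⨆ t : Eu d,
          ∑' χ : (t +ᵥ K : Set (Eu d)), (‖c χ‖₊ : ℝ≥0∞)) < ⊤)) := by
  classical
  constructor
  · intro hPD
    have hc0 := c_nonneg hPD hc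
    refine ⟨hc0, fun K hK => ?_⟩
    choose a ha hca using hc0
    have hc' : ∀ χ, HasMean μ (ex (-χ)) (a χ : ℂ) := fun χ => hca χ ▸ hc χ
    obtain ⟨Q, hQ⟩ := c_tb hSAP ha hc' K hK
    refine lt_of_le_of_lt (iSup_le fun t => ?_) (ENNReal.ofReal_lt_top (r := Q))
    rw [ENNReal.tsum_eq_iSup_sum]
    refine iSup_le fun S => ?_
    have h1 := hQ t (S.map (Function.Embedding.subtype _)) (fun χ hχ => by
      obtain ⟨⟨χ', h'⟩, -, rfl⟩ := Finset.mem_map.1 hχ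
      obtain ⟨k, hk, rfl⟩ := Set.mem_vadd_set.1 h'
      simpa using hk)
    rw [Finset.sum_map] at h1
    refine le_trans (le_of_eq ?_) (ENNReal.ofReal_le_ofReal h1)
    rw [ENNReal.ofReal_sum_of_nonneg (fun _ _ => ha _)]
    refine Finset.sum_congr rfl fun χ _ => ?_
    rw [hca, ← ENNReal.ofReal_coe_nnreal, coe_nnnorm, Complex.norm_real, Real.norm_of_nonneg (ha _)]
    rfl
  · rintro ⟨hc0, -⟩ f hf hs
    choose a ha hca using hc0
    have hc' : ∀ χ, HasMean μ (ex (-χ)) (a χ : ℂ) := fun χ => hca χ ▸ hc χ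
    obtain ⟨r, h1, h2⟩ := acor_bessel hSAP ha hc' hf hs ∅
    exact ⟨r, by simpa using h2, h1⟩


end helpers

/-- A positive, translation bounded, strongly almost periodic Radon measure `μ`
on `ℝ^d` with Fourier–Bohr coefficients `c` is positive definite if and only if every `c(χ)` is a
nonnegative real number and `c` is translation bounded. -/
theorem fourierTransformable_sap_stmt8 {d : ℕ}
    (μ : Measure (EuclideanSpace ℝ (Fin d))) [μ.Regular]
    (hTB : ∀ K : Set (EuclideanSpace ℝ (Fin d)), IsCompact K →
      (⨆ x : EuclideanSpace ℝ (Fin d), μ (x +ᵥ K)) < ⊤)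
    (hSAP : ∀ f : EuclideanSpace ℝ (Fin d) → ℂ, Continuous f → HasCompactSupport f →
      IsBohrAlmostPeriodic fun t => ∫ x, f (t - x) ∂μ)
    (c : EuclideanSpace ℝ (Fin d) → ℂ)
    (hc : ∀ χ : EuclideanSpace ℝ (Fin d), IsFourierBohrCoeff μ χ (c χ)) :
    (∀ f : EuclideanSpace ℝ (Fin d) → ℂ, Continuous f → HasCompactSupport f →
      ∃ r : ℝ, 0 ≤ r ∧
        ∫ t, (∫ s, f s * (starRingEnd ℂ) (f (s - t))) ∂μ = (r : ℂ)) ↔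
    ((∀ χ : EuclideanSpace ℝ (Fin d), ∃ r : ℝ, 0 ≤ r ∧ c χ = (r : ℂ)) ∧
      (∀ K : Set (EuclideanSpace ℝ (Fin d)), IsCompact K →
        (⨆ t : EuclideanSpace ℝ (Fin d),
          ∑' χ : (t +ᵥ K : Set (EuclideanSpace ℝ (Fin d))), (‖c χ‖₊ : ℝ≥0∞)) < ⊤)) := by
  have hc' : ∀ χ, HasMean μ (ex (-χ)) (c χ) := by
    intro χ
    refine (hc χ).congr fun R => ?_
    unfold avgM volB
    simp only [ex_neg]
  exact main_thm μ hSAP c hc'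
end
end

section
/- Let μ and ν be positive Radon measures on ℝ^d such that ν is translation bounded and ν is the Fourier transform of μ in the tempered distribution sense, i.e., every Schwartz function g : ℝ^d → ℂ is μ-integrable, 𝓕⁻¹g is ν-integrable, and ∫_{ℝ^d} g dμ = ∫_{ℝ^d} (𝓕⁻¹g) dν. Then μ is Fourier transformable as a measure with Fourier transform ν: for every continuous compactly supported f : ℝ^d → ℂ, the function ‖𝓕⁻¹f‖² is ν-integrable and ∫_{ℝ^d} (f * f̃)(t) dμ(t) = ∫_{ℝ^d} ‖𝓕⁻¹f(ξ)‖² dν(ξ). -/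
open MeasureTheory Metric Filter
open scoped Pointwise FourierTransform RealInnerProductSpace ENNReal Topology SchwartzMap

noncomputable section

open scoped Convolution ContDiff

/-- The autocorrelation as a convolution. -/
lemma autocorr_eq_conv {d : ℕ} (h : EuclideanSpace ℝ (Fin d) → ℂ) :
    (fun t => ∫ s, h s * (starRingEnd ℂ) (h (s - t)))
      = (h ⋆[ContinuousLinearMap.mul ℝ ℂ] (fun x => (starRingEnd ℂ) (h (-x)))) := by
  ext t
  simp [convolution_def]

lemma autocorr_eq_conv' {d : ℕ} (h : EuclideanSpace ℝ (Fin d) → ℂ) :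
    (fun t => ∫ s, h s * (starRingEnd ℂ) (h (s - t)))
      = (h ⋆[ContinuousLinearMap.mul ℂ ℂ] (fun x => (starRingEnd ℂ) (h (-x)))) := by
  ext t
  simp [convolution_def]

lemma tilde_compact {d : ℕ} {h : EuclideanSpace ℝ (Fin d) → ℂ} (hs : HasCompactSupport h) :
    HasCompactSupport (fun x => (starRingEnd ℂ) (h (-x))) := by
  have h1 : HasCompactSupport (fun x => h (-x)) :=
    hs.comp_homeomorph (Homeomorph.neg (EuclideanSpace ℝ (Fin d)))
  exact h1.comp_left (g := starRingEnd ℂ) (map_zero _)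

lemma tilde_cont_s9 {d : ℕ} {h : EuclideanSpace ℝ (Fin d) → ℂ} (hc : Continuous h) :
    Continuous (fun x => (starRingEnd ℂ) (h (-x))) :=
  Complex.continuous_conj.comp (hc.comp continuous_neg)

lemma autocorr_cont {d : ℕ} {h : EuclideanSpace ℝ (Fin d) → ℂ} (hc : Continuous h)
    (hs : HasCompactSupport h) :
    Continuous (fun t => ∫ s, h s * (starRingEnd ℂ) (h (s - t))) := by
  rw [autocorr_eq_conv]
  exact hs.continuous_convolution_left _ hc (tilde_cont_s9 hc).locallyIntegrable

lemma fourierInv_autocorr {d : ℕ} {h : EuclideanSpace ℝ (Fin d) → ℂ} (hc : Continuous h)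
    (hs : HasCompactSupport h) (ξ : EuclideanSpace ℝ (Fin d)) :
    𝓕⁻ (fun t => ∫ s, h s * (starRingEnd ℂ) (h (s - t))) ξ = ((‖𝓕⁻ h ξ‖ ^ 2 : ℝ) : ℂ) := by
  rw [autocorr_eq_conv', Real.fourierInv_eq_fourier_neg,
    Real.fourier_mul_convolution_eq (hc.integrable_of_hasCompactSupport hs)
      ((tilde_cont_s9 hc).integrable_of_hasCompactSupport (tilde_compact hs))]
  have : 𝓕 (fun x => (starRingEnd ℂ) (h (-x))) (-ξ) = (starRingEnd ℂ) (𝓕 h (-ξ)) := by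
    rw [Real.fourier_eq, Real.fourier_eq, ← integral_conj, ← integral_neg_eq_self]
    congr 1
    ext x
    simp [Circle.smul_def, ← Circle.coe_inv_eq_conj, AddChar.map_neg_eq_inv]
  rw [this, Complex.mul_conj, ← Real.fourierInv_eq_fourier_neg, Complex.normSq_eq_norm_sq]

/-- The smooth case. -/
lemma smooth_case {d : ℕ}
    (μ ν : Measure (EuclideanSpace ℝ (Fin d)))
    (hdist : ∀ g : 𝓢(EuclideanSpace ℝ (Fin d), ℂ),
      Integrable (fun t => g t) μ ∧ Integrable (fun ξ => 𝓕⁻ (fun t => g t) ξ) ν ∧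
        ∫ t, g t ∂μ = ∫ ξ, 𝓕⁻ (fun t => g t) ξ ∂ν)
    {h : EuclideanSpace ℝ (Fin d) → ℂ} (hd : ContDiff ℝ ∞ h) (hs : HasCompactSupport h) :
    Integrable (fun ξ => ‖𝓕⁻ h ξ‖ ^ 2) ν ∧
      ∫ t, (∫ s, h s * (starRingEnd ℂ) (h (s - t))) ∂μ
        = ((∫ ξ, ‖𝓕⁻ h ξ‖ ^ 2 ∂ν : ℝ) : ℂ) := by
  have hc := hd.continuous
  have gs : HasCompactSupport (fun t => ∫ s, h s * (starRingEnd ℂ) (h (s - t))) := by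
    rw [autocorr_eq_conv]
    exact hs.convolution _ (tilde_compact hs)
  have gd : ContDiff ℝ ∞ (fun t => ∫ s, h s * (starRingEnd ℂ) (h (s - t))) := by
    rw [autocorr_eq_conv]
    exact hs.contDiff_convolution_left _ hd (tilde_cont_s9 hc).locallyIntegrable
  obtain ⟨-, h2, h3⟩ := hdist (gs.toSchwartzMap gd)
  simp only [HasCompactSupport.toSchwartzMap_toFun] at h2 h3
  change Integrable (fun ξ => 𝓕⁻ (fun t => ∫ s, h s * (starRingEnd ℂ) (h (s - t))) ξ) ν at h2
  change ∫ t, (∫ s, h s * (starRingEnd ℂ) (h (s - t))) ∂μ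
    = ∫ ξ, 𝓕⁻ (fun t => ∫ s, h s * (starRingEnd ℂ) (h (s - t))) ξ ∂ν at h3
  simp only [fourierInv_autocorr hc hs] at h2 h3
  refine ⟨h2.re, ?_⟩
  rw [h3, integral_complex_ofReal]

lemma fatou_aux {X : Type*} [MeasurableSpace X] (ν : Measure X) (G : ℕ → X → ℝ) (F : X → ℝ)
    (hG : ∀ n, Integrable (G n) ν) (h0 : ∀ n x, 0 ≤ G n x) (hle : ∀ n x, G n x ≤ F x)
    (hlim : ∀ x, Tendsto (fun n => G n x) atTop (𝓝 (F x))) (a : ℝ)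
    (ha : Tendsto (fun n => ∫ x, G n x ∂ν) atTop (𝓝 a)) :
    Integrable F ν ∧ ∫ x, F x ∂ν = a := by
  have hm : AEStronglyMeasurable F ν :=
    aestronglyMeasurable_of_tendsto_ae _ (fun n => (hG n).1) (ae_of_all _ hlim)
  have hF0 : ∀ x, 0 ≤ F x := fun x => (h0 0 x).trans (hle 0 x)
  have hI : Integrable F ν := by
    refine ⟨hm, ?_⟩
    have h1 : ∫⁻ x, ‖F x‖ₑ ∂ν ≤ liminf (fun n => ∫⁻ x, ‖G n x‖ₑ ∂ν) atTop := by
      rw [lintegral_congr (fun x => ((hlim x).enorm.liminf_eq).symm)]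
      exact lintegral_liminf_le' fun n => (hG n).1.enorm
    have h2 : Tendsto (fun n => ∫⁻ x, ‖G n x‖ₑ ∂ν) atTop (𝓝 (ENNReal.ofReal a)) := by
      have : ∀ n, ∫⁻ x, ‖G n x‖ₑ ∂ν = ENNReal.ofReal (∫ x, G n x ∂ν) := fun n => by
        rw [ofReal_integral_eq_lintegral_ofReal (hG n) (ae_of_all _ (h0 n))]
        exact lintegral_congr fun x => Real.enorm_of_nonneg (h0 n x)
      simp only [this]
      exact ENNReal.tendsto_ofReal ha
    rw [h2.liminf_eq] at h1
    exact h1.trans_lt ENNReal.ofReal_lt_top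
  refine ⟨hI, tendsto_nhds_unique ?_ ha⟩
  refine tendsto_integral_of_dominated_convergence F (fun n => (hG n).1) hI ?_ (ae_of_all _ hlim)
  intro n
  exact ae_of_all _ fun x => by rw [Real.norm_of_nonneg (h0 n x)]; exact hle n x

/-- Mollifiers. -/
def molli (d n : ℕ) : ContDiffBump (0 : EuclideanSpace ℝ (Fin d)) where
  rIn := 1 / ((n : ℝ) + 1) / 2
  rOut := 1 / ((n : ℝ) + 1)
  rIn_pos := by positivity
  rIn_lt_rOut := half_lt_self (by positivity)

/-- Mollified function. -/
def mollify {d : ℕ} (f : EuclideanSpace ℝ (Fin d) → ℂ) (n : ℕ) : EuclideanSpace ℝ (Fin d) → ℂ :=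
  ((molli d n).normed volume ⋆[ContinuousLinearMap.lsmul ℝ ℝ] f)

lemma mollify_contDiff {d : ℕ} {f : EuclideanSpace ℝ (Fin d) → ℂ} (hf : Continuous f) (n : ℕ) :
    ContDiff ℝ ∞ (mollify f n) :=
  (molli d n).hasCompactSupport_normed.contDiff_convolution_left _ (molli d n).contDiff_normed
    hf.locallyIntegrable

lemma mollify_tendsto {d : ℕ} {f : EuclideanSpace ℝ (Fin d) → ℂ} (hf : Continuous f)
    (x : EuclideanSpace ℝ (Fin d)) :
    Tendsto (fun n => mollify f n x) atTop (𝓝 (f x)) :=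
  ContDiffBump.convolution_tendsto_right_of_continuous tendsto_one_div_add_atTop_nhds_zero_nat hf x

lemma mollify_bound {d : ℕ} {f : EuclideanSpace ℝ (Fin d) → ℂ} {C : ℝ} (hC : ∀ x, ‖f x‖ ≤ C)
    (n : ℕ) (x : EuclideanSpace ℝ (Fin d)) : ‖mollify f n x‖ ≤ C := by
  have h := norm_integral_le_of_norm_le
    (f := fun t => (molli d n).normed volume t • f (x - t))
    (((molli d n).integrable_normed (μ := volume)).mul_const C)
    (ae_of_all _ fun t => by
      rw [norm_smul, Real.norm_of_nonneg ((molli d n).nonneg_normed t)]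
      exact mul_le_mul_of_nonneg_left (hC _) ((molli d n).nonneg_normed t))
  rw [integral_mul_const, ContDiffBump.integral_normed, one_mul] at h
  exact h

lemma mollify_support {d : ℕ} (f : EuclideanSpace ℝ (Fin d) → ℂ) (n : ℕ)
    {x : EuclideanSpace ℝ (Fin d)} (hx : x ∉ closedBall 0 1 + tsupport f) : mollify f n x = 0 := by
  by_contra h
  apply hx
  have := support_convolution_subset _ (Function.mem_support.2 h)
  refine Set.add_subset_add ?_ (subset_tsupport f) this
  rw [ContDiffBump.support_normed_eq]
  refine ball_subset_closedBall.trans (closedBall_subset_closedBall ?_)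
  change 1 / ((n : ℝ) + 1) ≤ 1
  rw [div_le_one (by positivity)]
  linarith [(Nat.cast_nonneg n : (0 : ℝ) ≤ n)]

lemma mollify_fourierInv_le {d : ℕ} {f : EuclideanSpace ℝ (Fin d) → ℂ} (hf : Continuous f)
    (hs : HasCompactSupport f) (n : ℕ) (ξ : EuclideanSpace ℝ (Fin d)) :
    ‖𝓕⁻ (mollify f n) ξ‖ ≤ ‖𝓕⁻ f ξ‖ := by
  have h1 : mollify f n = ((fun x => (((molli d n).normed volume x : ℝ) : ℂ))
      ⋆[ContinuousLinearMap.mul ℂ ℂ] f) := by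
    ext x
    simp [mollify, convolution_def]
  rw [h1, Real.fourierInv_eq_fourier_neg, Real.fourierInv_eq_fourier_neg,
    Real.fourier_mul_convolution_eq (f₁ := fun x => (((molli d n).normed volume x : ℝ) : ℂ))
      ((molli d n).integrable_normed.ofReal)
      (hf.integrable_of_hasCompactSupport hs), norm_mul]
  refine mul_le_of_le_one_left (norm_nonneg _) ?_
  refine (VectorFourier.norm_fourierIntegral_le_integral_norm _ _ _ _ _).trans ?_
  simp only [Complex.norm_real, Real.norm_of_nonneg ((molli d n).nonneg_normed _)]
  exact (ContDiffBump.integral_normed _).le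

/-- Let `μ, ν` be positive Radon measures on `ℝ^d` with `ν` translation bounded
and `ν` the Fourier transform of `μ` in the tempered distribution sense. Then `μ` is Fourier
transformable as a measure with Fourier transform `ν`. -/
theorem fourierTransformable_sap_stmt9 {d : ℕ}
    (μ ν : Measure (EuclideanSpace ℝ (Fin d))) [μ.Regular] [ν.Regular]
    (hνTB : ∀ K : Set (EuclideanSpace ℝ (Fin d)), IsCompact K →
      (⨆ x : EuclideanSpace ℝ (Fin d), ν (x +ᵥ K)) < ⊤)
    (hdist : ∀ g : 𝓢(EuclideanSpace ℝ (Fin d), ℂ),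
      Integrable (fun t => g t) μ ∧ Integrable (fun ξ => 𝓕⁻ (fun t => g t) ξ) ν ∧
        ∫ t, g t ∂μ = ∫ ξ, 𝓕⁻ (fun t => g t) ξ ∂ν) :
    ∀ f : EuclideanSpace ℝ (Fin d) → ℂ, Continuous f → HasCompactSupport f →
      Integrable (fun ξ => ‖𝓕⁻ f ξ‖ ^ 2) ν ∧
      ∫ t, (∫ s, f s * (starRingEnd ℂ) (f (s - t))) ∂μ
        = ((∫ ξ, ‖𝓕⁻ f ξ‖ ^ 2 ∂ν : ℝ) : ℂ) := by
  intro f hf hs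
  set K : Set (EuclideanSpace ℝ (Fin d)) := closedBall 0 1 + tsupport f with hK
  have Kc : IsCompact K := (isCompact_closedBall _ _).add hs.isCompact
  obtain ⟨C, hC⟩ := hf.bounded_above_of_compact_support hs
  have hC0 : 0 ≤ C := (norm_nonneg _).trans (hC 0)
  have hms : ∀ n, HasCompactSupport (mollify f n) := fun n =>
    HasCompactSupport.intro Kc fun x hx => mollify_support f n hx
  have hmc : ∀ n, Continuous (mollify f n) := fun n => (mollify_contDiff hf n).continuous
  have hb : ∀ n x, ‖mollify f n x‖ ≤ K.indicator (fun _ => C) x := fun n x => by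
    by_cases hx : x ∈ K
    · rw [Set.indicator_of_mem hx]; exact mollify_bound hC n x
    · rw [Set.indicator_of_notMem hx, mollify_support f n hx, norm_zero]
  have hsm := fun n => smooth_case μ ν hdist (mollify_contDiff hf n) (hms n)
  have hFlim : ∀ ξ, Tendsto (fun n => 𝓕⁻ (mollify f n) ξ) atTop (𝓝 (𝓕⁻ f ξ)) := fun ξ => by
    simp only [Real.fourierInv_eq]
    refine tendsto_integral_of_dominated_convergence (K.indicator (fun _ => C)) (fun n => ?_)
      ((integrable_indicator_iff Kc.measurableSet).2
        (integrableOn_const Kc.measure_lt_top.ne)) (fun n => ae_of_all _ fun x => ?_)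
      (ae_of_all _ fun x => (mollify_tendsto hf x).const_smul _)
    · have := hmc n
      refine Continuous.aestronglyMeasurable ?_
      simp only [Circle.smul_def]
      exact (continuous_subtype_val.comp (Real.continuous_fourierChar.comp (by fun_prop))).smul this
    · rw [Circle.norm_smul]; exact hb n x
  have hglim : ∀ t, Tendsto
      (fun n => ∫ s, mollify f n s * (starRingEnd ℂ) (mollify f n (s - t))) atTop
      (𝓝 (∫ s, f s * (starRingEnd ℂ) (f (s - t)))) := fun t => by
    refine tendsto_integral_of_dominated_convergence (K.indicator (fun _ => C * C)) (fun n => ?_)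
      ((integrable_indicator_iff Kc.measurableSet).2
        (integrableOn_const Kc.measure_lt_top.ne)) (fun n => ae_of_all _ fun x => ?_)
      (ae_of_all _ fun x => (mollify_tendsto hf x).mul
        ((Complex.continuous_conj.tendsto _).comp (mollify_tendsto hf (x - t))))
    · exact ((hmc n).mul (Complex.continuous_conj.comp
        ((hmc n).comp (by fun_prop)))).aestronglyMeasurable
    · rw [norm_mul, RCLike.norm_conj]
      by_cases hx : x ∈ K
      · rw [Set.indicator_of_mem hx]
        exact mul_le_mul (mollify_bound hC n x) (mollify_bound hC n _) (norm_nonneg _) hC0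
      · rw [Set.indicator_of_notMem hx, mollify_support f n hx, norm_zero, zero_mul]
  have hgb : ∀ n t, ‖∫ s, mollify f n s * (starRingEnd ℂ) (mollify f n (s - t))‖
      ≤ (K - K).indicator (fun _ => ∫ s, K.indicator (fun _ => C * C) s) t := fun n t => by
    by_cases ht : t ∈ K - K
    · rw [Set.indicator_of_mem ht]
      refine norm_integral_le_of_norm_le ((integrable_indicator_iff Kc.measurableSet).2
        (integrableOn_const Kc.measure_lt_top.ne)) (ae_of_all _ fun x => ?_)
      rw [norm_mul, RCLike.norm_conj]
      by_cases hx : x ∈ K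
      · rw [Set.indicator_of_mem hx]
        exact mul_le_mul (mollify_bound hC n x) (mollify_bound hC n _) (norm_nonneg _) hC0
      · rw [Set.indicator_of_notMem hx, mollify_support f n hx, norm_zero, zero_mul]
    · rw [Set.indicator_of_notMem ht]
      have : ∀ s, mollify f n s * (starRingEnd ℂ) (mollify f n (s - t)) = 0 := fun s => by
        by_cases hx : s ∈ K
        · have : s - t ∉ K := fun h => ht ⟨s, hx, s - t, h, by simp⟩
          rw [mollify_support f n this, map_zero, mul_zero]
        · rw [mollify_support f n hx, zero_mul]
      simp [this]
  have KKc : IsCompact (K - K) := by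
    rw [sub_eq_add_neg]; exact Kc.add Kc.neg
  have hlimμ : Tendsto
      (fun n => ∫ t, (∫ s, mollify f n s * (starRingEnd ℂ) (mollify f n (s - t))) ∂μ) atTop
      (𝓝 (∫ t, (∫ s, f s * (starRingEnd ℂ) (f (s - t))) ∂μ)) :=
    tendsto_integral_of_dominated_convergence _
      (fun n => (autocorr_cont (hmc n) (hms n)).aestronglyMeasurable)
      ((integrable_indicator_iff KKc.measurableSet).2
        (integrableOn_const KKc.measure_lt_top.ne))
      (fun n => ae_of_all _ (hgb n)) (ae_of_all _ hglim)
  simp only [fun n => (hsm n).2] at hlimμ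
  have hre := (Complex.continuous_re.tendsto _).comp hlimμ
  obtain ⟨hI, hE⟩ := fatou_aux ν (fun n ξ => ‖𝓕⁻ (mollify f n) ξ‖ ^ 2) (fun ξ => ‖𝓕⁻ f ξ‖ ^ 2)
    (fun n => (hsm n).1) (fun n x => by positivity)
    (fun n x => pow_le_pow_left₀ (norm_nonneg _) (mollify_fourierInv_le hf hs n x) 2)
    (fun x => (hFlim x).norm.pow 2) _ hre
  refine ⟨hI, ?_⟩
  have h4 := (Complex.continuous_ofReal.tendsto _).comp hre
  rw [← hE] at h4
  exact tendsto_nhds_unique hlimμ h4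
end
end

section
/- Let μ and ν be positive Radon measures on ℝ^d such that ν is the Fourier transform of μ in the measure sense: for every continuous compactly supported f : ℝ^d → ℂ, the function ‖𝓕⁻¹f‖² is ν-integrable and ∫_{ℝ^d} (f * f̃)(t) dμ(t) = ∫_{ℝ^d} ‖𝓕⁻¹f(ξ)‖² dν(ξ). Then: (a) ν is translation bounded; (b) μ is tempered, in the sense that every Schwartz function g : ℝ^d → ℂ is μ-integrable; and (c) for every Schwartz function g, 𝓕⁻¹g is ν-integrable and ∫_{ℝ^d} g dμ = ∫_{ℝ^d} (𝓕⁻¹g) dν, i.e., ν is the Fourier transform of μ as a tempered distribution. -/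
open MeasureTheory Metric Filter
open scoped Pointwise FourierTransform RealInnerProductSpace ENNReal Topology SchwartzMap

noncomputable section

section Aux
set_option linter.unusedSectionVars false
variable {E : Type*} [NormedAddCommGroup E] [InnerProductSpace ℝ E] [FiniteDimensional ℝ E]
  [MeasurableSpace E] [BorelSpace E]

/-- A measure with uniformly bounded mass on unit balls has temperate growth. -/
theorem aux_temperate (μ : Measure E) [SFinite μ] (C : ℝ≥0∞) (hC : C ≠ ⊤)
    (h : ∀ x, μ (closedBall x 1) ≤ C) : μ.HasTemperateGrowth := by
  obtain ⟨n, hn⟩ := (inferInstance : (volume : Measure E).HasTemperateGrowth).exists_integrable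
  refine ⟨⟨n, ?_⟩⟩
  have hmeas : Measurable (fun x : E => (1 + ‖x‖) ^ (-(n : ℝ))) := by fun_prop
  refine ⟨hmeas.aestronglyMeasurable, ?_⟩
  have hnn : ∀ x : E, 0 ≤ (1 + ‖x‖) ^ (-(n : ℝ)) := fun x => by positivity
  set φ : E → ℝ≥0∞ := fun x => ENNReal.ofReal ((1 + ‖x‖) ^ (-(n : ℝ))) with hφ
  have hφm : Measurable φ := hmeas.ennreal_ofReal
  have hvol : ∫⁻ x, φ x < ⊤ := hn.lintegral_lt_top
  rw [hasFiniteIntegral_iff_ofReal (Eventually.of_forall hnn)]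
  change ∫⁻ x, φ x ∂μ < ⊤
  set V : ℝ≥0∞ := volume (closedBall (0 : E) 1) with hV
  have hV0 : V ≠ 0 := (measure_closedBall_pos volume (0 : E) one_pos).ne'
  have hVt : V ≠ ⊤ := measure_closedBall_lt_top.ne
  have key : ∀ x y : E, x ∈ closedBall y 1 → φ x ≤ ENNReal.ofReal (2 ^ n) * φ y := by
    intro x y hxy
    rw [hφ]
    simp only
    rw [← ENNReal.ofReal_mul (by positivity)]
    apply ENNReal.ofReal_le_ofReal
    have h1 : ‖y‖ ≤ ‖x‖ + 1 := by
      have : dist x y ≤ 1 := hxy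
      rw [dist_comm, dist_eq_norm] at this
      have := norm_le_norm_add_norm_sub' y x
      linarith
    rw [Real.rpow_neg (by positivity), Real.rpow_neg (by positivity), Real.rpow_natCast,
      Real.rpow_natCast, ← div_eq_mul_inv, inv_eq_one_div, div_le_div_iff₀ (by positivity)
      (by positivity), one_mul, ← mul_pow]
    gcongr
    linarith [norm_nonneg x]
  have hind : Measurable (fun p : E × E => (closedBall (0 : E) 1).indicator (1 : E → ℝ≥0∞) (p.1 - p.2)) :=
    (measurable_one.indicator measurableSet_closedBall).comp (measurable_fst.sub measurable_snd)
  have hmem : ∀ x y : E, x - y ∈ closedBall (0 : E) 1 ↔ x ∈ closedBall y 1 := by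
    intro x y; simp [dist_eq_norm]
  have hmem' : ∀ x y : E, x - y ∈ closedBall (0 : E) 1 ↔ y ∈ closedBall x 1 := by
    intro x y; simp [dist_eq_norm, norm_sub_rev]
  have h1 : V * ∫⁻ x, φ x ∂μ =
      ∫⁻ x, ∫⁻ y, (closedBall (0 : E) 1).indicator (1 : E → ℝ≥0∞) (x - y) * φ x ∂volume ∂μ := by
    rw [← lintegral_const_mul _ hφm]
    refine lintegral_congr fun x => ?_
    have hx : Measurable (fun y => (closedBall (0 : E) 1).indicator (1 : E → ℝ≥0∞) (x - y)) :=
      hind.comp (measurable_prodMk_left (x := x))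
    rw [lintegral_mul_const _ hx]
    congr 1
    have : (fun y => (closedBall (0 : E) 1).indicator (1 : E → ℝ≥0∞) (x - y))
        = (closedBall x 1).indicator 1 := by
      funext y
      by_cases hy : y ∈ closedBall x 1
      · rw [Set.indicator_of_mem ((hmem' x y).2 hy), Set.indicator_of_mem hy]; rfl
      · rw [Set.indicator_of_notMem (fun h => hy ((hmem' x y).1 h)), Set.indicator_of_notMem hy]
    rw [this, lintegral_indicator_one measurableSet_closedBall, hV]
    exact (Measure.addHaar_closedBall_center volume x 1).symm
  have h2 : V * ∫⁻ x, φ x ∂μ ≤ C * (ENNReal.ofReal (2 ^ n) * ∫⁻ y, φ y) := by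
    rw [h1, lintegral_lintegral_swap]
    · rw [← lintegral_const_mul _ hφm, ← lintegral_const_mul _ (hφm.const_mul _)]
      refine lintegral_mono fun y => ?_
      calc ∫⁻ x, (closedBall (0 : E) 1).indicator (1 : E → ℝ≥0∞) (x - y) * φ x ∂μ
          ≤ ∫⁻ x, (closedBall y 1).indicator (1 : E → ℝ≥0∞) x * (ENNReal.ofReal (2 ^ n) * φ y) ∂μ := by
            refine lintegral_mono fun x => ?_
            by_cases hx : x ∈ closedBall y 1
            · simp only [Set.indicator_of_mem ((hmem x y).2 hx), Set.indicator_of_mem hx,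
                Pi.one_apply, one_mul]
              exact key x y hx
            · rw [Set.indicator_of_notMem (fun h => hx ((hmem x y).1 h))]; simp
        _ = μ (closedBall y 1) * (ENNReal.ofReal (2 ^ n) * φ y) := by
            rw [lintegral_mul_const _ (measurable_one.indicator measurableSet_closedBall),
              lintegral_indicator_one measurableSet_closedBall]
        _ ≤ _ := by gcongr; exact h y
    · exact (hind.mul (hφm.comp measurable_fst)).aemeasurable
  by_contra hcon
  rw [not_lt, top_le_iff] at hcon
  rw [hcon, ENNReal.mul_top hV0, top_le_iff] at h2
  exact ENNReal.mul_ne_top hC (ENNReal.mul_ne_top ENNReal.ofReal_ne_top hvol.ne) h2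

/-- Compactly supported Schwartz functions are dense. -/
theorem aux_dense (g : 𝓢(E, ℂ)) : ∃ u : ℕ → 𝓢(E, ℂ), (∀ n, HasCompactSupport (u n)) ∧
    Tendsto u atTop (𝓝 g) := by
  let φ : ContDiffBump (0 : E) := ⟨1, 2, one_pos, one_lt_two⟩
  have hφs : ContDiff ℝ ((⊤ : ℕ∞) : WithTop ℕ∞) (fun x : E => φ x) := φ.contDiff
  have hb : ∀ i : ℕ, ∃ C, ∀ x, ‖iteratedFDeriv ℝ i (fun x : E => φ x) x‖ ≤ C := by
    intro i
    have hc : Continuous (iteratedFDeriv ℝ i (fun x : E => φ x)) :=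
      hφs.continuous_iteratedFDeriv (by exact_mod_cast le_top)
    exact (φ.hasCompactSupport.iteratedFDeriv i).exists_bound_of_continuous hc
  choose B hB using hb
  have hB0 : ∀ i, 0 ≤ B i := fun i => (norm_nonneg _).trans (hB i 0)
  let c : ℕ → ℝ := fun n => ((n : ℝ) + 1)⁻¹
  have hc0 : ∀ n, 0 < c n := fun n => by positivity
  have hc1 : ∀ n, c n ≤ 1 := fun n => inv_le_one_of_one_le₀ (by linarith [n.cast_nonneg (α := ℝ)])
  have hχs : ∀ n, ContDiff ℝ ((⊤ : ℕ∞) : WithTop ℕ∞) (fun x : E => φ (c n • x)) := fun n =>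
    hφs.comp (contDiff_const_smul (c n))
  have hχB : ∀ n i x, ‖iteratedFDeriv ℝ i (fun x : E => φ (c n • x)) x‖ ≤ B i := by
    intro n i x
    rw [iteratedFDeriv_comp_const_smul (f := fun x : E => φ x) (c n)
      (hφs.of_le (by exact_mod_cast le_top))]
    rw [norm_smul, norm_pow, Real.norm_of_nonneg (hc0 n).le]
    calc _ ≤ 1 * B i := by
          gcongr
          · exact pow_le_one₀ (hc0 n).le (hc1 n)
          · exact hB i _
      _ = B i := one_mul _
  have hcs : ∀ n, HasCompactSupport (fun x : E => φ (c n • x) • g x) := by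
    intro n
    have h1 : HasCompactSupport (fun x : E => φ (c n • x)) :=
      φ.hasCompactSupport.comp_smul (hc0 n).ne'
    exact h1.smul_right (f' := fun x => g x)
  have hsm : ∀ n, ContDiff ℝ ((⊤ : ℕ∞) : WithTop ℕ∞) (fun x : E => φ (c n • x) • g x) := fun n =>
    (hχs n).smul (g.smooth ⊤)
  let u : ℕ → 𝓢(E, ℂ) := fun n => (hcs n).toSchwartzMap (hsm n)
  refine ⟨u, fun n => hcs n, ?_⟩
  rw [(schwartz_withSeminorms ℝ E ℂ).tendsto_nhds]
  rintro ⟨k, m⟩ ε hε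
  let D : ℝ := ∑ i ∈ Finset.range (m + 1), (m.choose i : ℝ) * (B i + 1) *
    (SchwartzMap.seminorm ℝ (k + 1) (m - i) g)
  have hD : 0 ≤ D := Finset.sum_nonneg fun i _ => by
    have := hB0 i
    positivity
  have hbound : ∀ n, SchwartzMap.seminorm ℝ k m (u n - g) ≤ c n * D := by
    intro n
    refine SchwartzMap.seminorm_le_bound ℝ k m _ (mul_nonneg (hc0 n).le hD) fun x => ?_
    have hfun : (⇑(u n - g) : E → ℂ) = fun x => (φ (c n • x) - 1) • g x := by
      ext x
      simp [u, sub_mul]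
    rw [hfun]
    have hs1 : ContDiff ℝ ((⊤ : ℕ∞) : WithTop ℕ∞) (fun x : E => φ (c n • x) - 1) := (hχs n).sub contDiff_const
    by_cases hx : c n * ‖x‖ < 1
    · have : (fun x => (φ (c n • x) - 1) • g x) =ᶠ[𝓝 x] fun _ => 0 := by
        have ho : IsOpen {y : E | c n * ‖y‖ < 1} := isOpen_lt (by fun_prop) continuous_const
        filter_upwards [ho.mem_nhds hx] with y hy
        have : φ (c n • y) = 1 := φ.one_of_mem_closedBall (by
          simp only [mem_closedBall, dist_zero_right, norm_smul, Real.norm_of_nonneg (hc0 n).le]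
          exact (le_of_lt hy))
        simp [this]
      rw [(this.iteratedFDeriv ℝ m).eq_of_nhds]
      have h0 : iteratedFDeriv ℝ m (fun _ : E => (0 : ℂ)) x = 0 := by
        simp
      rw [h0, norm_zero, mul_zero]
      exact mul_nonneg (hc0 n).le hD
    · rw [not_lt] at hx
      calc ‖x‖ ^ k * ‖iteratedFDeriv ℝ m (fun x => (φ (c n • x) - 1) • g x) x‖
          ≤ ‖x‖ ^ k * ∑ i ∈ Finset.range (m + 1), (m.choose i : ℝ) *
            ‖iteratedFDeriv ℝ i (fun x : E => φ (c n • x) - 1) x‖ * ‖iteratedFDeriv ℝ (m - i) g x‖ := by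
            gcongr
            exact norm_iteratedFDeriv_smul_le hs1 (g.smooth ⊤) x (by exact_mod_cast le_top)
        _ ≤ (c n * ‖x‖) * (‖x‖ ^ k * ∑ i ∈ Finset.range (m + 1), (m.choose i : ℝ) *
            (B i + 1) * ‖iteratedFDeriv ℝ (m - i) g x‖) := by
            rw [← one_mul (‖x‖ ^ k * _)]
            gcongr with i hi
            rw [show (fun x : E => φ (c n • x) - 1) = (fun x : E => φ (c n • x)) - fun _ => (1 : ℝ) from rfl]
            rw [iteratedFDeriv_sub ((hχs n).of_le (by exact_mod_cast le_top)) contDiff_const]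
            refine (norm_sub_le _ _).trans (add_le_add (hχB n i x) ?_)
            rcases Nat.eq_zero_or_pos i with rfl | hi0
            · simp
            · rw [iteratedFDeriv_const_of_ne hi0.ne']; simp
        _ = c n * ∑ i ∈ Finset.range (m + 1), (m.choose i : ℝ) *
            (B i + 1) * (‖x‖ ^ (k + 1) * ‖iteratedFDeriv ℝ (m - i) g x‖) := by
            rw [mul_assoc, ← mul_assoc ‖x‖, ← pow_succ', Finset.mul_sum]
            congr 1
            refine Finset.sum_congr rfl fun i _ => by ring
        _ ≤ c n * D := by
            refine mul_le_mul_of_nonneg_left (Finset.sum_le_sum fun i _ => ?_) (hc0 n).le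
            have := hB0 i
            exact mul_le_mul_of_nonneg_left (SchwartzMap.le_seminorm ℝ (k + 1) (m - i) g x)
              (by positivity)
  have hlim : Tendsto (fun n => c n * D) atTop (𝓝 (0 * D)) :=
    (tendsto_inv_atTop_zero.comp
      (tendsto_atTop_add_const_right _ 1 tendsto_natCast_atTop_atTop)).mul_const D
  rw [zero_mul] at hlim
  filter_upwards [hlim.eventually (gt_mem_nhds hε)] with n hn
  exact (hbound n).trans_lt hn

theorem aux_integral4 {μ : Measure E} {a b c e : E → ℂ} (ha : Integrable a μ) (hb : Integrable b μ)
    (hc : Integrable c μ) (he : Integrable e μ) (α β γ : ℂ) :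
    ∫ x, ((a x + α * b x) + (β * c x + γ * e x)) ∂μ =
      (∫ x, a x ∂μ + α * ∫ x, b x ∂μ) + (β * ∫ x, c x ∂μ + γ * ∫ x, e x ∂μ) := by
  have h1 : Integrable (fun x => a x + α * b x) μ := ha.add (hb.const_mul α)
  have h2 : Integrable (fun x => β * c x + γ * e x) μ := (hc.const_mul β).add (he.const_mul γ)
  rw [integral_add h1 h2, integral_add ha (hb.const_mul α),
    integral_add (hc.const_mul β) (he.const_mul γ)]
  simp only [integral_const_mul]

/-- The correlation `f * h̃`. -/
def auxA (f h : E → ℂ) (t : E) : ℂ := ∫ s, f s * (starRingEnd ℂ) (h (s - t))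

theorem auxA_inner_integrable {f h : E → ℂ} (hf : Continuous f) (hfc : HasCompactSupport f)
    (hh : Continuous h) (t : E) : Integrable (fun s => f s * (starRingEnd ℂ) (h (s - t))) := by
  refine Continuous.integrable_of_hasCompactSupport ?_ hfc.mul_right
  exact hf.mul (Complex.continuous_conj.comp (hh.comp (continuous_id.sub continuous_const)))

theorem auxA_integrable (μ : Measure E) [IsFiniteMeasureOnCompacts μ] {f h : E → ℂ}
    (hf : Continuous f) (hfc : HasCompactSupport f)
    (hh : Continuous h) (hhc : HasCompactSupport h) : Integrable (auxA f h) μ := by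
  have hn : Continuous (fun x => (starRingEnd ℂ) (h (-x))) :=
    Complex.continuous_conj.comp (hh.comp continuous_neg)
  have hnc : HasCompactSupport (fun x => (starRingEnd ℂ) (h (-x))) := by
    have : HasCompactSupport (fun x => h (-x)) := hhc.comp_homeomorph (Homeomorph.neg E)
    exact this.comp_left (g := starRingEnd ℂ) (map_zero _)
  have heq : auxA f h = convolution f (fun x => (starRingEnd ℂ) (h (-x)))
      (ContinuousLinearMap.mul ℝ ℂ) volume := by
    ext t
    simp [auxA, convolution_def]
  rw [heq]
  refine Continuous.integrable_of_hasCompactSupport ?_ ?_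
  · exact hnc.continuous_convolution_right _
      (hf.integrable_of_hasCompactSupport hfc).locallyIntegrable hn
  · exact HasCompactSupport.convolution _ hfc hnc

theorem aux_fourierInv_continuous {f : E → ℂ} (hf : Continuous f) (hfc : HasCompactSupport f) :
    Continuous (𝓕⁻ f) := by
  have h1 : 𝓕⁻ f = fun w => 𝓕 f (-w) := by
    ext w; exact Real.fourierInv_eq_fourier_neg f w
  rw [h1]
  have : Continuous (𝓕 f) := VectorFourier.fourierIntegral_continuous Real.continuous_fourierChar
    (by simpa using continuous_inner) (hf.integrable_of_hasCompactSupport hfc)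
  exact this.comp continuous_neg

theorem aux_fourierInv_add_smul {f h : E → ℂ} (hf : Continuous f) (hfc : HasCompactSupport f)
    (hh : Continuous h) (hhc : HasCompactSupport h) (u : ℂ) (ξ : E) :
    𝓕⁻ (fun s => f s + u * h s) ξ = 𝓕⁻ f ξ + u * 𝓕⁻ h ξ := by
  simp only [Real.fourierInv_eq]
  have h1 : ∀ k : E → ℂ, Continuous k → HasCompactSupport k →
      Integrable (fun v : E => Real.fourierChar ⟪v, ξ⟫ • k v) := fun k hk hkc =>
    Continuous.integrable_of_hasCompactSupport (by
      have : Continuous fun v : E => (Real.fourierChar ⟪v, ξ⟫) :=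
        Real.continuous_fourierChar.comp (by fun_prop)
      fun_prop) hkc.smul_left
  rw [← integral_const_mul, ← integral_add (h1 f hf hfc) ((h1 h hh hhc).const_mul u)]
  congr 1
  ext v
  simp only [Circle.smul_def, smul_eq_mul]
  ring

/-- `ν` is the Fourier transform of `μ` in the measure sense. -/
def AuxFT (μ ν : Measure E) : Prop :=
  ∀ f : E → ℂ, Continuous f → HasCompactSupport f →
      Integrable (fun ξ => ‖𝓕⁻ f ξ‖ ^ 2) ν ∧
      ∫ t, (∫ s, f s * (starRingEnd ℂ) (f (s - t))) ∂μ
        = ((∫ ξ, ‖𝓕⁻ f ξ‖ ^ 2 ∂ν : ℝ) : ℂ)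

theorem aux_polar_int {μ ν : Measure E} (hFT : AuxFT μ ν)
    {f h : E → ℂ} (hf : Continuous f) (hfc : HasCompactSupport f)
    (hh : Continuous h) (hhc : HasCompactSupport h) :
    Integrable (fun ξ => 𝓕⁻ f ξ * (starRingEnd ℂ) (𝓕⁻ h ξ)) ν := by
  refine ((hFT f hf hfc).1.add (hFT h hh hhc).1).mono' ?_ (Eventually.of_forall fun ξ => ?_)
  · exact ((aux_fourierInv_continuous hf hfc).mul
      (Complex.continuous_conj.comp (aux_fourierInv_continuous hh hhc))).aestronglyMeasurable
  · simp only [norm_mul, RCLike.norm_conj, Pi.add_apply]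
    nlinarith [sq_nonneg (‖𝓕⁻ f ξ‖ - ‖𝓕⁻ h ξ‖), sq_nonneg (‖𝓕⁻ f ξ‖), sq_nonneg (‖𝓕⁻ h ξ‖)]

theorem aux_diag {μ ν : Measure E} (hFT : AuxFT μ ν)
    {f : E → ℂ} (hf : Continuous f) (hfc : HasCompactSupport f) :
    ∫ t, auxA f f t ∂μ = ∫ ξ, 𝓕⁻ f ξ * (starRingEnd ℂ) (𝓕⁻ f ξ) ∂ν := by
  refine (hFT f hf hfc).2.trans ?_
  rw [← integral_complex_ofReal]
  congr 1
  ext ξ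
  rw [Complex.mul_conj, Complex.normSq_eq_norm_sq]

theorem aux_expand {μ ν : Measure E} [IsFiniteMeasureOnCompacts μ] (hFT : AuxFT μ ν)
    {f h : E → ℂ} (hf : Continuous f) (hfc : HasCompactSupport f)
    (hh : Continuous h) (hhc : HasCompactSupport h) (u : ℂ) :
    (starRingEnd ℂ) u * (∫ t, auxA f h t ∂μ) + u * ∫ t, auxA h f t ∂μ =
    (starRingEnd ℂ) u * (∫ ξ, 𝓕⁻ f ξ * (starRingEnd ℂ) (𝓕⁻ h ξ) ∂ν) +
      u * ∫ ξ, 𝓕⁻ h ξ * (starRingEnd ℂ) (𝓕⁻ f ξ) ∂ν := by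
  have hk : Continuous (fun s => f s + u * h s) := hf.add (continuous_const.mul hh)
  have hkc : HasCompactSupport (fun s => f s + u * h s) :=
    hfc.add (hhc.mul_left (f := fun _ => u))
  have e := aux_diag hFT hk hkc
  have eA : ∀ t, auxA (fun s => f s + u * h s) (fun s => f s + u * h s) t =
      (auxA f f t + u * (starRingEnd ℂ) u * auxA h h t) +
      ((starRingEnd ℂ) u * auxA f h t + u * auxA h f t) := by
    intro t
    simp only [auxA]
    have i1 := auxA_inner_integrable hf hfc hf t
    have i2 := auxA_inner_integrable hf hfc hh t
    have i3 := auxA_inner_integrable hh hhc hf t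
    have i4 := auxA_inner_integrable hh hhc hh t
    rw [← aux_integral4 i1 i4 i2 i3]
    congr 1
    ext s
    simp only [map_add, map_mul]
    ring
  have eF : ∀ ξ, 𝓕⁻ (fun s => f s + u * h s) ξ * (starRingEnd ℂ) (𝓕⁻ (fun s => f s + u * h s) ξ) =
      (𝓕⁻ f ξ * (starRingEnd ℂ) (𝓕⁻ f ξ) +
        u * (starRingEnd ℂ) u * (𝓕⁻ h ξ * (starRingEnd ℂ) (𝓕⁻ h ξ))) +
      ((starRingEnd ℂ) u * (𝓕⁻ f ξ * (starRingEnd ℂ) (𝓕⁻ h ξ)) +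
        u * (𝓕⁻ h ξ * (starRingEnd ℂ) (𝓕⁻ f ξ))) := by
    intro ξ
    rw [aux_fourierInv_add_smul hf hfc hh hhc]
    simp only [map_add, map_mul]
    ring
  simp only [eA, eF] at e
  have j1 := auxA_integrable μ hf hfc hf hfc
  have j2 := auxA_integrable μ hf hfc hh hhc
  have j3 := auxA_integrable μ hh hhc hf hfc
  have j4 := auxA_integrable μ hh hhc hh hhc
  have l1 := aux_polar_int hFT hf hfc hf hfc
  have l2 := aux_polar_int hFT hf hfc hh hhc
  have l3 := aux_polar_int hFT hh hhc hf hfc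
  have l4 := aux_polar_int hFT hh hhc hh hhc
  rw [aux_integral4 j1 j4 j2 j3, aux_integral4 l1 l4 l2 l3] at e
  rw [aux_diag hFT hf hfc, aux_diag hFT hh hhc] at e
  exact add_left_cancel e

theorem aux_polar {μ ν : Measure E} [IsFiniteMeasureOnCompacts μ] (hFT : AuxFT μ ν)
    {f h : E → ℂ} (hf : Continuous f) (hfc : HasCompactSupport f)
    (hh : Continuous h) (hhc : HasCompactSupport h) :
    (∫ t, auxA f h t ∂μ) = ∫ ξ, 𝓕⁻ f ξ * (starRingEnd ℂ) (𝓕⁻ h ξ) ∂ν := by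
  have e1 := aux_expand hFT hf hfc hh hhc 1
  have e2 := aux_expand hFT hf hfc hh hhc Complex.I
  simp only [map_one, Complex.conj_I] at e1 e2
  linear_combination (1 / 2 : ℂ) * e1 + (1 / 2 : ℂ) * Complex.I * e2 +
    (1 / 2 : ℂ) * ((∫ t, auxA f h t ∂μ) - (∫ t, auxA h f t ∂μ) -
      (∫ ξ, 𝓕⁻ f ξ * (starRingEnd ℂ) (𝓕⁻ h ξ) ∂ν) +
      ∫ ξ, 𝓕⁻ h ξ * (starRingEnd ℂ) (𝓕⁻ f ξ) ∂ν) * Complex.I_sq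

theorem aux_markov {ν : Measure E} {F : E → ℝ} (hF : ∀ x, 0 ≤ F x) (hFi : Integrable F ν)
    {c : ℝ} (hc : 0 < c) {S : Set E} (hS : ∀ x ∈ S, c ≤ F x) :
    ν S ≤ ENNReal.ofReal (c⁻¹ * ∫ x, F x ∂ν) := by
  have h1 : ENNReal.ofReal c * ν {x | ENNReal.ofReal c ≤ ENNReal.ofReal (F x)} ≤
      ∫⁻ x, ENNReal.ofReal (F x) ∂ν :=
    mul_meas_ge_le_lintegral₀ hFi.aestronglyMeasurable.aemeasurable.ennreal_ofReal _
  rw [← ofReal_integral_eq_lintegral_ofReal hFi (Eventually.of_forall hF)] at h1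
  have h2 : ν S ≤ ν {x | ENNReal.ofReal c ≤ ENNReal.ofReal (F x)} :=
    measure_mono fun x hx => ENNReal.ofReal_le_ofReal (hS x hx)
  have h3 : ENNReal.ofReal c * ν S ≤ ENNReal.ofReal (∫ x, F x ∂ν) := (by gcongr : _ ≤ _).trans h1
  rw [ENNReal.ofReal_mul (by positivity), ENNReal.ofReal_inv_of_pos hc, mul_comm,
    ← div_eq_mul_inv]
  rw [ENNReal.le_div_iff_mul_le (Or.inl (by simpa using hc)) (Or.inl ENNReal.ofReal_ne_top), mul_comm]
  exact h3

theorem aux_norm_char (r : ℝ) : ‖(Real.fourierChar r : ℂ)‖ = 1 := Circle.norm_coe _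

theorem aux_normSq_char (r : ℝ) :
    (Real.fourierChar r : ℂ) * (starRingEnd ℂ) (Real.fourierChar r : ℂ) = 1 := by
  rw [Complex.mul_conj, Complex.normSq_eq_norm_sq, aux_norm_char]; simp

/-- `ν` has uniformly bounded mass on small balls. -/
theorem aux_nu_ball {μ ν : Measure E} (hFT : AuxFT μ ν) :
    ∃ r > 0, ∃ C : ℝ≥0∞, C ≠ ⊤ ∧ ∀ x, ν (closedBall x r) ≤ C := by
  let φ : ContDiffBump (0 : E) := ⟨1, 2, one_pos, one_lt_two⟩
  let f0 : E → ℂ := fun x => (φ.normed volume x : ℂ)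
  have hf : Continuous f0 := Complex.continuous_ofReal.comp φ.continuous_normed
  have hfc : HasCompactSupport f0 :=
    (φ.hasCompactSupport_normed (μ := volume)).comp_left (g := Complex.ofReal) Complex.ofReal_zero
  have hF0 : 𝓕⁻ f0 0 = 1 := by
    rw [Real.fourierInv_eq]
    simp only [inner_zero_right, AddChar.map_zero_eq_one, one_smul, f0]
    rw [integral_complex_ofReal, φ.integral_normed]
    simp
  have hcont := aux_fourierInv_continuous hf hfc
  have hev : ∀ᶠ ξ in 𝓝 (0 : E), (1 / 2 : ℝ) < ‖𝓕⁻ f0 ξ‖ := by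
    apply (hcont.norm.tendsto 0).eventually (lt_mem_nhds _)
    simp only [hF0, norm_one]
    norm_num
  obtain ⟨r, hr, hball⟩ := Metric.nhds_basis_closedBall.eventually_iff.1 hev
  refine ⟨r, hr, ENNReal.ofReal ((1 / 4 : ℝ)⁻¹ * ∫ t, ‖auxA f0 f0 t‖ ∂μ), ENNReal.ofReal_ne_top, ?_⟩
  intro x
  let fx : E → ℂ := fun t => (Real.fourierChar (-⟪t, x⟫) : ℂ) * f0 t
  have hch : Continuous (fun t : E => (Real.fourierChar (-⟪t, x⟫) : ℂ)) :=
    continuous_subtype_val.comp (Real.continuous_fourierChar.comp (by fun_prop))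
  have hfx : Continuous fx := hch.mul hf
  have hfxc : HasCompactSupport fx := hfc.mul_left
  have hFx : ∀ ξ, 𝓕⁻ fx ξ = 𝓕⁻ f0 (ξ - x) := by
    intro ξ
    simp only [Real.fourierInv_eq, fx, Circle.smul_def, smul_eq_mul, inner_sub_right]
    congr 1
    ext v
    rw [← mul_assoc, sub_eq_add_neg, AddChar.map_add_eq_mul, Circle.coe_mul]
  have hAx : ∀ t, auxA fx fx t = (Real.fourierChar (-⟪t, x⟫) : ℂ) * auxA f0 f0 t := by
    intro t
    simp only [auxA, fx]
    rw [← integral_const_mul]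
    congr 1
    ext s
    have : (Real.fourierChar (-⟪s, x⟫) : ℂ) =
        (Real.fourierChar (-⟪t, x⟫) : ℂ) * (Real.fourierChar (-⟪s - t, x⟫) : ℂ) := by
      rw [← Circle.coe_mul, ← AddChar.map_add_eq_mul, inner_sub_left]
      congr 3
      ring
    rw [this, map_mul]
    linear_combination ((Real.fourierChar (-⟪t, x⟫) : ℂ) * f0 s * (starRingEnd ℂ) (f0 (s - t))) *
      aux_normSq_char (-⟪s - t, x⟫)
  obtain ⟨hi, he⟩ := hFT fx hfx hfxc
  refine (aux_markov (fun ξ => sq_nonneg _) hi (c := 1 / 4) (by norm_num) ?_).trans ?_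
  · intro ξ hξ
    have : (1 / 2 : ℝ) < ‖𝓕⁻ f0 (ξ - x)‖ := hball (by
      simpa [dist_eq_norm] using hξ)
    rw [hFx]
    nlinarith
  · apply ENNReal.ofReal_le_ofReal
    gcongr
    have h1 : ∫ ξ, ‖𝓕⁻ fx ξ‖ ^ 2 ∂ν = ‖((∫ ξ, ‖𝓕⁻ fx ξ‖ ^ 2 ∂ν : ℝ) : ℂ)‖ := by
      rw [Complex.norm_real, Real.norm_of_nonneg (integral_nonneg fun _ => sq_nonneg _)]
    rw [h1, ← he]
    refine (norm_integral_le_integral_norm _).trans (le_of_eq ?_)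
    congr 1
    ext t
    change ‖auxA fx fx t‖ = _
    rw [hAx, norm_mul, aux_norm_char, one_mul]

theorem aux_translation_bounded {μ ν : Measure E} (hFT : AuxFT μ ν) {K : Set E}
    (hK : IsCompact K) : ∃ C : ℝ≥0∞, C ≠ ⊤ ∧ ∀ x : E, ν (x +ᵥ K) ≤ C := by
  obtain ⟨r, hr, C, hC, hb⟩ := aux_nu_ball hFT
  obtain ⟨T, -, hT, hcov⟩ := hK.finite_cover_balls hr
  refine ⟨hT.toFinset.card * C, ENNReal.mul_ne_top (ENNReal.natCast_ne_top _) hC, fun x => ?_⟩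
  have hsub : x +ᵥ K ⊆ ⋃ y ∈ hT.toFinset, closedBall (x + y) r := by
    rintro _ ⟨k, hk, rfl⟩
    have := hcov hk
    simp only [Set.mem_iUnion, Set.Finite.mem_toFinset] at this ⊢
    obtain ⟨y, hy, hky⟩ := this
    refine ⟨y, hy, ?_⟩
    have := (mem_ball.1 hky).le
    simpa [dist_eq_norm] using this
  calc ν (x +ᵥ K) ≤ ∑ y ∈ hT.toFinset, ν (closedBall (x + y) r) :=
        (measure_mono hsub).trans (measure_biUnion_finset_le _ _)
    _ ≤ ∑ y ∈ hT.toFinset, C := Finset.sum_le_sum fun y _ => hb _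
    _ = _ := by simp

theorem aux_mu_ball {μ ν : Measure E} [IsFiniteMeasureOnCompacts μ] (hFT : AuxFT μ ν) :
    ∃ C : ℝ≥0∞, C ≠ ⊤ ∧ ∀ x, μ (closedBall x 1) ≤ C := by
  let φ : ContDiffBump (0 : E) := ⟨2, 3, by norm_num, by norm_num⟩
  let f : E → ℂ := fun x => (φ x : ℂ)
  have hf : Continuous f := Complex.continuous_ofReal.comp φ.continuous
  have hfc : HasCompactSupport f :=
    φ.hasCompactSupport.comp_left (g := Complex.ofReal) Complex.ofReal_zero
  set V : ℝ := volume.real (closedBall (0 : E) 1) with hV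
  have hV0 : 0 < V := ENNReal.toReal_pos (measure_closedBall_pos volume (0 : E) one_pos).ne'
    measure_closedBall_lt_top.ne
  refine ⟨ENNReal.ofReal (V⁻¹ * ∫ ξ, ‖𝓕⁻ f ξ‖ ^ 2 ∂ν), ENNReal.ofReal_ne_top, fun x => ?_⟩
  let fx : E → ℂ := fun s => f (s - x)
  have hfx : Continuous fx := hf.comp (continuous_id.sub continuous_const)
  have hfxc : HasCompactSupport fx := hfc.comp_homeomorph (Homeomorph.subRight x)
  have hFx : ∀ ξ, ‖𝓕⁻ fx ξ‖ = ‖𝓕⁻ f ξ‖ := by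
    intro ξ
    have : 𝓕⁻ fx ξ = (Real.fourierChar ⟪x, ξ⟫ : ℂ) * 𝓕⁻ f ξ := by
      simp only [Real.fourierInv_eq, fx, Circle.smul_def, smul_eq_mul]
      rw [← integral_add_right_eq_self _ x, ← integral_const_mul]
      congr 1
      ext v
      rw [inner_add_left, AddChar.map_add_eq_mul, Circle.coe_mul, add_sub_cancel_right]
      ring
    rw [this, norm_mul, aux_norm_char, one_mul]
  have hA : ∀ t, auxA fx f t = ((∫ s, φ (s - x) * φ (s - t) : ℝ) : ℂ) := by
    intro t
    rw [← integral_complex_ofReal]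
    simp [auxA, fx, f]
  have hG0 : ∀ t, 0 ≤ ∫ s, φ (s - x) * φ (s - t) := fun t =>
    integral_nonneg fun s => mul_nonneg φ.nonneg φ.nonneg
  have hGi : Integrable (fun t => ∫ s, φ (s - x) * φ (s - t)) μ := by
    have := (auxA_integrable μ hfx hfxc hf hfc).re
    refine this.congr (Eventually.of_forall fun t => ?_)
    simp only [hA]
    exact Complex.ofReal_re _
  have hGV : ∀ t ∈ closedBall x 1, V ≤ ∫ s, φ (s - x) * φ (s - t) := by
    intro t ht
    have hint : Integrable (fun s => φ (s - x) * φ (s - t)) := by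
      refine Continuous.integrable_of_hasCompactSupport ?_ ?_
      · exact (φ.continuous.comp (continuous_id.sub continuous_const)).mul
          (φ.continuous.comp (continuous_id.sub continuous_const))
      · have : HasCompactSupport (fun s => φ (s - x)) :=
          φ.hasCompactSupport.comp_homeomorph (Homeomorph.subRight x)
        exact this.mul_right
    have h1 : V = ∫ s, (closedBall x 1).indicator (fun _ => (1 : ℝ)) s := by
      rw [integral_indicator measurableSet_closedBall]
      simp only [integral_const, smul_eq_mul, mul_one, measureReal_restrict_apply_univ]
      rw [hV, Measure.real, Measure.real, Measure.addHaar_closedBall_center volume x 1]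
    rw [h1]
    refine integral_mono ?_ hint fun s => ?_
    · exact (integrable_indicator_iff measurableSet_closedBall).2
        (integrableOn_const measure_closedBall_lt_top.ne)
    · by_cases hs : s ∈ closedBall x 1
      · simp only [Set.indicator_of_mem hs]
        have a1 : ‖s - x‖ ≤ 1 := by simpa [dist_eq_norm] using hs
        have a2 : ‖t - x‖ ≤ 1 := by simpa [dist_eq_norm] using ht
        have a3 : ‖s - t‖ ≤ 2 := by
          have := norm_sub_le (s - x) (t - x)
          rw [sub_sub_sub_cancel_right] at this
          linarith
        rw [φ.one_of_mem_closedBall (by simp [φ]; linarith),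
          φ.one_of_mem_closedBall (by simp [φ]; linarith)]
        norm_num
      · simp only [Set.indicator_of_notMem hs]
        exact mul_nonneg φ.nonneg φ.nonneg
  refine (aux_markov hG0 hGi hV0 hGV).trans ?_
  apply ENNReal.ofReal_le_ofReal
  gcongr
  have h1 : ∫ t, (∫ s, φ (s - x) * φ (s - t)) ∂μ = ‖∫ t, auxA fx f t ∂μ‖ := by
    simp only [hA]
    rw [integral_complex_ofReal, Complex.norm_real, Real.norm_of_nonneg (integral_nonneg hG0)]
  rw [h1, aux_polar hFT hfx hfxc hf hfc]
  refine (norm_integral_le_integral_norm _).trans (le_of_eq ?_)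
  congr 1
  ext ξ
  rw [norm_mul, RCLike.norm_conj, hFx, sq]

/-- A shrinking sequence of bumps. -/
def auxBump (E : Type*) [NormedAddCommGroup E] [InnerProductSpace ℝ E] (n : ℕ) :
    ContDiffBump (0 : E) :=
  ⟨((n : ℝ) + 2)⁻¹, ((n : ℝ) + 1)⁻¹, by positivity, by gcongr; norm_num⟩

theorem aux_approx {u : E → ℂ} (hu : Continuous u) (t : E) :
    Tendsto (fun n => ∫ s, u s * (((auxBump E n).normed volume (s - t) : ℝ) : ℂ)) atTop (𝓝 (u t)) := by
  have h0 : Tendsto (fun n => (auxBump E n).rOut) atTop (𝓝 0) :=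
    (tendsto_inv_atTop_zero.comp
      (tendsto_atTop_add_const_right _ 1 tendsto_natCast_atTop_atTop))
  have h1 := ContDiffBump.convolution_tendsto_right_of_continuous (μ := volume) h0 hu t
  refine h1.congr fun n => ?_
  rw [convolution_eq_swap]
  congr 1
  ext s
  rw [← neg_sub s t, ContDiffBump.normed_neg]
  simp [mul_comm]

theorem aux_cc {μ ν : Measure E} [IsFiniteMeasureOnCompacts μ] [ν.HasTemperateGrowth]
    (hFT : AuxFT μ ν) (g : 𝓢(E, ℂ)) (hgc : HasCompactSupport g) :
    ∫ t, g t ∂μ = ∫ ξ, (𝓕⁻ g) ξ ∂ν := by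
  let h : ℕ → E → ℂ := fun n x => ((auxBump E n).normed volume x : ℂ)
  have hh : ∀ n, Continuous (h n) := fun n =>
    Complex.continuous_ofReal.comp (auxBump E n).continuous_normed
  have hhc : ∀ n, HasCompactSupport (h n) := fun n =>
    ((auxBump E n).hasCompactSupport_normed (μ := volume)).comp_left (g := Complex.ofReal)
      Complex.ofReal_zero
  have hg : Continuous g := g.continuous
  have hpol := fun n => aux_polar hFT hg hgc (hh n) (hhc n)
  have hgF : ∀ ξ, 𝓕⁻ (⇑g) ξ = (𝓕⁻ g) ξ := fun ξ => by rw [SchwartzMap.fourierInv_coe]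
  -- limit on the `μ` side
  have hA : ∀ n t, auxA g (h n) t = ∫ s, g s * (((auxBump E n).normed volume (s - t) : ℝ) : ℂ) := by
    intro n t
    simp [auxA, h]
  obtain ⟨M, hM⟩ := hgc.exists_bound_of_continuous hg
  have hM0 : 0 ≤ M := (norm_nonneg _).trans (hM 0)
  set K := cthickening 1 (tsupport g) with hK
  have hKc : IsCompact K := IsCompact.cthickening hgc
  have lim1 : Tendsto (fun n => ∫ t, auxA g (h n) t ∂μ) atTop (𝓝 (∫ t, g t ∂μ)) := by
    refine tendsto_integral_of_dominated_convergence (K.indicator fun _ => M) ?_ ?_ ?_ ?_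
    · intro n
      exact (auxA_integrable μ hg hgc (hh n) (hhc n)).aestronglyMeasurable
    · exact (integrable_indicator_iff hKc.measurableSet).2 (integrableOn_const hKc.measure_lt_top.ne)
    · intro n
      refine Eventually.of_forall fun t => ?_
      rw [hA]
      by_cases ht : t ∈ K
      · rw [Set.indicator_of_mem ht]
        have hi : Integrable (fun s => (auxBump E n).normed volume (s - t)) :=
          (auxBump E n).integrable_normed.comp_sub_right t
        calc ‖∫ s, g s * (((auxBump E n).normed volume (s - t) : ℝ) : ℂ)‖
            ≤ ∫ s, M * (auxBump E n).normed volume (s - t) := by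
              refine norm_integral_le_of_norm_le (hi.const_mul M) (Eventually.of_forall fun s => ?_)
              rw [norm_mul, Complex.norm_real, Real.norm_of_nonneg ((auxBump E n).nonneg_normed _)]
              exact mul_le_mul_of_nonneg_right (hM s) ((auxBump E n).nonneg_normed _)
          _ = M := by
              rw [integral_const_mul, integral_sub_right_eq_self, (auxBump E n).integral_normed, mul_one]
      · rw [Set.indicator_of_notMem ht]
        rw [show (fun s => g s * (((auxBump E n).normed volume (s - t) : ℝ) : ℂ)) = fun _ => 0 from ?_]
        · simp
        · ext s
          by_contra hne
          have hgs : g s ≠ 0 := fun h0 => hne (by simp [h0])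
          have hbs : (auxBump E n).normed volume (s - t) ≠ 0 := fun h0 => hne (by simp [h0])
          have hmem : s - t ∈ Function.support ((auxBump E n).normed volume) := hbs
          rw [ContDiffBump.support_normed_eq, mem_ball, dist_zero_right] at hmem
          apply ht
          refine mem_cthickening_of_dist_le t s 1 _ (subset_tsupport _ hgs) ?_
          rw [dist_comm, dist_eq_norm]
          have : (auxBump E n).rOut ≤ 1 :=
            inv_le_one_of_one_le₀ (by linarith [n.cast_nonneg (α := ℝ)])
          linarith
    · refine Eventually.of_forall fun t => ?_
      simp only [hA]
      exact aux_approx hg t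
  have hFh : ∀ n ξ, 𝓕⁻ (h n) ξ =
      ∫ s, (Real.fourierChar ⟪s, ξ⟫ : ℂ) * (((auxBump E n).normed volume (s - 0) : ℝ) : ℂ) := by
    intro n ξ
    simp [Real.fourierInv_eq, Circle.smul_def, h]
  have lim2 : Tendsto (fun n => ∫ ξ, 𝓕⁻ (⇑g) ξ * (starRingEnd ℂ) (𝓕⁻ (h n) ξ) ∂ν) atTop
      (𝓝 (∫ ξ, (𝓕⁻ g) ξ ∂ν)) := by
    refine tendsto_integral_of_dominated_convergence (fun ξ => ‖(𝓕⁻ g) ξ‖) ?_ ?_ ?_ ?_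
    · intro n
      exact (aux_polar_int hFT hg hgc (hh n) (hhc n)).aestronglyMeasurable
    · exact ((𝓕⁻ g).integrable (μ := ν)).norm
    · intro n
      refine Eventually.of_forall fun ξ => ?_
      rw [norm_mul, RCLike.norm_conj, hgF]
      refine mul_le_of_le_one_right (norm_nonneg _) ?_
      rw [Real.fourierInv_eq]
      refine (norm_integral_le_integral_norm _).trans (le_of_eq ?_)
      rw [← (auxBump E n).integral_normed (μ := volume)]
      congr 1
      ext s
      rw [Circle.norm_smul, Complex.norm_real, Real.norm_of_nonneg ((auxBump E n).nonneg_normed _)]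
    · refine Eventually.of_forall fun ξ => ?_
      have hc : Continuous (fun s : E => (Real.fourierChar ⟪s, ξ⟫ : ℂ)) :=
        continuous_subtype_val.comp (Real.continuous_fourierChar.comp (by fun_prop))
      have h1 := aux_approx hc 0
      simp only [← hFh, inner_zero_left, AddChar.map_zero_eq_one, Circle.coe_one] at h1
      have h2 := ((Complex.continuous_conj.tendsto 1).comp h1).const_mul (𝓕⁻ (⇑g) ξ)
      rw [map_one, mul_one, hgF] at h2
      simpa only [hgF, Function.comp_def] using h2
  simp only [hpol] at lim1
  exact tendsto_nhds_unique lim1 lim2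

end Aux

/-- Let `μ, ν` be positive Radon measures on `ℝ^d` with `ν` the Fourier
transform of `μ` in the measure sense. Then `ν` is translation bounded, `μ` is tempered
(every Schwartz function is `μ`-integrable), and `ν` is the Fourier transform of `μ` as a
tempered distribution. -/
theorem fourierTransformable_sap_stmt10 {d : ℕ}
    (μ ν : Measure (EuclideanSpace ℝ (Fin d))) [μ.Regular] [ν.Regular]
    (hFT : ∀ f : EuclideanSpace ℝ (Fin d) → ℂ, Continuous f → HasCompactSupport f →
      Integrable (fun ξ => ‖𝓕⁻ f ξ‖ ^ 2) ν ∧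
      ∫ t, (∫ s, f s * (starRingEnd ℂ) (f (s - t))) ∂μ
        = ((∫ ξ, ‖𝓕⁻ f ξ‖ ^ 2 ∂ν : ℝ) : ℂ)) :
    (∀ K : Set (EuclideanSpace ℝ (Fin d)), IsCompact K →
      (⨆ x : EuclideanSpace ℝ (Fin d), ν (x +ᵥ K)) < ⊤) ∧
    (∀ g : 𝓢(EuclideanSpace ℝ (Fin d), ℂ), Integrable (fun t => g t) μ) ∧
    (∀ g : 𝓢(EuclideanSpace ℝ (Fin d), ℂ),
      Integrable (fun ξ => 𝓕⁻ (fun t => g t) ξ) ν ∧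
        ∫ t, g t ∂μ = ∫ ξ, 𝓕⁻ (fun t => g t) ξ ∂ν) := by
  have hFT' : AuxFT μ ν := hFT
  have hμt : μ.HasTemperateGrowth := by
    obtain ⟨C, hC, hb⟩ := aux_mu_ball hFT'
    exact aux_temperate μ C hC hb
  have hνt : ν.HasTemperateGrowth := by
    obtain ⟨C, hC, hb⟩ := aux_translation_bounded hFT'
      (isCompact_closedBall (0 : EuclideanSpace ℝ (Fin d)) 1)
    refine aux_temperate ν C hC fun x => ?_
    have := hb x
    rwa [vadd_closedBall, vadd_eq_add, add_zero] at this
  have hgF : ∀ g : 𝓢(EuclideanSpace ℝ (Fin d), ℂ),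
      (fun ξ => 𝓕⁻ (fun t => g t) ξ) = fun ξ => (𝓕⁻ g) ξ := fun g => by
    rw [SchwartzMap.fourierInv_coe]
  refine ⟨fun K hK => ?_, fun g => g.integrable, fun g => ⟨?_, ?_⟩⟩
  · obtain ⟨C, hC, hb⟩ := aux_translation_bounded hFT' hK
    exact (iSup_le hb).trans_lt hC.lt_top
  · rw [hgF]
    exact (𝓕⁻ g).integrable
  · rw [hgF]
    obtain ⟨u, huc, hu⟩ := aux_dense g
    have l1 := ((SchwartzMap.integralCLM ℂ μ (V := ℂ)).continuous.tendsto g).comp hu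
    have l2 := ((SchwartzMap.integralCLM ℂ ν (V := ℂ)).continuous.tendsto (𝓕⁻ g)).comp
      (((FourierTransform.continuous_fourierInv
        (E := 𝓢(EuclideanSpace ℝ (Fin d), ℂ)) (F := 𝓢(EuclideanSpace ℝ (Fin d), ℂ))).tendsto g).comp hu)
    refine tendsto_nhds_unique l1 (l2.congr fun n => ?_)
    exact (aux_cc hFT' (u n) (huc n)).symm
end
end

section
/- Let 𝓛 ⊂ ℝ^d × ℝ^m be a full-rank lattice (a discrete cocompact subgroup) such that the projection p₁ onto ℝ^d is injective on 𝓛 and the projection p₂(𝓛) is dense in ℝ^m, and let h : ℝ^m → ℂ be continuous with compact support. Then for every point (χ, χ⋆) of the dual lattice 𝓛⁰ = {(y, y⋆) ∈ ℝ^d × ℝ^m : ⟨y,x⟩ + ⟨y⋆,x⋆⟩ ∈ ℤ for all (x,x⋆) ∈ 𝓛}, one has lim_{R→∞} vol(B_R)⁻¹ ∑_{(x,x⋆) ∈ 𝓛, x ∈ B_R} e^{−2πi⟨χ,x⟩} h(x⋆) = dens(𝓛) · ∫_{ℝ^m} e^{2πi⟨χ⋆,t⟩} h(t) dt, where dens(𝓛)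 = 1/covol(𝓛) is the reciprocal of the covolume of 𝓛 in ℝ^{d+m}, and B_R is the open ball of radius R in ℝ^d. (In particular the Fourier–Bohr coefficient of the weighted Dirac comb ω_h = ∑_{(x,x⋆)∈𝓛} h(x⋆) δ_x at χ equals dens(𝓛)·ȟ(χ⋆).) -/
open MeasureTheory Metric Filter
open scoped Pointwise FourierTransform RealInnerProductSpace ENNReal Topology

noncomputable section

set_option linter.unusedSectionVars false

namespace CPS

section Basic
variable {V W : Type*}
  [NormedAddCommGroup V] [InnerProductSpace ℝ V] [FiniteDimensional ℝ V] [MeasurableSpace V]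
  [BorelSpace V]
  [NormedAddCommGroup W] [InnerProductSpace ℝ W] [FiniteDimensional ℝ W] [MeasurableSpace W]
  [BorelSpace W]
  (L : Submodule ℤ (V × W)) [DiscreteTopology L]

/-- number of lattice points in a set -/
def cnt (B : Set (V × W)) : ℝ := ({l : L | (l : V × W) ∈ B}.ncard : ℝ)

lemma finite_of_bounded {B : Set (V × W)} (hB : Bornology.IsBounded B) :
    {l : L | (l : V × W) ∈ B}.Finite := by
  have h1 : (B ∩ (L : Set (V × W))).Finite := by
    change (B ∩ L.toAddSubgroup).Finite
    have : DiscreteTopology L.toAddSubgroup := ‹DiscreteTopology L›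
    exact Metric.finite_isBounded_inter_isClosed DiscreteTopology.isDiscrete hB inferInstance
  refine Set.Finite.of_finite_image (f := ((↑) : L → V × W)) (h1.subset ?_)
    Subtype.val_injective.injOn
  rintro _ ⟨l, hl, rfl⟩
  exact ⟨hl, l.2⟩

lemma norm_tsum_le {B : Set (V × W)} (hB : Bornology.IsBounded B) (f : L → ℂ) {M : ℝ}
    (hf : ∀ l : L, (l : V × W) ∉ B → f l = 0) (hM : ∀ l, ‖f l‖ ≤ M) :
    ‖∑' l, f l‖ ≤ M * cnt L B := by
  have hfin := finite_of_bounded L hB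
  rw [tsum_eq_sum (s := hfin.toFinset) (by intro l hl; exact hf l (by simpa using hl))]
  refine (norm_sum_le _ _).trans ?_
  refine (Finset.sum_le_card_nsmul _ _ M (fun l _ => hM l)).trans ?_
  rw [cnt, Set.ncard_eq_toFinset_card _ hfin, nsmul_eq_mul, mul_comm]

lemma summable_of_bdd {B : Set (V × W)} (hB : Bornology.IsBounded B) (f : L → ℂ)
    (hf : ∀ l : L, (l : V × W) ∉ B → f l = 0) : Summable f := by
  have hfin := finite_of_bounded L hB
  refine summable_of_hasFiniteSupport (hfin.subset ?_)
  intro l hl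
  by_contra h
  exact hl (hf l h)

instance : MeasurableVAdd L (V × W) := (inferInstance : MeasurableVAdd L.toAddSubgroup (V × W))
instance : Measure.IsAddHaarMeasure (volume : Measure (V × W)) :=
  (inferInstance : Measure.IsAddHaarMeasure ((volume : Measure V).prod (volume : Measure W)))
instance : VAddInvariantMeasure L (V × W) volume :=
  (inferInstance : VAddInvariantMeasure L.toAddSubgroup (V × W) volume)

lemma cnt_bound {F A B : Set (V × W)} (hF : IsAddFundamentalDomain L F (volume : Measure (V × W)))
    (hA : Bornology.IsBounded A) (hB : Bornology.IsBounded B)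
    (hAB : ∀ a ∈ A, ∀ z ∈ F, a + z ∈ B) :
    cnt L A * volume.real F ≤ volume.real B := by
  have hfin := finite_of_bounded L hA
  have h1 : volume (⋃ l ∈ hfin.toFinset, (l +ᵥ F)) = ∑ l ∈ hfin.toFinset, volume (l +ᵥ F) := by
    apply measure_biUnion_finset₀
    · intro a _ b _ hab
      exact hF.aedisjoint hab
    · intro b _
      exact hF.nullMeasurableSet_vadd b
  have h2 : (⋃ l ∈ hfin.toFinset, (l +ᵥ F)) ⊆ B := by
    intro x hx
    simp only [Set.mem_iUnion, Set.Finite.mem_toFinset] at hx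
    obtain ⟨l, hl, z, hz, rfl⟩ := hx
    exact hAB _ hl _ hz
  have h3 := measure_mono (μ := volume) h2
  rw [h1] at h3
  simp only [measure_vadd, Finset.sum_const, nsmul_eq_mul] at h3
  have h4 := ENNReal.toReal_mono hB.measure_lt_top.ne h3
  rw [ENNReal.toReal_mul, ENNReal.toReal_natCast] at h4
  rw [cnt, Set.ncard_eq_toFinset_card _ hfin]
  exact h4

/-- volume of ball -/
def vb (V : Type*) [NormedAddCommGroup V] [InnerProductSpace ℝ V] [FiniteDimensional ℝ V]
  [MeasurableSpace V] [BorelSpace V] (R : ℝ) : ℝ := volume.real (ball (0 : V) R)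

lemma vb_eq {R : ℝ} (hR : 0 < R) : vb V R = R ^ Module.finrank ℝ V * vb V 1 := by
  rw [vb, Measure.real, Measure.addHaar_ball_of_pos _ _ hR, ENNReal.toReal_mul,
    ENNReal.toReal_ofReal (by positivity)]
  rfl

lemma vb_pos {R : ℝ} (hR : 0 < R) : 0 < vb V R :=
  ENNReal.toReal_pos (measure_ball_pos _ _ hR).ne' measure_ball_lt_top.ne

lemma vb_ratio (a : ℝ) : Tendsto (fun R => vb V (R + a) / vb V R) atTop (𝓝 1) := by
  have h1 : Tendsto (fun R : ℝ => ((R + a) / R) ^ Module.finrank ℝ V) atTop (𝓝 1) := by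
    have : Tendsto (fun R : ℝ => 1 + a / R) atTop (𝓝 (1 + 0)) :=
      tendsto_const_nhds.add (tendsto_const_nhds.div_atTop tendsto_id)
    have h2 := this.pow (Module.finrank ℝ V)
    rw [add_zero, one_pow] at h2
    refine h2.congr' ?_
    filter_upwards [eventually_gt_atTop 0] with R hR
    congr 1
    field_simp
  refine h1.congr' ?_
  filter_upwards [eventually_gt_atTop 0, eventually_gt_atTop (-a)] with R hR hRa
  rw [vb_eq hR, vb_eq (by linarith : 0 < R + a), div_pow]
  have := vb_pos (V := V) one_pos
  field_simp

variable [IsZLattice ℝ L]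

lemma exists_fd : ∃ (F : Set (V × W)) (c : ℝ), IsAddFundamentalDomain L F volume ∧
    MeasurableSet F ∧ 0 < c ∧ 0 < volume.real F ∧ (∀ z ∈ F, ‖z.1‖ < c ∧ ‖z.2‖ < c) ∧
    ZLattice.covolume L = volume.real F ∧ volume F < ⊤ := by
  let b := Module.Free.chooseBasis ℤ L
  have hF := ZLattice.isAddFundamentalDomain b (volume : Measure (V × W))
  have hbd := ZSpan.fundamentalDomain_isBounded (b.ofZLatticeBasis ℝ L)
  have hcov := ZLattice.covolume_eq_measure_fundamentalDomain L volume hF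
  obtain ⟨c, hc⟩ := hbd.subset_ball 0
  refine ⟨_, max c 1, hF, ZSpan.fundamentalDomain_measurableSet _, by positivity, ?_, ?_, hcov,
    hbd.measure_lt_top⟩
  · rw [← hcov]; exact ZLattice.covolume_pos L volume
  · intro z hz
    have := hc hz
    rw [mem_ball_zero_iff] at this
    exact ⟨lt_max_of_lt_left ((norm_fst_le z).trans_lt this),
      lt_max_of_lt_left ((norm_snd_le z).trans_lt this)⟩

lemma cnt_shell (s ρ : ℝ) : Tendsto (fun R => cnt L ((ball (0 : V) (R + s) \ ball 0 (R - s)) ×ˢ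
    ball (0 : W) ρ) / vb V R) atTop (𝓝 0) := by
  obtain ⟨F, c, hF, hFm, hc, hFp, hFc, -, -⟩ := exists_fd L
  have h0 : Tendsto (fun R => (vb V (R + (|s| + c)) / vb V R - vb V (R + -(|s| + c)) / vb V R) *
      (volume.real (ball (0 : W) (ρ + c)) / volume.real F)) atTop (𝓝 0) := by
    have := ((vb_ratio (V := V) (|s| + c)).sub (vb_ratio (V := V) (-(|s| + c)))).mul_const
      (volume.real (ball (0 : W) (ρ + c)) / volume.real F)
    simpa using this
  refine squeeze_zero' ?_ ?_ h0
  · exact Eventually.of_forall fun R => div_nonneg (Nat.cast_nonneg _) ENNReal.toReal_nonneg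
  filter_upwards [eventually_gt_atTop 0] with R hR
  have key := cnt_bound L (A := (ball (0 : V) (R + s) \ ball 0 (R - s)) ×ˢ ball (0 : W) ρ)
    (B := (ball (0 : V) (R + (|s| + c)) \ ball 0 (R + -(|s| + c))) ×ˢ ball (0 : W) (ρ + c)) hF
    ((isBounded_ball.subset Set.sdiff_subset).prod isBounded_ball)
    ((isBounded_ball.subset Set.sdiff_subset).prod isBounded_ball) (by
      rintro ⟨a1, a2⟩ ⟨⟨h1, h2⟩, h3⟩ z hz
      obtain ⟨hz1, hz2⟩ := hFc z hz
      simp only [mem_ball_zero_iff, not_lt] at h1 h2 h3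
      have e1 := norm_add_le a1 z.1
      have e2 := norm_add_le a2 z.2
      have e3 := norm_sub_le (a1 + z.1) z.1
      rw [add_sub_cancel_right] at e3
      have e4 := le_abs_self s
      refine ⟨⟨?_, ?_⟩, ?_⟩ <;> simp only [mem_ball_zero_iff, not_lt, Prod.fst_add, Prod.snd_add]
        <;> linarith)
  have hv : volume.real ((ball (0 : V) (R + (|s| + c)) \ ball 0 (R + -(|s| + c))) ×ˢ
      ball (0 : W) (ρ + c)) = (vb V (R + (|s| + c)) - vb V (R + -(|s| + c))) *
      volume.real (ball (0 : W) (ρ + c)) := by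
    rw [Measure.volume_eq_prod, measureReal_prod_prod, measureReal_sdiff (ball_subset_ball ?_)
      measurableSet_ball measure_ball_lt_top.ne]
    · rfl
    · have := abs_nonneg s
      linarith
  rw [hv, ← le_div_iff₀ hFp] at key
  have hvR := vb_pos (V := V) hR
  calc _ ≤ _ := div_le_div_of_nonneg_right key hvR.le
    _ = _ := by field_simp

lemma cnt_ball (s ρ : ℝ) : ∃ C : ℝ, 0 < C ∧ ∀ᶠ R in atTop, cnt L (ball (0 : V) (R + s) ×ˢ
    ball (0 : W) ρ) ≤ C * vb V R := by
  obtain ⟨F, c, hF, hFm, hc, hFp, hFc, -, -⟩ := exists_fd L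
  refine ⟨2 * (volume.real (ball (0 : W) (ρ + c)) / volume.real F) + 1, by positivity, ?_⟩
  filter_upwards [eventually_gt_atTop 0,
    (vb_ratio (V := V) (s + c)).eventually_lt_const one_lt_two] with R hR hR2
  have key := cnt_bound L (A := ball (0 : V) (R + s) ×ˢ ball (0 : W) ρ)
    (B := ball (0 : V) (R + (s + c)) ×ˢ ball (0 : W) (ρ + c)) hF
    (isBounded_ball.prod isBounded_ball)
    (isBounded_ball.prod isBounded_ball) (by
      rintro ⟨a1, a2⟩ ⟨h1, h3⟩ z hz
      obtain ⟨hz1, hz2⟩ := hFc z hz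
      simp only [mem_ball_zero_iff] at h1 h3
      have e1 := norm_add_le a1 z.1
      have e2 := norm_add_le a2 z.2
      refine ⟨?_, ?_⟩ <;> simp only [mem_ball_zero_iff, Prod.fst_add, Prod.snd_add]
        <;> linarith)
  have hvR := vb_pos (V := V) hR
  rw [Measure.volume_eq_prod, measureReal_prod_prod, ← Measure.volume_eq_prod,
    ← le_div_iff₀ hFp] at key
  rw [div_lt_iff₀ hvR] at hR2
  change _ ≤ vb V (R + (s + c)) * _ / _ at key
  have h5 : 0 ≤ volume.real (ball (0 : W) (ρ + c)) / volume.real F := by positivity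
  rw [mul_div_assoc] at key
  nlinarith [mul_le_mul_of_nonneg_right hR2.le h5]

/-- the test function on the product -/
def Phi (g : W → ℂ) (R : ℝ) (z : V × W) : ℂ := (ball (0 : V) R).indicator (fun _ => (1 : ℂ)) z.1 * g z.2

/-- lattice sum -/
def S (g : W → ℂ) (R : ℝ) (z : V × W) : ℂ := ∑' l : L, Phi g R ((l : V × W) + z)

lemma S_add (g : W → ℂ) (R : ℝ) (z : V × W) (l : L) : S L g R (z + l) = S L g R z := by
  unfold S
  rw [← (Equiv.addRight l).tsum_eq (fun k : L => Phi g R ((k : V × W) + z))]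
  refine tsum_congr fun k => ?_
  simp only [Equiv.coe_addRight, Submodule.coe_add]
  congr 1
  abel

lemma Phi_zero {g : W → ℂ} {ρ : ℝ} (hg : ∀ w, ρ ≤ ‖w‖ → g w = 0) (R : ℝ) (z : V × W)
    (hz : z ∉ ball (0 : V) R ×ˢ ball (0 : W) ρ) : Phi g R z = 0 := by
  unfold Phi
  by_cases h1 : z.1 ∈ ball (0 : V) R
  · rw [hg, mul_zero]
    by_contra h2
    exact hz ⟨h1, by simpa using h2⟩
  · rw [Set.indicator_of_notMem h1, zero_mul]

lemma Phi_bound {g : W → ℂ} {M : ℝ} (hM : ∀ w, ‖g w‖ ≤ M) (R : ℝ) (z : V × W) :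
    ‖Phi g R z‖ ≤ M := by
  unfold Phi
  have h0 := (norm_nonneg _).trans (hM 0)
  by_cases h1 : z.1 ∈ ball (0 : V) R
  · rw [Set.indicator_of_mem h1, one_mul]; exact hM _
  · rw [Set.indicator_of_notMem h1, zero_mul, norm_zero]; exact h0

lemma Phi_zero' {g : W → ℂ} {ρ : ℝ} (hg : ∀ w, ρ ≤ ‖w‖ → g w = 0) (R : ℝ) {c : ℝ} {z : V × W}
    (hz : ‖z.1‖ ≤ c ∧ ‖z.2‖ ≤ c) (x : V × W)
    (hx : x ∉ ball (0 : V) (R + c) ×ˢ ball (0 : W) (ρ + c)) : Phi g R (x + z) = 0 := by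
  apply Phi_zero hg
  rintro ⟨h1, h2⟩
  simp only [mem_ball_zero_iff, Prod.fst_add, Prod.snd_add] at h1 h2
  apply hx
  have e3 := norm_sub_le (x.1 + z.1) z.1
  have e4 := norm_sub_le (x.2 + z.2) z.2
  rw [add_sub_cancel_right] at e3 e4
  constructor <;> simp only [mem_ball_zero_iff] <;> linarith

lemma S_summable {g : W → ℂ} {ρ : ℝ} (hg : ∀ w, ρ ≤ ‖w‖ → g w = 0) (R : ℝ) (z : V × W) :
    Summable (fun l : L => Phi g R ((l : V × W) + z)) :=
  summable_of_bdd L (isBounded_ball.prod isBounded_ball) _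
    (fun l hl => Phi_zero' hg R ⟨norm_fst_le z, norm_snd_le z⟩ l hl)

lemma S_bound {g : W → ℂ} {ρ M : ℝ} (hg : ∀ w, ρ ≤ ‖w‖ → g w = 0) (hM : ∀ w, ‖g w‖ ≤ M)
    (R : ℝ) {c : ℝ} {z : V × W} (hz : ‖z.1‖ ≤ c ∧ ‖z.2‖ ≤ c) :
    ‖S L g R z‖ ≤ M * cnt L (ball (0 : V) (R + c) ×ˢ ball (0 : W) (ρ + c)) :=
  norm_tsum_le L (isBounded_ball.prod isBounded_ball) _ (fun l hl => Phi_zero' hg R hz l hl)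
    fun _ => Phi_bound hM _ _

lemma S_shift_fst {g : W → ℂ} {ρ M : ℝ} (hg : ∀ w, ρ ≤ ‖w‖ → g w = 0) (hM : ∀ w, ‖g w‖ ≤ M)
    (a : V) (b : W) (R : ℝ) : ‖S L g R (a, b) - S L g R (0, b)‖ ≤ M *
      cnt L ((ball (0 : V) (R + ‖a‖) \ ball 0 (R - ‖a‖)) ×ˢ ball (0 : W) (ρ + ‖b‖)) := by
  unfold S
  rw [← (S_summable L hg R _).tsum_sub (S_summable L hg R _)]
  refine norm_tsum_le L ((isBounded_ball.subset Set.sdiff_subset).prod isBounded_ball) _ ?_ ?_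
  · intro l hl
    generalize (l : V × W) = x at *
    obtain ⟨l1, l2⟩ := x
    simp only [Phi, Prod.mk_add_mk, add_zero]
    have e1 := norm_add_le l1 a
    have e3 := norm_sub_le (l1 + a) a
    have e4 := norm_sub_le (l2 + b) b
    rw [add_sub_cancel_right] at e3 e4
    by_cases hb : ρ ≤ ‖l2 + b‖
    · simp [hg _ hb]
    · simp only [Set.mem_prod, Set.mem_sdiff, mem_ball_zero_iff] at hl
      have h2 : ‖l2‖ < ρ + ‖b‖ := by linarith
      have hl' : ¬ (‖l1‖ < R + ‖a‖ ∧ ¬ ‖l1‖ < R - ‖a‖) := fun h => hl ⟨h, h2⟩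
      by_cases h3 : ‖l1‖ < R - ‖a‖
      · rw [Set.indicator_of_mem, Set.indicator_of_mem, sub_self] <;> 
          rw [mem_ball_zero_iff] <;> linarith [norm_nonneg a]
      · have h4 : ¬ ‖l1‖ < R + ‖a‖ := fun h => hl' ⟨h, h3⟩
        rw [Set.indicator_of_notMem, Set.indicator_of_notMem, sub_self] <;>
          rw [mem_ball_zero_iff] <;> linarith [norm_nonneg a]
  · intro l
    generalize (l : V × W) = x at *
    obtain ⟨l1, l2⟩ := x
    simp only [Phi, Prod.mk_add_mk, add_zero, ← sub_mul, norm_mul]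
    calc _ ≤ 1 * ‖g (l2 + b)‖ := by
          gcongr
          by_cases h1 : l1 + a ∈ ball (0 : V) R <;> by_cases h2 : l1 ∈ ball (0 : V) R <;>
            simp only [h1, h2, Set.indicator_of_mem, Set.indicator_of_notMem, not_false_eq_true] <;>
            norm_num
      _ ≤ M := by rw [one_mul]; exact hM _

lemma S_shift_snd {g : W → ℂ} {ρ ε δ : ℝ} (hg : ∀ w, ρ ≤ ‖w‖ → g w = 0) (hδ : δ ≤ 1)
    (hε : 0 ≤ ε) (hu : ∀ w w', dist w w' < δ → dist (g w) (g w') ≤ ε)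
    (b b' : W) (hb : dist b b' < δ) (R : ℝ) : ‖S L g R (0, b) - S L g R (0, b')‖ ≤ ε *
      cnt L (ball (0 : V) (R + 0) ×ˢ ball (0 : W) (ρ + ‖b‖ + 1)) := by
  unfold S
  rw [← (S_summable L hg R _).tsum_sub (S_summable L hg R _)]
  refine norm_tsum_le L (isBounded_ball.prod isBounded_ball) _ ?_ ?_
  · intro l hl
    generalize (l : V × W) = x at *
    obtain ⟨l1, l2⟩ := x
    simp only [Phi, Prod.mk_add_mk, add_zero, ← mul_sub] at hl ⊢
    by_cases h1 : l1 ∈ ball (0 : V) R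
    · have h2 : ¬ ‖l2‖ < ρ + ‖b‖ + 1 := fun h => hl ⟨h1, by simpa using h⟩
      have e3 := norm_sub_le (l2 + b) b
      have e4 := norm_sub_le (l2 + b') b'
      have e5 : ‖b'‖ ≤ ‖b‖ + ‖b' - b‖ := norm_le_norm_add_norm_sub' _ _
      rw [← dist_eq_norm, dist_comm] at e5
      rw [add_sub_cancel_right] at e3 e4
      rw [hg (l2 + b) (by linarith), hg (l2 + b') (by linarith), sub_self, mul_zero]
    · rw [Set.indicator_of_notMem h1, zero_mul]
  · intro l
    generalize (l : V × W) = x at *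
    obtain ⟨l1, l2⟩ := x
    simp only [Phi, Prod.mk_add_mk, add_zero, ← mul_sub, norm_mul]
    by_cases h1 : l1 ∈ ball (0 : V) R
    · rw [Set.indicator_of_mem h1, norm_one, one_mul, ← dist_eq_norm]
      exact hu _ _ (by simpa using hb)
    · rw [Set.indicator_of_notMem h1, norm_zero, zero_mul]; exact hε

lemma S_pointwise {g : W → ℂ} {ρ M : ℝ} (hg : ∀ w, ρ ≤ ‖w‖ → g w = 0) (hM : ∀ w, ‖g w‖ ≤ M)
    (hu : UniformContinuous g) (hdense : Dense (Prod.snd '' (L : Set (V × W)))) (z : V × W) :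
    Tendsto (fun R => (vb V R)⁻¹ • (S L g R z - S L g R 0)) atTop (𝓝 0) := by
  obtain ⟨a, b⟩ := z
  rw [Metric.tendsto_nhds]
  intro ε hε
  obtain ⟨C, hC, hCR⟩ := cnt_ball L (V := V) 0 (ρ + ‖b‖ + 1)
  have hη : 0 < ε / (2 * C) := by positivity
  obtain ⟨δ, hδ, hδu⟩ := Metric.uniformContinuous_iff.1 hu _ hη
  obtain ⟨_, hlb, ⟨l, hl, rfl⟩⟩ := Metric.dense_iff.1 hdense b (min δ 1) (by positivity)
  rw [mem_ball, dist_comm] at hlb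
  have t1 := (cnt_shell L ‖a‖ (ρ + ‖b‖)).const_mul M
  have t2 := (cnt_shell L ‖-l.1‖ (ρ + ‖(0 : W)‖)).const_mul M
  have t3 := t1.add t2
  simp only [mul_zero, add_zero] at t3
  filter_upwards [eventually_gt_atTop 0, hCR, t3.eventually_lt_const (half_pos hε)]
    with R hR h1 h2
  have hv := vb_pos (V := V) hR
  have k1 := S_shift_fst L hg hM a b R
  have k2 := S_shift_snd L hg (min_le_right δ 1) hη.le
    (fun w w' h => (hδu (h.trans_le (min_le_left _ _))).le) b l.2 hlb R
  have k3 := S_shift_fst L hg hM (-l.1) 0 R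
  have k4 : S L g R (-l.1, 0) = S L g R (0, l.2) := by
    rw [← S_add L g R _ ⟨l, hl⟩]
    congr 1
    ext <;> simp
  rw [k4] at k3
  have k5 : ‖S L g R (a, b) - S L g R 0‖ ≤ ‖S L g R (a, b) - S L g R (0, b)‖ +
      ‖S L g R (0, b) - S L g R (0, l.2)‖ + ‖S L g R (0, l.2) - S L g R (0, 0)‖ := by
    refine le_trans (le_of_eq ?_) (norm_add₃_le)
    congr 1
    rw [← Prod.zero_eq_mk]
    ring
  rw [dist_zero_right, norm_smul, norm_inv, Real.norm_of_nonneg hv.le, inv_mul_lt_iff₀ hv]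
  have k6 := mul_le_mul_of_nonneg_left h1 hη.le
  have k7 : ε / (2 * C) * (C * vb V R) = ε / 2 * vb V R := by field_simp
  rw [← mul_div_assoc, ← mul_div_assoc, ← add_div, div_lt_iff₀ hv] at h2
  linarith

lemma Phi_integrable {g : W → ℂ} (hgc : Continuous g) (hgs : HasCompactSupport g) (R : ℝ) :
    Integrable (Phi (V := V) g R) volume := by
  have h1 : Integrable ((ball (0 : V) R).indicator (fun _ => (1 : ℂ))) volume :=
    (integrable_indicator_iff measurableSet_ball).2
      (integrableOn_const measure_ball_lt_top.ne)
  exact h1.mul_prod (hgc.integrable_of_hasCompactSupport hgs)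

lemma Phi_integral (g : W → ℂ) (R : ℝ) :
    ∫ z, Phi (V := V) g R z = (vb V R) • ∫ w, g w := by
  unfold Phi
  rw [Measure.volume_eq_prod, integral_prod_mul ((ball (0 : V) R).indicator
    (fun _ => (1 : ℂ))) g, integral_indicator measurableSet_ball]
  simp [vb]

lemma main_tendsto {g : W → ℂ} (hgc : Continuous g) (hgs : HasCompactSupport g)
    (hdense : Dense (Prod.snd '' (L : Set (V × W)))) :
    Tendsto (fun R => (vb V R)⁻¹ • S L g R 0) atTop
      (𝓝 ((ZLattice.covolume L)⁻¹ • ∫ w, g w)) := by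
  obtain ⟨F, c, hF, hFm, hc, hFp, hFc, hcov, hFfin⟩ := exists_fd L
  obtain ⟨M, hM⟩ := hgc.bounded_above_of_compact_support hgs
  have hM0 := (norm_nonneg _).trans (hM 0)
  obtain ⟨ρ, hρ⟩ := hgs.isCompact.isBounded.subset_ball 0
  have hg : ∀ w, ρ ≤ ‖w‖ → g w = 0 := by
    intro w hw
    by_contra h
    have := hρ (subset_tsupport _ h)
    rw [mem_ball_zero_iff] at this
    linarith
  have hu := hgs.uniformContinuous_of_continuous hgc
  have : Countable L := inferInstance
  -- the sum over a finite set
  have hSfin : ∀ R, ∃ T : Finset L, (∀ z ∈ F, S L g R z = ∑ l ∈ T, Phi g R ((l : V × W) + z)) ∧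
      ∀ l ∉ T, ∀ z ∈ F, Phi g R ((l : V × W) + z) = 0 := by
    intro R
    have hfin := finite_of_bounded L ((isBounded_ball (x := (0 : V)) (r := R + c)).prod
      (isBounded_ball (x := (0 : W)) (r := ρ + c)))
    have h0 : ∀ l ∉ hfin.toFinset, ∀ z ∈ F, Phi g R ((l : V × W) + z) = 0 := by
      intro l hl z hz
      exact Phi_zero' hg R ⟨(hFc z hz).1.le, (hFc z hz).2.le⟩ _ (by simpa using hl)
    refine ⟨hfin.toFinset, fun z hz => ?_, h0⟩
    exact tsum_eq_sum fun l hl => h0 l hl z hz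
  have hint : ∀ R (l : L), IntegrableOn (fun z => Phi g R ((l : V × W) + z)) F := fun R l =>
    ((Phi_integrable hgc hgs R).comp_add_left (l : V × W)).integrableOn
  have hSint : ∀ R, IntegrableOn (S L g R) F := by
    intro R
    obtain ⟨T, hT, -⟩ := hSfin R
    refine IntegrableOn.congr_fun ?_ (fun z hz => (hT z hz).symm) hFm
    exact integrable_finsetSum _ fun l _ => hint R l
  have hSI : ∀ R, ∫ z in F, S L g R z = (vb V R) • ∫ w, g w := by
    intro R
    obtain ⟨T, hT, hT0⟩ := hSfin R
    rw [setIntegral_congr_fun hFm hT, integral_finsetSum _ (fun l _ => hint R l),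
      ← Phi_integral, hF.integral_eq_tsum'' _ (Phi_integrable hgc hgs R), tsum_eq_sum (s := T)]
    · rfl
    · intro l hl
      exact setIntegral_eq_zero_of_forall_eq_zero fun z hz => hT0 l hl z hz
  obtain ⟨C, hC, hCR⟩ := cnt_ball L (V := V) c (ρ + c)
  have hlim : Tendsto (fun R => ∫ z in F, (vb V R)⁻¹ • (S L g R z - S L g R 0)) atTop
      (𝓝 (∫ z in F, (0 : ℂ))) := by
    refine tendsto_integral_filter_of_dominated_convergence (fun _ => 2 * (M * C)) ?_ ?_ ?_ ?_
    · refine Eventually.of_forall fun R => ?_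
      exact (((hSint R).aestronglyMeasurable).sub aestronglyMeasurable_const).const_smul (vb V R)⁻¹
    · filter_upwards [eventually_gt_atTop 0, hCR] with R hR h1
      have hv := vb_pos (V := V) hR
      refine (ae_restrict_iff' hFm).2 (Eventually.of_forall fun z hz => ?_)
      rw [norm_smul, norm_inv, Real.norm_of_nonneg hv.le, inv_mul_le_iff₀ hv]
      have k1 := S_bound L hg hM R ⟨(hFc z hz).1.le, (hFc z hz).2.le⟩
      have k2 := S_bound L hg hM R (c := c) (z := 0) (by simp [hc.le])
      have k3 := norm_sub_le (S L g R z) (S L g R 0)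
      have k4 := mul_le_mul_of_nonneg_left h1 hM0
      linarith
    · exact integrableOn_const hFfin.ne
    · exact Eventually.of_forall fun z => S_pointwise L hg hM hu hdense z
  rw [integral_zero] at hlim
  have h2 := (tendsto_const_nhds (x := (volume.real F)⁻¹ • ∫ w, g w)).sub
    (hlim.const_smul (volume.real F)⁻¹)
  rw [smul_zero, sub_zero, ← hcov] at h2
  refine h2.congr' ?_
  filter_upwards [eventually_gt_atTop 0] with R hR
  have hv := vb_pos (V := V) hR
  rw [integral_smul, integral_sub (hSint R) (integrableOn_const hFfin.ne), hSI, hcov,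
    setIntegral_const]
  rw [smul_sub, smul_sub, smul_smul (vb V R)⁻¹, inv_mul_cancel₀ hv.ne', one_smul, sub_sub_cancel,
    smul_comm, smul_smul (volume.real F)⁻¹, inv_mul_cancel₀ hFp.ne', one_smul]

end Basic
end CPS

/-- For a Euclidean cut-and-project scheme given by a full-rank lattice
`L ⊂ ℝ^d × ℝ^m` (first projection injective on `L`, second projection with dense image) and
`h : ℝ^m → ℂ` continuous with compact support, the Fourier–Bohr coefficient of the weighted
Dirac comb `ω_h = ∑_{(x,x⋆) ∈ L} h(x⋆) δ_x` at any point `(χ, χ⋆)` of the dual lattice `L⁰`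
equals `dens(L) · ȟ(χ⋆)`. -/
theorem fourierTransformable_sap_stmt11 {d m : ℕ}
    (L : Submodule ℤ (EuclideanSpace ℝ (Fin d) × EuclideanSpace ℝ (Fin m)))
    [DiscreteTopology L] [IsZLattice ℝ L]
    (hinj : ∀ p q : L, (p : EuclideanSpace ℝ (Fin d) × EuclideanSpace ℝ (Fin m)).1 =
      (q : EuclideanSpace ℝ (Fin d) × EuclideanSpace ℝ (Fin m)).1 → p = q)
    (hdense : Dense (Prod.snd '' (L : Set (EuclideanSpace ℝ (Fin d) × EuclideanSpace ℝ (Fin m)))))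
    (h : EuclideanSpace ℝ (Fin m) → ℂ) (hh : Continuous h) (hhc : HasCompactSupport h)
    (χ : EuclideanSpace ℝ (Fin d)) (χs : EuclideanSpace ℝ (Fin m))
    (hdual : ∀ p ∈ L, ∃ n : ℤ,
      ⟪χ, (p : EuclideanSpace ℝ (Fin d) × EuclideanSpace ℝ (Fin m)).1⟫
        + ⟪χs, (p : EuclideanSpace ℝ (Fin d) × EuclideanSpace ℝ (Fin m)).2⟫ = (n : ℝ)) :
    Tendsto (fun R : ℝ =>
        ((volume (ball (0 : EuclideanSpace ℝ (Fin d)) R)).toReal)⁻¹ •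
          ∑' l : {y : L //
              (y : EuclideanSpace ℝ (Fin d) × EuclideanSpace ℝ (Fin m)).1
                ∈ ball (0 : EuclideanSpace ℝ (Fin d)) R},
            Complex.exp
                (((-(2 * Real.pi *
                  ⟪χ, (l.1 : EuclideanSpace ℝ (Fin d) × EuclideanSpace ℝ (Fin m)).1⟫)) : ℝ)
                  * Complex.I)
              * h (l.1 : EuclideanSpace ℝ (Fin d) × EuclideanSpace ℝ (Fin m)).2)
      atTop (𝓝 ((ZLattice.covolume L)⁻¹ • 𝓕⁻ h χs)) := by
  let g : EuclideanSpace ℝ (Fin m) → ℂ := fun w =>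
    Complex.exp ((2 * Real.pi * ⟪w, χs⟫ : ℝ) * Complex.I) * h w
  have hgc : Continuous g := by
    refine Continuous.mul ?_ hh
    fun_prop
  have hgs : HasCompactSupport g := hhc.mul_left
  have key := CPS.main_tendsto L hgc hgs hdense
  have hF : 𝓕⁻ h χs = ∫ w, g w := by
    rw [Real.fourierInv_eq']
    rfl
  rw [hF]
  refine key.congr fun R => ?_
  congr 1
  rw [CPS.S]
  have h1 := tsum_subtype {y : L | (y : EuclideanSpace ℝ (Fin d) × EuclideanSpace ℝ (Fin m)).1
                ∈ ball (0 : EuclideanSpace ℝ (Fin d)) R} (fun l : L => Complex.exp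
                (((-(2 * Real.pi *
                  ⟪χ, (l : EuclideanSpace ℝ (Fin d) × EuclideanSpace ℝ (Fin m)).1⟫)) : ℝ)
                  * Complex.I)
              * h (l : EuclideanSpace ℝ (Fin d) × EuclideanSpace ℝ (Fin m)).2)
  refine Eq.trans ?_ h1.symm
  refine tsum_congr fun l => ?_
  rw [add_zero, CPS.Phi]
  by_cases hl : (l : EuclideanSpace ℝ (Fin d) × EuclideanSpace ℝ (Fin m)).1
                ∈ ball (0 : EuclideanSpace ℝ (Fin d)) R
  · rw [Set.indicator_of_mem hl, Set.indicator_of_mem (by exact hl), one_mul]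
    change Complex.exp _ * _ = _
    congr 1
    obtain ⟨n, hn⟩ := hdual l l.2
    rw [Complex.exp_eq_exp_iff_exists_int]
    refine ⟨n, ?_⟩
    rw [← eq_sub_iff_add_eq'] at hn
    rw [real_inner_comm, hn]
    push_cast
    ring
  · rw [Set.indicator_of_notMem hl, Set.indicator_of_notMem (by exact hl), zero_mul]
end
end
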